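/- For each i ∈ ℕ let nᵢ ∈ ℕ, let (θ^i_j)_{j≥1} be a sequence of Lipschitz maps θ^i_j : ℝ^{nᵢ} → ℝ^{nᵢ}, let Wᵢ be a countable collection of weights in ℝ^{nᵢ}, let U ⊆ ℝ be an open interval, and let φᵢ : U → ℝ^{nᵢ} be a nondegenerate analytic map. Let μ be an Ahlfors regular measure on ℝ with U ∩ supp μ ≠ ∅. Then the Hausdorff dimension of ⋂_{i≥1} ⋂_{r ∈ Wᵢ} ⋂_{j≥1} φᵢ⁻¹(Bad_{θ^i_j}(r)) ∩ supp μ equals the Hausdorff dimension of supp μ. -/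

import Mathlib

/- STATEMENT 1: Corollary (curves): the countable intersection of preimages of
inhomogeneous bad sets along analytic nondegenerate curves has full Hausdorff
dimension in the support of any Ahlfors regular measure. -/

open Filter Set MeasureTheory
open scoped ENNReal

/-- distance from `y` to the nearest integer, `|y|_ℤ`. -/
noncomputable def distInt (y : ℝ) : ℝ := |y - round y|

/-- `wpow t s = t ^ (1/s)`, with the convention `t ^ (1/0) := 0`. -/
noncomputable def wpow (t s : ℝ) : ℝ := if s = 0 then 0 else t ^ (1 / s)

/-- `liminf` over `q ∈ ℤ \ {0}`, `|q| → ∞`, of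
`max_{1 ≤ i ≤ n} |q·yᵢ − θᵢ|_ℤ^{1/rᵢ} · |q|` (valued in `ℝ≥0∞`). -/
noncomputable def badLiminf {n : ℕ} (r y θv : Fin n → ℝ) : ℝ≥0∞ :=
  Filter.liminf
    (fun q : ℤ =>
      ENNReal.ofReal ((⨆ i, wpow (distInt ((q : ℝ) * y i - θv i)) (r i)) * |(q : ℝ)|))
    (Filter.comap (fun q : ℤ => |q|) Filter.atTop)

/-- support of a measure on `ℝ`. -/
def msupport (μ : Measure ℝ) : Set ℝ := {x | ∀ ρ > 0, 0 < μ (Metric.ball x ρ)}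

namespace BadCurve

open scoped Matrix

section

/-! ### Binary trees of balls -/

/-- The binary sequences agreeing with `ω` in the first `n` places. -/
def cyl (ω : ℕ → Bool) (n : ℕ) : Set (ℕ → Bool) := {ω' | ∀ i < n, ω' i = ω i}

lemma cyl_anti (ω : ℕ → Bool) {m n : ℕ} (h : m ≤ n) : cyl ω n ⊆ cyl ω m :=
  fun _ h' i hi => h' i (hi.trans_le h)

lemma mem_cyl_symm {ω ω' : ℕ → Bool} {n : ℕ} (h : ω' ∈ cyl ω n) : ω ∈ cyl ω' n :=
  fun i hi => (h i hi).symm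

lemma cyl_eq_of_mem {ω ω' : ℕ → Bool} {n : ℕ} (h : ω' ∈ cyl ω n) : cyl ω' n = cyl ω n := by
  ext η
  exact ⟨fun h' i hi => (h' i hi).trans (h i hi), fun h' i hi => (h' i hi).trans (h i hi).symm⟩

lemma cyl_zero (ω : ℕ → Bool) : cyl ω 0 = univ := by
  ext; simp [cyl]

/-- The fair coin. -/
noncomputable def coin : Measure Bool := (PMF.uniformOfFintype Bool).toMeasure

instance : IsProbabilityMeasure coin := by unfold coin; infer_instance

lemma coin_singleton (b : Bool) : coin {b} = 2⁻¹ := by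
  unfold coin
  rw [PMF.toMeasure_apply_singleton _ _ (MeasurableSet.singleton _)]
  simp

/-- The fair coin tossing measure. -/
noncomputable def coins : Measure (ℕ → Bool) := Measure.infinitePi fun _ => coin

instance : IsProbabilityMeasure coins := by unfold coins; infer_instance

lemma cyl_eq_pi (ω : ℕ → Bool) (n : ℕ) :
    cyl ω n = Set.pi (Finset.range n : Set ℕ) fun i => {ω i} := by
  ext; simp [cyl, Set.mem_pi]

lemma measurableSet_cyl (ω : ℕ → Bool) (n : ℕ) : MeasurableSet (cyl ω n) := by
  rw [cyl_eq_pi]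
  exact MeasurableSet.pi (Finset.countable_toSet _) fun _ _ => MeasurableSet.singleton _

lemma coins_cyl (ω : ℕ → Bool) (n : ℕ) : coins (cyl ω n) = 2⁻¹ ^ n := by
  rw [cyl_eq_pi, coins, Measure.infinitePi_pi _ fun _ _ => MeasurableSet.singleton _]
  simp [coin_singleton]

/-- A set of binary sequences determined by the first `n` places. -/
def DepOn (n : ℕ) (E : Set (ℕ → Bool)) : Prop := ∀ ω ∈ E, cyl ω n ⊆ E

lemma DepOn.mem_iff {n : ℕ} {E : Set (ℕ → Bool)} (hE : DepOn n E) {ω ω' : ℕ → Bool}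
    (h : ω' ∈ cyl ω n) : ω' ∈ E ↔ ω ∈ E :=
  ⟨fun h' => hE _ h' (mem_cyl_symm h), fun h' => hE _ h' h⟩

lemma DepOn.mono {m n : ℕ} (h : m ≤ n) {E : Set (ℕ → Bool)} (hE : DepOn m E) : DepOn n E :=
  fun ω hω => (cyl_anti ω h).trans (hE ω hω)

lemma DepOn.compl {n : ℕ} {E : Set (ℕ → Bool)} (hE : DepOn n E) : DepOn n Eᶜ :=
  fun _ hω _ hω' h => hω (hE _ h (mem_cyl_symm hω'))

lemma DepOn.inter {n : ℕ} {E F : Set (ℕ → Bool)} (hE : DepOn n E) (hF : DepOn n F) :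
    DepOn n (E ∩ F) :=
  fun ω hω _ h => ⟨hE ω hω.1 h, hF ω hω.2 h⟩

lemma depOn_cyl (ω : ℕ → Bool) (n : ℕ) : DepOn n (cyl ω n) :=
  fun _ h => (cyl_eq_of_mem h).subset

/-- The extension by `false` of a finite binary sequence. -/
def ext0 {n : ℕ} (s : Fin n → Bool) : ℕ → Bool := fun i => if h : i < n then s ⟨i, h⟩ else false

lemma mem_cyl_ext0 (ω : ℕ → Bool) (n : ℕ) : ω ∈ cyl (ext0 fun i : Fin n => ω i) n := by
  intro i hi
  simp [ext0, hi]

lemma DepOn.eq_iUnion {n : ℕ} {E : Set (ℕ → Bool)} (hE : DepOn n E) :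
    E = ⋃ s ∈ {s : Fin n → Bool | ext0 s ∈ E}, cyl (ext0 s) n := by
  ext ω
  simp only [mem_iUnion, mem_ofPred_eq, exists_prop]
  refine ⟨fun h => ⟨fun i => ω i, hE ω h (mem_cyl_symm (mem_cyl_ext0 ω n)), mem_cyl_ext0 ω n⟩, ?_⟩
  rintro ⟨s, hs, h⟩
  exact hE _ hs h

lemma DepOn.measurableSet {n : ℕ} {E : Set (ℕ → Bool)} (hE : DepOn n E) : MeasurableSet E := by
  rw [hE.eq_iUnion]
  exact MeasurableSet.biUnion (Set.to_countable _) fun s _ => measurableSet_cyl _ _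

lemma disjoint_cyl_ext0 {n : ℕ} {s t : Fin n → Bool} (h : s ≠ t) :
    Disjoint (cyl (ext0 s) n) (cyl (ext0 t) n) := by
  rw [Set.disjoint_left]
  intro ω h1 h2
  apply h
  ext i
  have := (h1 i i.2).symm.trans (h2 i i.2)
  simp only [ext0, i.2, dite_true] at this
  rw [this]

/-- A bound for the conditional probabilities gives a bound for the probability. -/
lemma coins_inter_le {n : ℕ} {E : Set (ℕ → Bool)} (hE : DepOn n E) (A : Set (ℕ → Bool)) (κ : ℝ≥0∞)
    (h : ∀ ω ∈ E, coins (A ∩ cyl ω n) ≤ κ * coins (cyl ω n)) :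
    coins (A ∩ E) ≤ κ * coins E := by
  classical
  set S : Finset (Fin n → Bool) := Finset.univ.filter fun s => ext0 s ∈ E with hS
  have hES : E = ⋃ s ∈ S, cyl (ext0 s) n := by
    conv_lhs => rw [hE.eq_iUnion]
    simp [hS]
  have h1 : coins E = ∑ s ∈ S, coins (cyl (ext0 s) n) := by
    conv_lhs => rw [hES]
    exact measure_biUnion_finset (fun s _ t _ hst => disjoint_cyl_ext0 hst)
      fun s _ => measurableSet_cyl _ _
  have h2 : A ∩ E = ⋃ s ∈ S, A ∩ cyl (ext0 s) n := by
    conv_lhs => rw [hES]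
    simp [inter_iUnion]
  rw [h1, h2, Finset.mul_sum]
  refine (measure_biUnion_finset_le _ _).trans (Finset.sum_le_sum fun s hs => h _ ?_)
  simpa [hS] using hs

/-- A binary tree of balls with ratio `β` and root radius `ρ`. -/
structure IsTree (β ρ : ℝ) (c : ℕ → (ℕ → Bool) → ℝ) : Prop where
  dep : ∀ n ω ω', ω' ∈ cyl ω n → c n ω' = c n ω
  nest : ∀ n ω, |c (n + 1) ω - c n ω| + β ^ (n + 1) * ρ ≤ β ^ n * ρ
  sep : ∀ n ω ω', ω' ∈ cyl ω n → ω n ≠ ω' n →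
    3 * (β ^ (n + 1) * ρ) ≤ |c (n + 1) ω - c (n + 1) ω'|

section Tree

variable {β ρ : ℝ} {c : ℕ → (ℕ → Bool) → ℝ}

/-- The ball of the tree at level `n` along `ω`. -/
def node (β ρ : ℝ) (c : ℕ → (ℕ → Bool) → ℝ) (n : ℕ) (ω : ℕ → Bool) : Set ℝ :=
  Metric.closedBall (c n ω) (β ^ n * ρ)

/-- The limit point of a branch. -/
noncomputable def limPt (c : ℕ → (ℕ → Bool) → ℝ) (ω : ℕ → Bool) : ℝ := limUnder atTop fun n => c n ω

lemma IsTree.node_succ (h : IsTree β ρ c) (n : ℕ) (ω : ℕ → Bool) :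
    node β ρ c (n + 1) ω ⊆ node β ρ c n ω := by
  apply Metric.closedBall_subset_closedBall'
  rw [Real.dist_eq]
  linarith [h.nest n ω]

lemma IsTree.node_anti (h : IsTree β ρ c) {m n : ℕ} (hmn : m ≤ n) (ω : ℕ → Bool) :
    node β ρ c n ω ⊆ node β ρ c m ω := by
  induction hmn with
  | refl => exact subset_rfl
  | step _ ih => exact (h.node_succ _ ω).trans ih

lemma IsTree.node_congr (h : IsTree β ρ c) {n : ℕ} {ω ω' : ℕ → Bool} (hω : ω' ∈ cyl ω n) :
    node β ρ c n ω' = node β ρ c n ω := by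
  unfold node; rw [h.dep n ω ω' hω]

lemma IsTree.tendsto (h : IsTree β ρ c) (hβ0 : 0 < β) (hβ1 : β < 1) (hρ : 0 < ρ)
    (ω : ℕ → Bool) : Tendsto (fun n => c n ω) atTop (nhds (limPt c ω)) := by
  have : CauchySeq fun n => c n ω := by
    refine cauchySeq_of_le_geometric β ρ hβ1 fun n => ?_
    rw [Real.dist_eq, abs_sub_comm]
    have := h.nest n ω
    have h2 : 0 ≤ β ^ (n + 1) * ρ := by positivity
    linarith
  exact this.tendsto_limUnder

lemma IsTree.limPt_mem (h : IsTree β ρ c) (hβ0 : 0 < β) (hβ1 : β < 1) (hρ : 0 < ρ)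
    (n : ℕ) (ω : ℕ → Bool) : limPt c ω ∈ node β ρ c n ω := by
  refine Metric.isClosed_closedBall.mem_of_tendsto (h.tendsto hβ0 hβ1 hρ ω) ?_
  filter_upwards [eventually_ge_atTop n] with m hm
  apply h.node_anti hm ω
  apply Metric.mem_closedBall_self
  positivity

/-- Points in different nodes of the same level are separated. -/
lemma IsTree.sep_of_notMem (h : IsTree β ρ c) (hβ0 : 0 < β) (hβ1 : β < 1) (hρ : 0 < ρ)
    {n : ℕ} {ω ω' : ℕ → Bool} (hω : ω' ∉ cyl ω n) {x y : ℝ} (hx : x ∈ node β ρ c n ω)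
    (hy : y ∈ node β ρ c n ω') : β ^ n * ρ ≤ |x - y| := by
  classical
  have hex : ∃ i, ω' i ≠ ω i ∧ i < n := by
    simp only [cyl, mem_ofPred_eq, not_forall] at hω
    obtain ⟨i, hi, h⟩ := hω
    exact ⟨i, h, hi⟩
  set i := Nat.find hex with hi
  obtain ⟨h1, h2⟩ : ω' i ≠ ω i ∧ i < n := Nat.find_spec hex
  have h3 : ω' ∈ cyl ω i := by
    intro j hj
    by_contra hne
    exact Nat.find_min hex hj ⟨hne, hj.trans h2⟩
  have h4 := h.sep i ω ω' h3 h1.symm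
  have hx' := h.node_anti (Nat.succ_le_of_lt h2) ω hx
  have hy' := h.node_anti (Nat.succ_le_of_lt h2) ω' hy
  simp only [node, Metric.mem_closedBall, Real.dist_eq, Nat.succ_eq_add_one] at hx' hy'
  have h5 : β ^ n * ρ ≤ β ^ (i + 1) * ρ := by
    apply mul_le_mul_of_nonneg_right _ hρ.le
    exact pow_le_pow_of_le_one hβ0.le hβ1.le (Nat.succ_le_of_lt h2)
  have h6 : |c (i + 1) ω - c (i + 1) ω'| ≤ |x - c (i + 1) ω| + |x - y| + |y - c (i + 1) ω'| := by
    have e : c (i + 1) ω - c (i + 1) ω' = -(x - c (i+1) ω) + (x - y) + (y - c (i + 1) ω') := by ring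
    rw [e]
    refine (abs_add_le _ _).trans (add_le_add_left ((abs_add_le _ _).trans ?_) _)
    rw [abs_neg]
  linarith

end Tree

end

/-! ### An abstract quantitative nondivergence estimate on trees -/

/-- `y` is marked by a chain in `Q`. -/
def Marked {ι : Type*} [PartialOrder ι] (ψ : ι → ℝ → ℝ) (ε : ℝ) (Q : Set ι) (y : ℝ) : Prop :=
  ∃ T : Set ι, T ⊆ Q ∧ IsChain (· ≤ ·) T ∧ (∀ V ∈ T, ψ V y ≤ 1) ∧
    ∀ W ∈ Q, (∀ V ∈ T, V ≤ W ∨ W ≤ V) → ε ≤ ψ W y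

lemma coins_unmarked_le {ι : Type*} [PartialOrder ι] {β ρ : ℝ} {c : ℕ → (ℕ → Bool) → ℝ}
    (h : IsTree β ρ c) (hβ0 : 0 < β) (hβ1 : β < 1) (hρ : 0 < ρ)
    (rk : ι → ℕ) (hrk : StrictMono rk) (ψ : ι → ℝ → ℝ) {ε : ℝ} (hε : ε ≤ 1) (κ : ℝ≥0∞)
    (D : Set ℝ) (hD : ∀ ω, node β ρ c 0 ω ⊆ D) (hψ : ∀ V, ContinuousOn (ψ V) D)
    (hgood : ∀ V n ω, (∃ x ∈ node β ρ c n ω, 1 ≤ ψ V x) →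
      coins ({ω' | ψ V (limPt c ω') < ε} ∩ cyl ω n) ≤ κ * coins (cyl ω n))
    (m : ℕ) : ∀ (Q : Set ι) (R : Finset ℕ), R.card ≤ m → (∀ V ∈ Q, rk V ∈ R) →
      ∀ n ω, (∀ V ∈ Q, ∃ x ∈ node β ρ c n ω, 1 ≤ ψ V x) →
      coins ({ω' | ¬ Marked ψ ε Q (limPt c ω')} ∩ cyl ω n) ≤ (4 ^ m * κ) * coins (cyl ω n) := by
  induction m with
  | zero =>
    intro Q R hR hQ n ω _
    have hR' : R = ∅ := Finset.card_eq_zero.mp (Nat.le_zero.mp hR)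
    have : {ω' | ¬ Marked ψ ε Q (limPt c ω')} ∩ cyl ω n = ∅ := by
      rw [eq_empty_iff_forall_notMem]
      rintro ω' ⟨h1, -⟩
      refine h1 ⟨∅, empty_subset _, IsChain.empty, by simp, fun W hW => ?_⟩
      have := hQ W hW
      simp [hR'] at this
    rw [this]; simp
  | succ m ih =>
    intro Q R hR hQ n ω hsup
    set A : ℕ → Set (ℕ → Bool) := fun k => {ω' | ∃ V ∈ Q, ∀ x ∈ node β ρ c k ω', ψ V x < 1} with hA
    have hAdep : ∀ k, DepOn k (A k) := by
      rintro k ω₁ ⟨V, hV, h1⟩ ω₂ h2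
      refine ⟨V, hV, ?_⟩
      rwa [h.node_congr h2]
    have hAmono : ∀ {k l}, k ≤ l → A k ⊆ A l := by
      rintro k l hkl ω₁ ⟨V, hV, h1⟩
      exact ⟨V, hV, fun x hx => h1 x (h.node_anti hkl _ hx)⟩
    set E : ℕ → Set (ℕ → Bool) := fun k => if n ≤ k then A (k + 1) ∩ (A k)ᶜ ∩ cyl ω n else ∅ with hE
    have hEdep : ∀ k, DepOn (k + 1) (E k) := by
      intro k
      by_cases hk : n ≤ k
      · simp only [hE, hk, if_true]
        exact ((hAdep _).inter ((hAdep k).compl.mono (Nat.le_succ k))).inter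
          ((depOn_cyl ω n).mono (hk.trans (Nat.le_succ k)))
      · simp only [hE, hk, if_false]
        exact fun _ h => h.elim
    have hEsub : ∀ k, E k ⊆ cyl ω n := by
      intro k
      by_cases hk : n ≤ k
      · simp only [hE, hk, if_true]; exact inter_subset_right
      · simp only [hE, hk, if_false]; exact empty_subset _
    have hEdisj : Pairwise (Function.onFun Disjoint E) := by
      have key : ∀ k l, k < l → Disjoint (E k) (E l) := by
        intro k l hkl
        rw [Set.disjoint_left]
        intro ω₁ h1 h2
        by_cases hk : n ≤ k
        · have hl : n ≤ l := hk.trans hkl.le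
          simp only [hE, hk, hl, if_true] at h1 h2
          exact h2.1.2 (hAmono hkl h1.1.1)
        · simp [hE, hk] at h1
      intro k l hkl
      rcases lt_or_gt_of_ne hkl with h1 | h1
      · exact key k l h1
      · exact (key l k h1).symm
    -- a branch that never meets `A` is marked
    have hcover : {ω' | ¬ Marked ψ ε Q (limPt c ω')} ∩ cyl ω n ⊆
        ⋃ k, {ω' | ¬ Marked ψ ε Q (limPt c ω')} ∩ E k := by
      rintro ω₁ ⟨h1, h2⟩
      by_contra hcon
      have hnA : ∀ k, n ≤ k → ω₁ ∉ A k := by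
        intro k hk
        induction k, hk using Nat.le_induction with
        | base =>
          rintro ⟨V, hV, h3⟩
          obtain ⟨x, hx, h4⟩ := hsup V hV
          rw [← h.node_congr h2] at hx
          exact absurd (h3 x hx) (not_lt.mpr h4)
        | succ k hk ihk =>
          intro h3
          apply hcon
          rw [mem_iUnion]
          refine ⟨k, h1, ?_⟩
          simp only [hE, hk, if_true]
          exact ⟨⟨h3, ihk⟩, h2⟩
      refine h1 ⟨∅, empty_subset _, IsChain.empty, by simp, fun W hW _ => hε.trans ?_⟩
      have h3 : ∀ k, ∃ x ∈ node β ρ c (n + k) ω₁, 1 ≤ ψ W x := by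
        intro k
        by_contra hc
        push Not at hc
        exact hnA (n + k) (Nat.le_add_right _ _) ⟨W, hW, hc⟩
      choose x hx hx1 using h3
      have hlim : Tendsto x atTop (nhds (limPt c ω₁)) := by
        rw [tendsto_iff_dist_tendsto_zero]
        refine squeeze_zero (fun _ => dist_nonneg) (g := fun k => 2 * (β ^ (n + k) * ρ)) ?_ ?_
        · intro k
          have h5 := hx k
          have h6 := h.limPt_mem hβ0 hβ1 hρ (n + k) ω₁
          rw [node, Metric.mem_closedBall] at h5 h6
          have := dist_triangle_right (x k) (limPt c ω₁) (c (n + k) ω₁)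
          linarith
        · have h7 : Tendsto (fun k => β ^ (n + k)) atTop (nhds 0) :=
            (tendsto_pow_atTop_nhds_zero_of_lt_one hβ0.le hβ1).comp
              (tendsto_add_atTop_nat n |>.congr fun k => by rw [add_comm])
          simpa using (h7.mul_const ρ).const_mul 2
      have hmem : ∀ k, x k ∈ D := fun k => hD ω₁ (h.node_anti (Nat.zero_le _) _ (hx k))
      have hcont := (hψ W) _ (hD ω₁ (h.limPt_mem hβ0 hβ1 hρ 0 ω₁))
      have := hcont.tendsto.comp (tendsto_nhdsWithin_iff.mpr ⟨hlim, Eventually.of_forall hmem⟩)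
      exact ge_of_tendsto' this hx1
    -- the estimate on each node where some `ψ V` becomes small
    have hloc : ∀ k, coins ({ω' | ¬ Marked ψ ε Q (limPt c ω')} ∩ E k) ≤
        (4 ^ (m + 1) * κ) * coins (E k) := by
      intro k
      refine coins_inter_le (hEdep k) _ _ fun ω₁ hω₁ => ?_
      by_cases hk : n ≤ k
      swap
      · simp [hE, hk] at hω₁
      simp only [hE, hk, if_true] at hω₁
      obtain ⟨⟨⟨V, hV, hV1⟩, hnA⟩, hcy⟩ := hω₁
      set QV : Set ι := {W ∈ Q | (V ≤ W ∨ W ≤ V) ∧ W ≠ V} with hQV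
      have h1 := ih QV (R.erase (rk V)) (by
          rw [Finset.card_erase_of_mem (hQ V hV)]; omega) (by
          rintro W ⟨hW, hc, hne⟩
          refine Finset.mem_erase.mpr ⟨?_, hQ W hW⟩
          rcases hc with hc | hc
          · exact (hrk (lt_of_le_of_ne hc hne.symm)).ne'
          · exact (hrk (lt_of_le_of_ne hc hne)).ne) k ω₁ (by
          rintro W ⟨hW, -⟩
          by_contra hc
          push Not at hc
          exact hnA ⟨W, hW, hc⟩)
      have h2 := hgood V k ω₁ (by
          by_contra hc
          push Not at hc
          exact hnA ⟨V, hV, hc⟩)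
      have hsub : {ω' | ¬ Marked ψ ε Q (limPt c ω')} ∩ cyl ω₁ (k + 1) ⊆
          ({ω' | ¬ Marked ψ ε QV (limPt c ω')} ∩ cyl ω₁ k) ∪
            ({ω' | ψ V (limPt c ω') < ε} ∩ cyl ω₁ k) := by
        rintro ω₂ ⟨h3, h4⟩
        have h4' := cyl_anti ω₁ (Nat.le_succ k) h4
        by_contra hc
        rw [mem_union, not_or] at hc
        obtain ⟨hc1, hc2⟩ := hc
        have hM : Marked ψ ε QV (limPt c ω₂) := by
          by_contra hh; exact hc1 ⟨hh, h4'⟩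
        have hψV : ε ≤ ψ V (limPt c ω₂) := by
          by_contra hh; exact hc2 ⟨not_le.mp hh, h4'⟩
        obtain ⟨T, hT, hTc, hT1, hT2⟩ := hM
        refine h3 ⟨insert V T, ?_, ?_, ?_, ?_⟩
        · exact insert_subset hV fun W hW => (hT hW).1
        · exact hTc.insert fun W hW _ => (hT hW).2.1
        · rintro W (rfl | hW)
          · apply le_of_lt (hV1 _ _)
            rw [← h.node_congr h4]
            exact h.limPt_mem hβ0 hβ1 hρ _ _
          · exact hT1 W hW
        · intro W hW hcomp
          by_cases hWV : W = V
          · rw [hWV]; exact hψV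
          · exact hT2 W ⟨hW, hcomp V (mem_insert _ _), hWV⟩
              fun V' hV' => hcomp V' (mem_insert_of_mem _ hV')
      calc coins ({ω' | ¬ Marked ψ ε Q (limPt c ω')} ∩ cyl ω₁ (k + 1))
          ≤ 4 ^ m * κ * coins (cyl ω₁ k) + κ * coins (cyl ω₁ k) :=
            (measure_mono hsub).trans ((measure_union_le _ _).trans (add_le_add h1 h2))
        _ = (2 * (4 ^ m + 1)) * (κ * coins (cyl ω₁ (k + 1))) := by
            rw [coins_cyl, coins_cyl, pow_succ]
            have : (2 : ℝ≥0∞) * 2⁻¹ = 1 := ENNReal.mul_inv_cancel (by simp) (by simp)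
            calc 4 ^ m * κ * 2⁻¹ ^ k + κ * 2⁻¹ ^ k = (4 ^ m + 1) * κ * 2⁻¹ ^ k * 1 := by ring
              _ = _ := by rw [← this]; ring
        _ ≤ 4 ^ (m + 1) * (κ * coins (cyl ω₁ (k + 1))) := by
            gcongr
            have : (1 : ℝ≥0∞) ≤ 4 ^ m := one_le_pow₀ (by norm_num)
            calc (2 : ℝ≥0∞) * (4 ^ m + 1) ≤ 2 * (4 ^ m + 4 ^ m) := by gcongr
              _ = 4 ^ (m + 1) := by ring
        _ = _ := by rw [mul_assoc]
    calc coins ({ω' | ¬ Marked ψ ε Q (limPt c ω')} ∩ cyl ω n)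
        ≤ ∑' k, coins ({ω' | ¬ Marked ψ ε Q (limPt c ω')} ∩ E k) :=
          (measure_mono hcover).trans (measure_iUnion_le _)
      _ ≤ ∑' k, (4 ^ (m + 1) * κ) * coins (E k) := ENNReal.tsum_le_tsum hloc
      _ = (4 ^ (m + 1) * κ) * coins (⋃ k, E k) := by
          rw [ENNReal.tsum_mul_left, measure_iUnion hEdisj fun k => (hEdep k).measurableSet]
      _ ≤ (4 ^ (m + 1) * κ) * coins (cyl ω n) := by
          gcongr
          exact iUnion_subset hEsub

/-! ### Divided differences -/

lemma exists_iterate_deriv_eq_zero {D J : Set ℝ} (hJD : J ⊆ D) (hJ : J.OrdConnected) (k : ℕ) :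
    ∀ (g : ℝ → ℝ) (_ : AnalyticOnNhd ℝ g D) (x : Fin (k + 1) → ℝ) (_ : StrictMono x)
      (_ : ∀ i, x i ∈ J) (_ : ∀ i, g (x i) = 0), ∃ ξ ∈ J, deriv^[k] g ξ = 0 := by
  induction k with
  | zero => exact fun g _ x _ hJ h0 => ⟨x 0, hJ 0, h0 0⟩
  | succ k ih =>
    intro g hg x hx hxJ h0
    have h1 : ∀ i : Fin (k + 1), ∃ ξ ∈ Ioo (x i.castSucc) (x i.succ), deriv g ξ = 0 := by
      intro i
      refine exists_deriv_eq_zero (hx Fin.castSucc_lt_succ) ?_ ((h0 _).trans (h0 _).symm)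
      exact hg.continuousOn.mono ((hJ.out (hxJ _) (hxJ _)).trans hJD)
    choose ξ hξ hξ0 using h1
    have hmono : StrictMono ξ := by
      intro i j hij
      have h2 : x i.succ ≤ x j.castSucc := hx.monotone (by
        rw [Fin.le_iff_val_le_val]; simp; exact hij)
      exact (hξ i).2.trans_le (h2.trans (hξ j).1.le)
    obtain ⟨η, hη, h3⟩ := ih (deriv g) hg.deriv ξ hmono
      (fun i => hJ.out (hxJ _) (hxJ _) (Ioo_subset_Icc_self (hξ i))) hξ0
    exact ⟨η, hη, by rwa [Function.iterate_succ_apply]⟩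

lemma iterate_deriv_sub_polynomial {D : Set ℝ} {g : ℝ → ℝ} (hg : AnalyticOnNhd ℝ g D)
    (P : Polynomial ℝ) (k : ℕ) {x : ℝ} (hx : x ∈ D) :
    deriv^[k] (fun y => g y - P.eval y) x =
        deriv^[k] g x - (Polynomial.derivative^[k] P).eval x := by
  rw [← iteratedDeriv_eq_iterate, ← iteratedDeriv_eq_iterate]
  have h1 : ContDiffAt ℝ k g x := (hg x hx).contDiffAt
  have h2 : ContDiffAt ℝ k (fun y => P.eval y) x :=
    (AnalyticOnNhd.eval_polynomial (𝕜 := ℝ) P (A := ℝ) x (mem_univ _)).contDiffAt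
  have h3 : (fun y => g y - P.eval y) = g - fun y => P.eval y := rfl
  rw [h3, iteratedDeriv_sub h1 h2]
  congr 1
  rw [iteratedDeriv_eq_iterate]
  clear h1 h2 h3
  induction k generalizing P with
  | zero => rfl
  | succ k ih =>
    have h4 : deriv (fun y => P.eval y) = fun y => (Polynomial.derivative P).eval y :=
      funext fun y => P.deriv
    rw [Function.iterate_succ_apply, Function.iterate_succ_apply, ← ih, h4]

/-- The mean value theorem for divided differences. -/
lemma exists_iterate_deriv_eq_divided {D J : Set ℝ} (hJD : J ⊆ D) (hJ : J.OrdConnected) {g : ℝ → ℝ}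
    (hg : AnalyticOnNhd ℝ g D) {k : ℕ} (s : Finset ℝ) (hs : s.card = k + 1) (hsJ : ∀ x ∈ s, x ∈ J) :
    ∃ ξ ∈ J, deriv^[k] g ξ = k.factorial * ∑ x ∈ s, g x / ∏ y ∈ s.erase x, (x - y) := by
  set P := Lagrange.interpolate s id g with hP
  have hinj : Set.InjOn (id : ℝ → ℝ) s := Set.injOn_id _
  have h1 : AnalyticOnNhd ℝ (fun y => g y - P.eval y) D := fun y hy =>
    (hg y hy).sub (by
      have := AnalyticOnNhd.eval_polynomial (𝕜 := ℝ) P (A := ℝ)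
      exact this y (mem_univ _))
  obtain ⟨ξ, hξ, h0⟩ := exists_iterate_deriv_eq_zero hJD hJ k _ h1 (s.orderEmbOfFin hs)
    (s.orderEmbOfFin hs).strictMono (fun i => hsJ _ (Finset.orderEmbOfFin_mem s hs i)) (fun i => by
      have := Lagrange.eval_interpolate_at_node g hinj (Finset.orderEmbOfFin_mem s hs i)
      simp only [id] at this
      rw [hP, this, sub_self])
  refine ⟨ξ, hξ, ?_⟩
  rw [iterate_deriv_sub_polynomial hg P k (hJD hξ), sub_eq_zero] at h0
  rw [h0, hP, Lagrange.iterate_derivative_interpolate g hinj (by omega), hs]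
  simp [Polynomial.eval_finsetSum]

section

/-! ### Finite type and a good-function estimate -/

section Good

variable {ι : Type*} [Fintype ι]

/-- The linear combination of the functions `b i` with coefficients `a i`. -/
noncomputable def combo (b : ι → ℝ → ℝ) (a : ι → ℝ) (x : ℝ) : ℝ := ∑ i, a i * b i x

lemma combo_analytic {b : ι → ℝ → ℝ} {D : Set ℝ} (hb : ∀ i, AnalyticOnNhd ℝ (b i) D) (a : ι → ℝ) :
    AnalyticOnNhd ℝ (combo b a) D := by
  intro x hx
  exact Finset.analyticAt_fun_sum _ fun i _ => analyticAt_const.mul (hb i x hx)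

lemma iterate_deriv_combo {b : ι → ℝ → ℝ} {D : Set ℝ} (hb : ∀ i, AnalyticOnNhd ℝ (b i) D)
    (a : ι → ℝ) (k : ℕ) {x : ℝ} (hx : x ∈ D) :
    deriv^[k] (combo b a) x = ∑ i, a i * deriv^[k] (b i) x := by
  have h1 : combo b a = ∑ i, fun x => a i * b i x := by
    ext y; simp [combo]
  rw [← iteratedDeriv_eq_iterate, h1, iteratedDeriv_sum]
  · refine Finset.sum_congr rfl fun i _ => ?_
    rw [iteratedDeriv_const_mul (a i) (hb i x hx).contDiffAt, iteratedDeriv_eq_iterate]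
  · exact fun i _ => contDiffAt_const.mul (hb i x hx).contDiffAt

lemma exists_jet_bound {b : ι → ℝ → ℝ} {D : Set ℝ} (hD : IsPreconnected D)
    (hb : ∀ i, AnalyticOnNhd ℝ (b i) D) {x₀ : ℝ} (hx₀ : x₀ ∈ D) :
    ∃ N : ℕ, ∃ C : ℝ, 0 ≤ C ∧ ∀ a : ι → ℝ, ∃ a' : ι → ℝ, (∀ x ∈ D, combo b a x = combo b a' x) ∧
      ∀ M : ℝ, 0 ≤ M → (∀ k < N, |deriv^[k] (combo b a') x₀| ≤ M) → ‖a'‖ ≤ C * M := by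
  classical
  let T : (n : ℕ) → (ι → ℝ) →ₗ[ℝ] (Fin n → ℝ) := fun n =>
    { toFun := fun a k => ∑ i, a i * deriv^[(k : ℕ)] (b i) x₀
      map_add' := by
        intro a a'; ext k; simp [add_mul, Finset.sum_add_distrib]
      map_smul' := by
        intro c a; ext k; simp [mul_assoc, Finset.mul_sum] }
  have hT : ∀ n a (k : Fin n), T n a k = deriv^[(k : ℕ)] (combo b a) x₀ := fun n a k =>
    (iterate_deriv_combo hb a k hx₀).symm
  have hker : ∀ n a, a ∈ LinearMap.ker (T n) ↔ ∀ k < n, deriv^[k] (combo b a) x₀ = 0 := by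
    intro n a
    rw [LinearMap.mem_ker]
    constructor
    · intro h k hk
      have := congrFun h ⟨k, hk⟩
      rwa [hT] at this
    · intro h
      ext k
      rw [hT]; exact h k k.2
  let F : ℕ →o (Submodule ℝ (ι → ℝ))ᵒᵈ :=
    { toFun := fun n => OrderDual.toDual (LinearMap.ker (T n))
      monotone' := by
        intro m n hmn a ha
        change a ∈ LinearMap.ker (T n) at ha
        change a ∈ LinearMap.ker (T m)
        rw [hker] at ha ⊢
        exact fun k hk => ha k (hk.trans_le hmn) }
  obtain ⟨N, hN⟩ := IsArtinian.monotone_stabilizes F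
  have hN' : ∀ m, N ≤ m → LinearMap.ker (T N) = LinearMap.ker (T m) := hN
  have hzero : ∀ a ∈ LinearMap.ker (T N), ∀ x ∈ D, combo b a x = 0 := by
    intro a ha
    have h1 : ∀ k, deriv^[k] (combo b a) x₀ = 0 := by
      intro k
      have h2 := ha
      rw [hN' (max N (k + 1)) (le_max_left _ _), hker] at h2
      exact h2 k (lt_of_lt_of_le (Nat.lt_succ_self k) (le_max_right _ _))
    have h3 : analyticOrderAt (combo b a) x₀ = ⊤ := by
      rw [ENat.eq_top_iff_forall_ge]
      intro n
      rw [natCast_le_analyticOrderAt_iff_iteratedDeriv_eq_zero (combo_analytic hb a x₀ hx₀)]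
      intro i _
      rw [iteratedDeriv_eq_iterate]; exact h1 i
    rw [analyticOrderAt_eq_top] at h3
    exact (combo_analytic hb a).eqOn_zero_of_preconnected_of_eventuallyEq_zero hD hx₀ h3
  obtain ⟨S, hS⟩ := LinearMap.exists_rightInverse_of_surjective (T N).rangeRestrict
    (LinearMap.range_rangeRestrict _)
  refine ⟨N, ‖LinearMap.toContinuousLinearMap S‖, ContinuousLinearMap.opNorm_nonneg _, fun a => ?_⟩
  set a' := S ((T N).rangeRestrict a) with ha'
  have h1 : (T N).rangeRestrict a' = (T N).rangeRestrict a := by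
    exact LinearMap.congr_fun hS ((T N).rangeRestrict a)
  have h1' : T N a' = T N a := congrArg Subtype.val h1
  refine ⟨a', fun x hx => ?_, fun M hM hbd => ?_⟩
  · have h2 : a - a' ∈ LinearMap.ker (T N) := by
      rw [LinearMap.mem_ker, map_sub, h1', sub_self]
    have h3 := hzero _ h2 x hx
    simp only [combo, Pi.sub_apply, sub_mul, Finset.sum_sub_distrib] at h3
    exact sub_eq_zero.mp h3
  · have h2 : ‖(T N).rangeRestrict a‖ ≤ M := by
      rw [← h1]
      change ‖T N a'‖ ≤ M
      rw [pi_norm_le_iff_of_nonneg hM]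
      intro k
      rw [hT, Real.norm_eq_abs]
      exact hbd k k.2
    calc ‖a'‖ = ‖LinearMap.toContinuousLinearMap S ((T N).rangeRestrict a)‖ := rfl
      _ ≤ _ := (ContinuousLinearMap.le_opNorm _ _).trans (by gcongr)

end Good

end

section

section Good

variable {ι : Type*} [Fintype ι]

lemma prod_le_of_separated {s : Finset ℝ} {x h : ℝ} (hx : x ∈ s) (h0 : 0 ≤ h)
    (hsep : ∀ x ∈ s, ∀ y ∈ s, x ≠ y → h ≤ |x - y|) :
    h ^ (s.card - 1) ≤ |∏ y ∈ s.erase x, (x - y)| := by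
  rw [Finset.abs_prod, ← Finset.card_erase_of_mem hx, ← Finset.prod_const]
  refine Finset.prod_le_prod (fun _ _ => h0) fun y hy => ?_
  rw [Finset.mem_erase] at hy
  exact hsep x hx y hy.2 hy.1.symm

/-- Small values at many separated points of a ball force small values on the whole ball. -/
lemma exists_good {b : ι → ℝ → ℝ} {x₀ : ℝ} (hb : ∀ i, AnalyticAt ℝ (b i) x₀) :
    ∃ N : ℕ, ∃ K : ℝ, 1 ≤ K ∧ ∃ h₀ > 0, ∀ (a : ι → ℝ) (c h ς ε : ℝ), 0 < h → 0 < ς → ς ≤ 1 → 0 ≤ ε →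
      Metric.closedBall c h ⊆ Metric.closedBall x₀ h₀ →
      ∀ s : Finset ℝ, s.card = N → (∀ x ∈ s, x ∈ Metric.closedBall c h) →
      (∀ x ∈ s, ∀ y ∈ s, x ≠ y → ς * h ≤ |x - y|) → (∀ x ∈ s, |combo b a x| ≤ ε) →
      ∀ y ∈ Metric.closedBall c h, |combo b a y| ≤ K * ς⁻¹ ^ N * ε := by
  classical
  obtain ⟨r, hr, hbr⟩ : ∃ r > 0, ∀ i, AnalyticOnNhd ℝ (b i) (Metric.ball x₀ r) := by
    have h1 : ∀ᶠ x in nhds x₀, ∀ i, AnalyticAt ℝ (b i) x :=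
      eventually_all.mpr fun i => (hb i).eventually_analyticAt
    obtain ⟨r, hr, h2⟩ := Metric.eventually_nhds_iff_ball.mp h1
    exact ⟨r, hr, fun i x hx => h2 x hx i⟩
  obtain ⟨N, C, hC, hjet⟩ := exists_jet_bound (Metric.isPreconnected_ball) hbr
    (Metric.mem_ball_self hr)
  have hsub : Metric.closedBall x₀ (r / 2) ⊆ Metric.ball x₀ r :=
    Metric.closedBall_subset_ball (by linarith)
  obtain ⟨B, hB0, hB⟩ : ∃ B : ℝ, 0 ≤ B ∧ ∀ a : ι → ℝ, ∀ k ≤ N, ∀ x ∈ Metric.closedBall x₀ (r / 2),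
      |deriv^[k] (combo b a) x| ≤ B * ‖a‖ := by
    have h1 : ∀ k i, ∃ B : ℝ, ∀ x ∈ Metric.closedBall x₀ (r / 2), |deriv^[k] (b i) x| ≤ B := by
      intro k i
      have := (isCompact_closedBall x₀ (r / 2)).exists_bound_of_continuousOn
        (((hbr i).iterated_deriv k).continuousOn.mono hsub)
      simpa only [Real.norm_eq_abs] using this
    choose B hB using h1
    have hBnn : ∀ k i, 0 ≤ B k i := fun k i =>
      (abs_nonneg _).trans (hB k i x₀ (Metric.mem_closedBall_self (by linarith)))
    refine ⟨∑ k ∈ Finset.range (N + 1), ∑ i, B k i,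
      Finset.sum_nonneg fun k _ => Finset.sum_nonneg fun i _ => hBnn k i, fun a k hk x hx => ?_⟩
    rw [iterate_deriv_combo hbr a k (hsub hx)]
    calc |∑ i, a i * deriv^[k] (b i) x| ≤ ∑ i, |a i * deriv^[k] (b i) x| :=
          Finset.abs_sum_le_sum_abs _ _
      _ ≤ ∑ i, ‖a‖ * B k i := by
          refine Finset.sum_le_sum fun i _ => ?_
          rw [abs_mul]
          exact mul_le_mul (norm_le_pi_norm a i) (hB k i x hx) (abs_nonneg _) (norm_nonneg _)
      _ = (∑ i, B k i) * ‖a‖ := by rw [← Finset.mul_sum, mul_comm]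
      _ ≤ _ := by
          gcongr
          exact Finset.single_le_sum (f := fun k => ∑ i, B k i)
            (fun k _ => Finset.sum_nonneg fun i _ => hBnn k i) (Finset.mem_range.mpr (by omega))
  set h₀ : ℝ := min (r / 2) (min (1 / (2 * (C * B) + 2)) (1 / 2)) with hh₀
  have hCB : 0 ≤ C * B := mul_nonneg hC hB0
  have h₀pos : 0 < h₀ := by positivity
  have h₀r : h₀ ≤ r / 2 := min_le_left _ _
  have h₀C : C * B * h₀ ≤ 1 / 2 := by
    have : h₀ ≤ 1 / (2 * (C * B) + 2) := (min_le_right _ _).trans (min_le_left _ _)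
    calc C * B * h₀ ≤ C * B * (1 / (2 * (C * B) + 2)) := by gcongr
      _ = C * B / (2 * (C * B) + 2) := by ring
      _ ≤ 1 / 2 := by rw [div_le_div_iff₀ (by positivity) (by norm_num)]; linarith
  have h₀half : h₀ ≤ 1 / 2 := (min_le_right _ _).trans (min_le_right _ _)
  set K₁ : ℝ := 2 * (C * (N.factorial * (N + 1))) with hK₁
  have hK₁0 : 0 ≤ K₁ := by positivity
  refine ⟨N, 1 + 2 ^ N * (B * K₁) + N * 2 ^ N, ?_, h₀, h₀pos, ?_⟩
  · have : 0 ≤ 2 ^ N * (B * K₁) + N * 2 ^ N := by positivity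
    linarith
  intro a c h ς ε hh hς hς1 hε hcb s hs hsJ hsep hsε y hy
  have hJsub : Metric.closedBall c h ⊆ Metric.ball x₀ r :=
    (hcb.trans (Metric.closedBall_subset_closedBall h₀r)).trans hsub
  have hJ2 : Metric.closedBall c h ⊆ Metric.closedBall x₀ (r / 2) :=
    hcb.trans (Metric.closedBall_subset_closedBall h₀r)
  have hord : (Metric.closedBall c h).OrdConnected := by
    rw [Real.closedBall_eq_Icc]; exact ordConnected_Icc
  have hh1 : h ≤ 1 := by
    have h1 : c + h ∈ Metric.closedBall x₀ h₀ := hcb (by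
      rw [Metric.mem_closedBall, Real.dist_eq]; simp [abs_of_pos hh])
    have h2 : c - h ∈ Metric.closedBall x₀ h₀ := hcb (by
      rw [Metric.mem_closedBall, Real.dist_eq]; simp [abs_of_pos hh])
    rw [Metric.mem_closedBall, Real.dist_eq, abs_le] at h1 h2
    linarith [h1.2, h2.1]
  have hςh0 : 0 < ς * h := by positivity
  have hςh1 : ς * h ≤ 1 := mul_le_one₀ hς1 hh.le hh1
  obtain ⟨a', haa', hjet'⟩ := hjet a
  have hval : ∀ x ∈ Metric.closedBall c h, combo b a x = combo b a' x := fun x hx =>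
    haa' x (hJsub hx)
  set g := combo b a' with hg
  have hgan : AnalyticOnNhd ℝ g (Metric.ball x₀ r) := combo_analytic hbr a'
  have hsε' : ∀ x ∈ s, |g x| ≤ ε := fun x hx => by
    rw [← hval x (hsJ x hx)]; exact hsε x hx
  set M₀ : ℝ := N.factorial * (N + 1) * ((ς * h)⁻¹ ^ N * ε) with hM₀
  have hM₀0 : 0 ≤ M₀ := by positivity
  -- each low order derivative is small somewhere in the ball
  have hsmall : ∀ k < N, |deriv^[k] g x₀| ≤ M₀ + B * ‖a'‖ * h₀ := by
    intro k hk
    obtain ⟨t, hts, htc⟩ := Finset.exists_subset_card_eq (s := s) (n := k + 1) (by omega)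
    obtain ⟨ξ, hξ, hξe⟩ := exists_iterate_deriv_eq_divided hJsub hord hgan t htc
      fun x hx => hsJ x (hts hx)
    have h1 : |deriv^[k] g ξ| ≤ M₀ := by
      rw [hξe, abs_mul, Nat.abs_cast]
      have h2 : |∑ x ∈ t, g x / ∏ z ∈ t.erase x, (x - z)| ≤ ∑ x ∈ t, (ς * h)⁻¹ ^ N * ε := by
        refine (Finset.abs_sum_le_sum_abs _ _).trans (Finset.sum_le_sum fun x hx => ?_)
        have h3 := prod_le_of_separated hx hςh0.le
          fun x hx y hy hxy => hsep x (hts hx) y (hts hy) hxy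
        rw [htc, Nat.add_sub_cancel] at h3
        rw [abs_div, div_eq_inv_mul]
        have h4 : (0 : ℝ) < (ς * h) ^ k := by positivity
        have h5 : |∏ z ∈ t.erase x, (x - z)|⁻¹ ≤ (ς * h)⁻¹ ^ N := by
          calc |∏ z ∈ t.erase x, (x - z)|⁻¹ ≤ ((ς * h) ^ k)⁻¹ := inv_anti₀ h4 h3
            _ = (ς * h)⁻¹ ^ k := by rw [inv_pow]
            _ ≤ _ := pow_le_pow_right₀ (one_le_inv_iff₀.mpr ⟨hςh0, hςh1⟩) hk.le
        exact mul_le_mul h5 (hsε' x (hts hx)) (abs_nonneg _) (by positivity)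
      rw [Finset.sum_const, htc, nsmul_eq_mul] at h2
      calc (k.factorial : ℝ) * _ ≤ N.factorial * ((k + 1 : ℕ) * ((ς * h)⁻¹ ^ N * ε)) := by
            gcongr
        _ ≤ N.factorial * ((N + 1) * ((ς * h)⁻¹ ^ N * ε)) := by
            gcongr
            exact_mod_cast (by omega : k + 1 ≤ N + 1)
        _ = M₀ := by rw [hM₀]; ring
    have h2 : |deriv^[k] g x₀ - deriv^[k] g ξ| ≤ B * ‖a'‖ * h₀ := by
      have h3 : ∀ x ∈ Metric.closedBall x₀ (r / 2),
          HasDerivWithinAt (deriv^[k] g) (deriv^[k + 1] g x) (Metric.closedBall x₀ (r / 2)) x := by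
        intro x hx
        rw [Function.iterate_succ_apply']
        exact ((hgan.iterated_deriv k) x (hsub hx)).differentiableAt.hasDerivAt.hasDerivWithinAt
      have h4 := (convex_closedBall x₀ (r / 2)).norm_image_sub_le_of_norm_hasDerivWithin_le h3
        (fun x hx => by rw [Real.norm_eq_abs]; exact hB a' (k + 1) hk x hx) (hJ2 hξ)
        (Metric.mem_closedBall_self (by linarith))
      rw [Real.norm_eq_abs, Real.norm_eq_abs] at h4
      refine h4.trans ?_
      gcongr
      have := hcb hξ
      rwa [Metric.mem_closedBall, dist_comm, Real.dist_eq] at this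
    calc |deriv^[k] g x₀| = |deriv^[k] g ξ + (deriv^[k] g x₀ - deriv^[k] g ξ)| := by congr 1; ring
      _ ≤ _ := (abs_add_le _ _).trans (add_le_add h1 h2)
  have ha'le : ‖a'‖ ≤ K₁ * ((ς * h)⁻¹ ^ N * ε) := by
    have h1 := hjet' (M₀ + B * ‖a'‖ * h₀) (by positivity) hsmall
    have h2 : C * (B * ‖a'‖ * h₀) ≤ 1 / 2 * ‖a'‖ := by
      calc C * (B * ‖a'‖ * h₀) = (C * B * h₀) * ‖a'‖ := by ring
        _ ≤ _ := by gcongr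
    have h3 : K₁ * ((ς * h)⁻¹ ^ N * ε) = 2 * (C * M₀) := by rw [hK₁, hM₀]; ring
    rw [h3]
    linarith
  rw [hval y hy]
  have hςinv : 1 ≤ ς⁻¹ := one_le_inv_iff₀.mpr ⟨hς, hς1⟩
  have hςN : (1 : ℝ) ≤ ς⁻¹ ^ N := one_le_pow₀ hςinv
  by_cases hys : y ∈ s
  · refine (hsε' y hys).trans ?_
    have : 1 ≤ (1 + 2 ^ N * (B * K₁) + N * 2 ^ N) * ς⁻¹ ^ N := by
      apply one_le_mul_of_one_le_of_one_le _ hςN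
      have : 0 ≤ 2 ^ N * (B * K₁) + N * 2 ^ N := by positivity
      linarith
    nlinarith
  have hdiff : ∀ x ∈ Metric.closedBall c h, |y - x| ≤ 2 * h := by
    intro x hx
    have := dist_triangle_right y x c
    rw [Metric.mem_closedBall] at hx hy
    rw [← Real.dist_eq]; linarith
  obtain ⟨ξ, hξ, hξe⟩ := exists_iterate_deriv_eq_divided hJsub hord hgan (insert y s) (k := N)
    (by rw [Finset.card_insert_of_notMem hys, hs]) (by
      intro x hx
      rcases Finset.mem_insert.mp hx with rfl | hx
      · exact hy
      · exact hsJ x hx)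
  rw [Finset.sum_insert hys, Finset.erase_insert hys] at hξe
  set Φ : ℝ := ∏ x ∈ s, (y - x) with hΦ
  have hΦ0 : Φ ≠ 0 := Finset.prod_ne_zero_iff.mpr fun x hx h0 => hys (by
    rw [sub_eq_zero] at h0; rwa [h0])
  have hgy : g y = Φ * (deriv^[N] g ξ / N.factorial) -
      ∑ x ∈ s, Φ * (g x / ∏ z ∈ (insert y s).erase x, (x - z)) := by
    have h5 : (N.factorial : ℝ) ≠ 0 := by exact_mod_cast N.factorial_ne_zero
    rw [hξe, ← Finset.mul_sum]
    field_simp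
    ring
  have hterm : ∀ x ∈ s, |Φ * (g x / ∏ z ∈ (insert y s).erase x, (x - z))| ≤
      2 ^ N * ς⁻¹ ^ N * ε := by
    intro x hx
    have hxy : x ≠ y := fun h => hys (h ▸ hx)
    have h1 : (insert y s).erase x = insert y (s.erase x) := Finset.erase_insert_of_ne hxy.symm
    rw [h1, Finset.prod_insert (fun h => hys (Finset.mem_of_mem_erase h)), hΦ,
      ← Finset.mul_prod_erase s _ hx]
    have h2 := prod_le_of_separated hx hςh0.le hsep
    rw [hs] at h2
    have h3 : |∏ z ∈ s.erase x, (y - z)| ≤ (2 * h) ^ (N - 1) := by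
      rw [Finset.abs_prod, ← hs, ← Finset.card_erase_of_mem hx, ← Finset.prod_const]
      refine Finset.prod_le_prod (fun _ _ => abs_nonneg _) fun z hz => ?_
      exact hdiff z (hsJ z (Finset.mem_of_mem_erase hz))
    have h4 : |y - x| ≠ 0 := abs_ne_zero.mpr (sub_ne_zero.mpr hxy.symm)
    have h5 : (0 : ℝ) < (ς * h) ^ (N - 1) := by positivity
    calc |(y - x) * (∏ z ∈ s.erase x, (y - z)) * (g x / ((x - y) * ∏ z ∈ s.erase x, (x - z)))|
        = |∏ z ∈ s.erase x, (y - z)| * |g x| / |∏ z ∈ s.erase x, (x - z)| := by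
          rw [abs_mul, abs_mul, abs_div, abs_mul, abs_sub_comm x y]
          field_simp
      _ ≤ (2 * h) ^ (N - 1) * ε / (ς * h) ^ (N - 1) := by
          gcongr
          exact hsε' x hx
      _ = 2 ^ (N - 1) * ς⁻¹ ^ (N - 1) * ε := by
          rw [mul_pow, mul_pow, inv_pow]
          have : h ^ (N - 1) ≠ 0 := by positivity
          field_simp
      _ ≤ 2 ^ N * ς⁻¹ ^ N * ε := by
          gcongr
          · norm_num
          · omega
          · omega
  have hΦle : |Φ| ≤ (2 * h) ^ N := by
    rw [hΦ, Finset.abs_prod, ← hs, ← Finset.prod_const]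
    exact Finset.prod_le_prod (fun _ _ => abs_nonneg _) fun z hz => hdiff z (hsJ z hz)
  have hfirst : |Φ * (deriv^[N] g ξ / N.factorial)| ≤ 2 ^ N * (B * K₁) * ς⁻¹ ^ N * ε := by
    rw [abs_mul, abs_div, Nat.abs_cast]
    have h1 : |deriv^[N] g ξ| / N.factorial ≤ B * (K₁ * ((ς * h)⁻¹ ^ N * ε)) := by
      refine (div_le_self (abs_nonneg _) (by exact_mod_cast N.factorial_pos)).trans ?_
      exact (hB a' N le_rfl ξ (hJ2 hξ)).trans (by gcongr)
    calc |Φ| * (|deriv^[N] g ξ| / N.factorial) ≤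
            (2 * h) ^ N * (B * (K₁ * ((ς * h)⁻¹ ^ N * ε))) := by
          gcongr
      _ = _ := by
          rw [mul_pow, mul_inv, mul_pow]
          have : h ^ N * h⁻¹ ^ N = 1 := by rw [← mul_pow, mul_inv_cancel₀ hh.ne', one_pow]
          linear_combination (2 ^ N * (B * K₁) * ς⁻¹ ^ N * ε) * this
  rw [hgy]
  calc |Φ * (deriv^[N] g ξ / N.factorial) - ∑ x ∈ s, Φ *
          (g x / ∏ z ∈ (insert y s).erase x, (x - z))|
      ≤ |Φ * (deriv^[N] g ξ / N.factorial)| +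
        |∑ x ∈ s, Φ * (g x / ∏ z ∈ (insert y s).erase x, (x - z))| := abs_sub _ _
    _ ≤ 2 ^ N * (B * K₁) * ς⁻¹ ^ N * ε + ∑ x ∈ s, 2 ^ N * ς⁻¹ ^ N * ε :=
        add_le_add hfirst ((Finset.abs_sum_le_sum_abs _ _).trans (Finset.sum_le_sum hterm))
    _ ≤ _ := by
        rw [Finset.sum_const, hs, nsmul_eq_mul]
        have : 0 ≤ ς⁻¹ ^ N * ε := by positivity
        linarith

end Good

end

section

section Good

variable {ι : Type*} [Fintype ι]

lemma exists_good_tree {b : ι → ℝ → ℝ} {x₀ : ℝ} (hb : ∀ i, AnalyticAt ℝ (b i) x₀) :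
    ∃ N : ℕ, ∃ K : ℝ, 1 ≤ K ∧ ∃ h₀ > 0, ∀ (β ρ : ℝ) (c : ℕ → (ℕ → Bool) → ℝ), IsTree β ρ c → 0 < β →
      β < 1 → 0 < ρ → (∀ ω, node β ρ c 0 ω ⊆ Metric.closedBall x₀ h₀) →
      ∀ (a : ι → ℝ) (j : ℕ) (ε : ℝ), 0 ≤ ε → K * (β ^ j)⁻¹ ^ N * ε < 1 → ∀ n ω,
      (∃ x ∈ node β ρ c n ω, 1 ≤ |combo b a x|) →
      coins ({ω' | |combo b a (limPt c ω')| < ε} ∩ cyl ω n) ≤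
        (N * 2⁻¹ ^ j) * coins (cyl ω n) := by
  classical
  obtain ⟨N, K, hK, h₀, hh₀, hgood⟩ := exists_good hb
  refine ⟨N, K, hK, h₀, hh₀, ?_⟩
  intro β ρ c h hβ0 hβ1 hρ hroot a j ε hε hKε n ω ⟨x₁, hx₁, hx₁1⟩
  set A : Set (ℕ → Bool) := {ω' | |combo b a (limPt c ω')| < ε} ∩ cyl ω n with hA
  set S : Finset (Fin (n + j) → Bool) :=
    Finset.univ.filter fun s => (A ∩ cyl (ext0 s) (n + j)).Nonempty with hS
  have hcov : A ⊆ ⋃ s ∈ S, cyl (ext0 s) (n + j) := by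
    intro ω' hω'
    simp only [mem_iUnion]
    exact ⟨fun i => ω' i, by
      simp only [hS, Finset.mem_filter, Finset.mem_univ, true_and]
      exact ⟨ω', hω', mem_cyl_ext0 ω' _⟩, mem_cyl_ext0 ω' _⟩
  have hcard : S.card ≤ N := by
    by_contra hlt
    push Not at hlt
    obtain ⟨S', hS'S, hS'c⟩ := Finset.exists_subset_card_eq hlt.le
    have hne : ∀ s : S', (A ∩ cyl (ext0 s.1) (n + j)).Nonempty := fun s => by
      have := hS'S s.2
      simpa [hS] using this
    choose w hw using hne
    have hsepw : ∀ s t : S', s ≠ t → β ^ j * (β ^ n * ρ) ≤ |limPt c (w s) - limPt c (w t)| := by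
      intro s t hst
      have h1 : w t ∉ cyl (w s) (n + j) := by
        intro h2
        rw [cyl_eq_of_mem (hw s).2] at h2
        exact Set.disjoint_left.mp (disjoint_cyl_ext0 fun h3 => hst (Subtype.ext h3)) h2 (hw t).2
      have h2 := h.sep_of_notMem hβ0 hβ1 hρ h1 (h.limPt_mem hβ0 hβ1 hρ _ _)
        (h.limPt_mem hβ0 hβ1 hρ _ _)
      calc β ^ j * (β ^ n * ρ) = β ^ (n + j) * ρ := by rw [pow_add]; ring
        _ ≤ _ := h2
    have hinj : Function.Injective fun s : S' => limPt c (w s) := by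
      intro s t hst
      by_contra hne
      have := hsepw s t hne
      simp only at hst
      rw [hst, sub_self, abs_zero] at this
      have h3 : 0 < β ^ j * (β ^ n * ρ) := by positivity
      linarith
    have hnode : ∀ ω' ∈ cyl ω n, limPt c ω' ∈ Metric.closedBall (c n ω) (β ^ n * ρ) := by
      intro ω' hω'
      have := h.limPt_mem hβ0 hβ1 hρ n ω'
      rwa [h.node_congr hω'] at this
    have key := hgood a (c n ω) (β ^ n * ρ) (β ^ j) ε (by positivity) (by positivity)
      (pow_le_one₀ hβ0.le hβ1.le) hε ((h.node_anti (Nat.zero_le n) ω).trans (hroot ω))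
      (Finset.univ.image fun s : S' => limPt c (w s))
      (by rw [Finset.card_image_of_injective _ hinj]; simp [hS'c])
      (by
        intro x hx
        obtain ⟨s, -, rfl⟩ := Finset.mem_image.mp hx
        exact hnode _ (hw s).1.2)
      (by
        intro x hx y hy hxy
        obtain ⟨s, -, rfl⟩ := Finset.mem_image.mp hx
        obtain ⟨t, -, rfl⟩ := Finset.mem_image.mp hy
        exact hsepw s t fun hst => hxy (by rw [hst]))
      (by
        intro x hx
        obtain ⟨s, -, rfl⟩ := Finset.mem_image.mp hx
        exact (hw s).1.1.le)
      x₁ hx₁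
    linarith
  calc coins A ≤ coins (⋃ s ∈ S, cyl (ext0 s) (n + j)) := measure_mono hcov
    _ ≤ ∑ s ∈ S, coins (cyl (ext0 s) (n + j)) := measure_biUnion_finset_le _ _
    _ = S.card * (2⁻¹ ^ j * 2⁻¹ ^ n) := by
        simp only [coins_cyl, Finset.sum_const, nsmul_eq_mul, pow_add]
        ring
    _ ≤ N * (2⁻¹ ^ j * 2⁻¹ ^ n) := by gcongr
    _ = _ := by rw [coins_cyl, mul_assoc]

end Good

end

section

section Minors
variable {R : Type*} [CommRing R] {N k : ℕ}

/-- The maximal minor of a matrix with rows selected by `σ`. -/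
def minor (M : Matrix (Fin N) (Fin k) R) (σ : Fin k → Fin N) : R := (M.submatrix σ id).det

lemma det_mul_eq_sum_minor (C : Matrix (Fin k) (Fin N) R) (B : Matrix (Fin N) (Fin k) R) :
    (C * B).det = ∑ τ : Fin k → Fin N, (∏ i, C i (τ i)) * minor B τ := by
  classical
  have h1 : C * B = fun i => ∑ j, C i j • B j := by
    ext i l
    simp [Matrix.mul_apply, Finset.sum_apply]
  change Matrix.detRowAlternating (C * B) = _
  rw [h1]
  have := (Matrix.detRowAlternating (n := Fin k) (R := R)).toMultilinearMap.map_sum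
    (fun i j => C i j • B j)
  refine this.trans (Finset.sum_congr rfl fun τ _ => ?_)
  exact (Matrix.detRowAlternating (n := Fin k) (R := R)).toMultilinearMap.map_smul_univ
    (fun i => C i (τ i)) (fun i => B (τ i))

lemma minor_mul (C : Matrix (Fin N) (Fin N) R) (B : Matrix (Fin N) (Fin k) R)
    (σ : Fin k → Fin N) :
    minor (C * B) σ = ∑ τ : Fin k → Fin N, (∏ i, C (σ i) (τ i)) * minor B τ :=
  det_mul_eq_sum_minor (C.submatrix σ id) B

lemma minor_mul_right (B : Matrix (Fin N) (Fin k) R) (A : Matrix (Fin k) (Fin k) R)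
    (σ : Fin k → Fin N) : minor (B * A) σ = minor B σ * A.det :=
  Matrix.det_mul (B.submatrix σ id) A

lemma minor_map {S : Type*} [CommRing S] (f : R →+* S) (B : Matrix (Fin N) (Fin k) R)
    (σ : Fin k → Fin N) : minor (B.map f) σ = f (minor B σ) := by
  simp only [minor, RingHom.map_det]
  rfl

lemma minor_diagonal_mul (d : Fin N → R) (B : Matrix (Fin N) (Fin k) R) (σ : Fin k → Fin N) :
    minor (Matrix.diagonal d * B) σ = (∏ i, d (σ i)) * minor B σ := by
  have : (Matrix.diagonal d * B).submatrix σ id = Matrix.diagonal (d ∘ σ) * B.submatrix σ id := by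
    ext i j
    simp [Matrix.diagonal_mul]
  rw [minor, this, Matrix.det_mul, Matrix.det_diagonal]
  rfl

lemma minor_eq_zero_of_not_injective (B : Matrix (Fin N) (Fin k) R) {σ : Fin k → Fin N}
    (h : ¬ Function.Injective σ) : minor B σ = 0 := by
  simp only [Function.Injective, not_forall] at h
  obtain ⟨i, j, hij, hne⟩ := h
  exact Matrix.det_zero_of_row_eq hne (by ext l; simp [hij])

lemma exists_minor_ne_zero {K : Type*} [Field K] (B : Matrix (Fin N) (Fin k) K)
    (h : LinearIndependent K fun j i => B i j) : ∃ σ, minor B σ ≠ 0 := by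
  classical
  have hB : Function.Injective B.mulVec := Matrix.mulVec_injective_iff.2 h
  obtain ⟨L, hL⟩ := LinearMap.exists_leftInverse_of_injective (Matrix.mulVecLin B)
    (LinearMap.ker_eq_bot.2 hB)
  obtain ⟨C, hC⟩ : ∃ C : Matrix (Fin k) (Fin N) K, C * B = 1 := by
    refine ⟨LinearMap.toMatrix' L, ?_⟩
    have := congrArg LinearMap.toMatrix' hL
    rwa [LinearMap.toMatrix'_comp, LinearMap.toMatrix'_id, ← Matrix.toLin'_apply',
      LinearMap.toMatrix'_toLin'] at this
  by_contra! h0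
  have := det_mul_eq_sum_minor C B
  rw [hC] at this
  simp [h0] at this

end Minors

section IntBasis
variable {N : ℕ}

/-- The columns of `B` form a `ℚ`-basis of `V` consisting of integer vectors. -/
structure IsIntBasis (V : Submodule ℚ (Fin N → ℚ)) {k : ℕ} (B : Matrix (Fin N) (Fin k) ℤ) :
    Prop where
  card : k = Module.finrank ℚ V
  mem : ∀ j, (fun i => (B i j : ℚ)) ∈ V
  indep : LinearIndependent ℚ fun j i => (B i j : ℚ)

lemma exists_int_smul (v : Fin N → ℚ) :
    ∃ n : ℤ, n ≠ 0 ∧ ∃ w : Fin N → ℤ, ∀ i, (w i : ℚ) = n * v i := by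
  refine ⟨∏ i, ((v i).den : ℤ), Finset.prod_ne_zero_iff.2 fun i _ => by simp,
    fun i => (v i).num * ∏ j ∈ Finset.univ.erase i, ((v j).den : ℤ), fun i => ?_⟩
  rw [← Finset.mul_prod_erase Finset.univ _ (Finset.mem_univ i)]
  push_cast
  have : (v i).num = (v i).den * v i := by rw [mul_comm]; exact (Rat.mul_den_eq_num (v i)).symm
  rw [this]; ring

lemma exists_isIntBasis (V : Submodule ℚ (Fin N → ℚ)) :
    ∃ B : Matrix (Fin N) (Fin (Module.finrank ℚ V)) ℤ, IsIntBasis V B := by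
  let b := Module.finBasis ℚ V
  choose n hn w hw using fun j => exists_int_smul (b j : Fin N → ℚ)
  have key : (fun j i => (w j i : ℚ)) = fun j =>
      (Units.mk0 (n j : ℚ) (by exact_mod_cast hn j)) • (b j : Fin N → ℚ) := by
    ext j i
    simp [hw, Units.smul_def]
  refine ⟨fun i j => w j i, rfl, fun j => ?_, ?_⟩
  · have := congrFun key j
    change (fun i => (w j i : ℚ)) = _ at this
    rw [this]
    exact V.smul_mem _ (b j).2
  · rw [key]
    have : LinearIndependent ℚ fun j => (b j : Fin N → ℚ) :=
      b.linearIndependent.map' V.subtype (Submodule.ker_subtype V)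
    exact this.units_smul _

lemma exists_minimal_isIntBasis (V : Submodule ℚ (Fin N → ℚ)) :
    ∃ B : Matrix (Fin N) (Fin (Module.finrank ℚ V)) ℤ, IsIntBasis V B ∧
      ∀ B' : Matrix (Fin N) (Fin (Module.finrank ℚ V)) ℤ, IsIntBasis V B' →
        ∑ σ, |minor B σ| ≤ ∑ σ, |minor B' σ| := by
  obtain ⟨B, hB, h⟩ := WellFounded.has_min (InvImage.wf (fun B : Matrix (Fin N)
    (Fin (Module.finrank ℚ V)) ℤ => (∑ σ, |minor B σ|).toNat) Nat.lt_wfRel.wf)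
    {B | IsIntBasis V B} (exists_isIntBasis V)
  refine ⟨B, hB, fun B' hB' => ?_⟩
  have h1 := h B' hB'
  have h2 : 0 ≤ ∑ σ, |minor B σ| := Finset.sum_nonneg fun _ _ => abs_nonneg _
  have h3 : 0 ≤ ∑ σ, |minor B' σ| := Finset.sum_nonneg fun _ _ => abs_nonneg _
  have h4 : ¬ (∑ σ, |minor B' σ|).toNat < (∑ σ, |minor B σ|).toNat := h1
  omega

/-- An integer basis of `V` of minimal total size of minors. -/
noncomputable def intBasis (V : Submodule ℚ (Fin N → ℚ)) :
    Matrix (Fin N) (Fin (Module.finrank ℚ V)) ℤ := (exists_minimal_isIntBasis V).choose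

lemma intBasis_spec (V : Submodule ℚ (Fin N → ℚ)) : IsIntBasis V (intBasis V) :=
  (exists_minimal_isIntBasis V).choose_spec.1

/-- Maximum of the absolute values of the maximal minors of `g * B`. -/
noncomputable def covol (g : Matrix (Fin N) (Fin N) ℝ) {k : ℕ} (B : Matrix (Fin N) (Fin k) ℤ) : ℝ :=
  ‖fun σ => minor (g * B.map (Int.castRingHom ℝ)) σ‖

lemma covol_nonneg (g : Matrix (Fin N) (Fin N) ℝ) {k : ℕ} (B : Matrix (Fin N) (Fin k) ℤ) :
    0 ≤ covol g B := norm_nonneg _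

lemma IsIntBasis.exists_minor {V : Submodule ℚ (Fin N → ℚ)} {k : ℕ} {B : Matrix (Fin N) (Fin k) ℤ}
    (h : IsIntBasis V B) : ∃ σ, minor B σ ≠ 0 := by
  obtain ⟨σ, hσ⟩ := exists_minor_ne_zero (B.map (Int.castRingHom ℚ)) h.indep
  rw [minor_map] at hσ
  exact ⟨σ, fun h0 => hσ (by simp [h0])⟩

lemma covol_intBasis_le {V : Submodule ℚ (Fin N → ℚ)} {k : ℕ} {B : Matrix (Fin N) (Fin k) ℤ}
    (h : IsIntBasis V B) (g : Matrix (Fin N) (Fin N) ℝ) : covol g (intBasis V) ≤ covol g B := by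
  classical
  obtain rfl := h.card
  set B₀ := intBasis V with hB₀
  have h₀ := intBasis_spec V
  have hspan : Submodule.span ℚ (range fun j i => (B₀ i j : ℚ)) = V := by
    apply Submodule.eq_of_le_of_finrank_eq
    · rw [Submodule.span_le]; rintro _ ⟨j, rfl⟩; exact h₀.mem j
    · rw [finrank_span_eq_card h₀.indep]; simp
  have hA : ∃ A : Matrix (Fin (Module.finrank ℚ V)) (Fin (Module.finrank ℚ V)) ℚ,
      B.map (Int.castRingHom ℚ) = B₀.map (Int.castRingHom ℚ) * A := by
    have : ∀ j, ∃ c : Fin (Module.finrank ℚ V) → ℚ, ∑ l, c l • (fun i => (B₀ i l : ℚ)) =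
        fun i => (B i j : ℚ) := by
      intro j
      rw [← Submodule.mem_span_range_iff_exists_fun, hspan]
      exact h.mem j
    choose c hc using this
    refine ⟨Matrix.of fun l j => c j l, ?_⟩
    ext i j
    have := congrFun (hc j) i
    simp only [Finset.sum_apply, Pi.smul_apply, smul_eq_mul] at this
    simp [Matrix.mul_apply, ← this, mul_comm]
  obtain ⟨A, hA⟩ := hA
  have hm : ∀ σ, ((minor B σ : ℤ) : ℚ) = minor B₀ σ * A.det := by
    intro σ
    have := congrArg (fun M => minor M σ) hA
    simp only [minor_mul_right, minor_map] at this
    exact this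
  have hmin : (∑ σ, |((minor B₀ σ : ℤ) : ℚ)|) ≤ (∑ σ, |((minor B₀ σ : ℤ) : ℚ)|) * |A.det| := by
    have h1 := (exists_minimal_isIntBasis V).choose_spec.2 B h
    have h2 : ((∑ σ, |minor B₀ σ| : ℤ) : ℚ) ≤ ((∑ σ, |minor B σ| : ℤ) : ℚ) := by exact_mod_cast h1
    push_cast at h2
    rw [Finset.sum_mul]
    simpa [hm, abs_mul] using h2
  have hpos : 0 < ∑ σ, |((minor B₀ σ : ℤ) : ℚ)| := by
    obtain ⟨σ, hσ⟩ := h₀.exists_minor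
    refine Finset.sum_pos' (fun _ _ => abs_nonneg _) ⟨σ, Finset.mem_univ _, ?_⟩
    rw [abs_pos]; exact_mod_cast hσ
  have hdet : 1 ≤ |A.det| := by
    by_contra! hlt
    nlinarith
  have hdetR : (1 : ℝ) ≤ |((A.det : ℚ) : ℝ)| := by exact_mod_cast hdet
  have hBR : B.map (Int.castRingHom ℝ) = B₀.map (Int.castRingHom ℝ) * A.map (algebraMap ℚ ℝ) := by
    have := congrArg (fun M => M.map (algebraMap ℚ ℝ)) hA
    simp only [Matrix.map_mul, Matrix.map_map] at this
    have hc : ⇑(algebraMap ℚ ℝ) ∘ ⇑(Int.castRingHom ℚ) = ⇑(Int.castRingHom ℝ) := by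
      ext z; simp
    rwa [hc] at this
  have hdetmap : (A.map (algebraMap ℚ ℝ)).det = ((A.det : ℚ) : ℝ) := by
    have := RingHom.map_det (algebraMap ℚ ℝ) A
    rw [eq_ratCast] at this
    exact this.symm
  refine (pi_norm_le_iff_of_nonneg (covol_nonneg _ _)).2 fun σ => ?_
  have : minor (g * B.map (Int.castRingHom ℝ)) σ =
      minor (g * B₀.map (Int.castRingHom ℝ)) σ * ((A.det : ℚ) : ℝ) := by
    rw [hBR, ← Matrix.mul_assoc, minor_mul_right, hdetmap]
  calc _ ≤ ‖minor (g * B₀.map (Int.castRingHom ℝ)) σ‖ * |((A.det : ℚ) : ℝ)| :=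
        le_mul_of_one_le_right (norm_nonneg _) hdetR
    _ = ‖minor (g * B.map (Int.castRingHom ℝ)) σ‖ := by rw [this, norm_mul]; rfl
    _ ≤ _ := norm_le_pi_norm (fun σ => minor (g * B.map (Int.castRingHom ℝ)) σ) σ

end IntBasis

end

section

section Covol
variable {N : ℕ}

lemma abs_minor_le_covol (g : Matrix (Fin N) (Fin N) ℝ) {k : ℕ} (B : Matrix (Fin N) (Fin k) ℤ)
    (σ : Fin k → Fin N) : |minor (g * B.map (Int.castRingHom ℝ)) σ| ≤ covol g B :=
  norm_le_pi_norm (fun σ => minor (g * B.map (Int.castRingHom ℝ)) σ) σ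

lemma covol_le {g : Matrix (Fin N) (Fin N) ℝ} {k : ℕ} {B : Matrix (Fin N) (Fin k) ℤ} {M : ℝ}
    (hM : 0 ≤ M) (h : ∀ σ, |minor (g * B.map (Int.castRingHom ℝ)) σ| ≤ M) : covol g B ≤ M :=
  (pi_norm_le_iff_of_nonneg hM).2 h

lemma covol_of_eq_zero (g : Matrix (Fin N) (Fin N) ℝ) {k : ℕ} (hk : k = 0)
    (B : Matrix (Fin N) (Fin k) ℤ) : covol g B = 1 := by
  subst hk
  apply le_antisymm
  · exact covol_le zero_le_one fun σ => by simp [minor]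
  · refine le_trans ?_ (abs_minor_le_covol g B Fin.elim0)
    simp [minor]

lemma covol_bot (g : Matrix (Fin N) (Fin N) ℝ) :
    covol g (intBasis (⊥ : Submodule ℚ (Fin N → ℚ))) = 1 :=
  covol_of_eq_zero g (by simp) _

lemma one_le_covol_of_eq {g : Matrix (Fin N) (Fin N) ℝ} (hg : |g.det| = 1) {k : ℕ} (hk : k = N)
    {V : Submodule ℚ (Fin N → ℚ)} {B : Matrix (Fin N) (Fin k) ℤ} (hB : IsIntBasis V B) :
    1 ≤ covol g B := by
  subst hk
  obtain ⟨σ, hσ⟩ := hB.exists_minor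
  have h1 : B.det ≠ 0 := by
    intro h0
    apply hσ
    have : B.submatrix σ id = (1 : Matrix (Fin k) (Fin k) ℤ).submatrix σ id * B := by
      ext i j
      simp [Matrix.mul_apply, Matrix.one_apply]
    rw [minor, this, Matrix.det_mul, h0, mul_zero]
  refine le_trans ?_ (abs_minor_le_covol g B id)
  have h2 : minor (g * B.map (Int.castRingHom ℝ)) id = g.det * (B.det : ℝ) := by
    change ((g * B.map (Int.castRingHom ℝ)).submatrix id id).det = _
    rw [Matrix.submatrix_id_id, Matrix.det_mul]
    congr 1
    exact (RingHom.map_det (Int.castRingHom ℝ) B).symm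
  rw [h2, abs_mul, hg, one_mul]
  exact_mod_cast Int.one_le_abs h1

lemma one_le_covol_top {g : Matrix (Fin N) (Fin N) ℝ} (hg : |g.det| = 1) :
    1 ≤ covol g (intBasis (⊤ : Submodule ℚ (Fin N → ℚ))) :=
  one_le_covol_of_eq hg (by simp) (intBasis_spec _)

lemma covol_cons_le (g : Matrix (Fin N) (Fin N) ℝ) {k : ℕ} (B : Matrix (Fin N) (Fin k) ℤ)
    (z : Fin N → ℤ) :
    covol g (Matrix.of fun i => (Fin.cons (z i) (B i) : Fin (k + 1) → ℤ)) ≤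
      (k + 1 : ℕ) * covol g B * ‖g.mulVec fun i => (z i : ℝ)‖ := by
  have h0 := covol_nonneg g B
  refine covol_le (by positivity) fun σ => ?_
  rw [minor, Matrix.det_succ_column_zero]
  refine (Finset.abs_sum_le_sum_abs _ _).trans ?_
  have : ((k + 1 : ℕ) : ℝ) * covol g B * ‖g.mulVec fun i => (z i : ℝ)‖ =
      ∑ i : Fin (k + 1), covol g B * ‖g.mulVec fun i => (z i : ℝ)‖ := by
    simp [mul_assoc]
  rw [this]
  refine Finset.sum_le_sum fun i _ => ?_
  rw [abs_mul, abs_mul, abs_pow, abs_neg, abs_one, one_pow, one_mul, mul_comm]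
  refine mul_le_mul ?_ ?_ (abs_nonneg _) h0
  · exact abs_minor_le_covol g B (fun j => σ (i.succAbove j))
  · exact norm_le_pi_norm (g.mulVec fun i => (z i : ℝ)) (σ i)

lemma IsIntBasis.sup_span {V : Submodule ℚ (Fin N → ℚ)} {k : ℕ} {B : Matrix (Fin N) (Fin k) ℤ}
    (h : IsIntBasis V B) {z : Fin N → ℤ} (hz : (fun i => (z i : ℚ)) ∉ V) :
    IsIntBasis (V ⊔ Submodule.span ℚ {fun i => (z i : ℚ)})
      (Matrix.of fun i => (Fin.cons (z i) (B i) : Fin (k + 1) → ℤ)) := by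
  have hspan : Submodule.span ℚ (range fun j i => (B i j : ℚ)) = V := by
    apply Submodule.eq_of_le_of_finrank_eq
    · rw [Submodule.span_le]; rintro _ ⟨j, rfl⟩; exact h.mem j
    · rw [finrank_span_eq_card h.indep, ← h.card]; simp
  have hcol :
      (fun j i => (((Matrix.of fun i => (Fin.cons (z i) (B i) : Fin (k + 1) → ℤ)) i j : ℤ) : ℚ)) =
      (Fin.cons (fun i => (z i : ℚ)) (fun j i => (B i j : ℚ)) : Fin (k + 1) → Fin N → ℚ) := by
    ext j i
    refine Fin.cases ?_ (fun j => ?_) j <;> simp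
  have hind : LinearIndependent ℚ (fun j i => (((Matrix.of fun i => (Fin.cons (z i) (B i) :
      Fin (k + 1) → ℤ)) i j : ℤ) : ℚ)) := by
    rw [hcol, linearIndependent_finCons, hspan]
    exact ⟨h.indep, hz⟩
  have hsp : Submodule.span ℚ (range (fun j i => (((Matrix.of fun i => (Fin.cons (z i) (B i) :
      Fin (k + 1) → ℤ)) i j : ℤ) : ℚ))) =
      V ⊔ Submodule.span ℚ {fun i => (z i : ℚ)} := by
    rw [hcol, Fin.range_cons, Submodule.span_insert, hspan, sup_comm]
  refine ⟨?_, fun j => ?_, hind⟩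
  · rw [← hsp, finrank_span_eq_card hind]; simp
  · rw [← hsp]
    exact Submodule.subset_span ⟨j, rfl⟩

lemma covol_sup_span_le (g : Matrix (Fin N) (Fin N) ℝ) {V : Submodule ℚ (Fin N → ℚ)}
    {z : Fin N → ℤ} (hz : (fun i => (z i : ℚ)) ∉ V) :
    covol g (intBasis (V ⊔ Submodule.span ℚ {fun i => (z i : ℚ)})) ≤
      N * covol g (intBasis V) * ‖g.mulVec fun i => (z i : ℝ)‖ := by
  have h := (intBasis_spec V).sup_span hz
  refine (covol_intBasis_le h g).trans ((covol_cons_le g _ z).trans ?_)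
  have h0 := covol_nonneg g (intBasis V)
  have : Module.finrank ℚ V + 1 ≤ N := by
    rw [h.card]
    simpa using Submodule.finrank_le (V ⊔ Submodule.span ℚ {fun i => (z i : ℚ)})
  gcongr

/-- The proper nonzero subspaces. -/
def properSub (N : ℕ) : Set (Submodule ℚ (Fin N → ℚ)) := {V | V ≠ ⊥ ∧ V ≠ ⊤}

lemma le_norm_mulVec_of_marked {g : ℝ → Matrix (Fin N) (Fin N) ℝ} {y ε : ℝ}
    (hg : |(g y).det| = 1) (hε : ε ≤ 1)
    (h : Marked (fun V x => covol (g x) (intBasis V)) ε (properSub N) y) {z : Fin N → ℤ}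
    (hz : z ≠ 0) : ε ≤ N * ‖(g y).mulVec fun i => (z i : ℝ)‖ := by
  obtain ⟨T, hTQ, hT, hT1, hTW⟩ := h
  set zq : Fin N → ℚ := fun i => (z i : ℚ) with hzq
  have hzq0 : zq ≠ 0 := by
    intro h0; apply hz; ext i
    have := congrFun h0 i
    simpa [zq] using this
  obtain ⟨V, ⟨hV, hzV⟩, hmax⟩ : ∃ V, (V ∈ insert ⊥ T ∧ zq ∉ V) ∧
      ∀ V', (V' ∈ insert ⊥ T ∧ zq ∉ V') → Module.finrank ℚ V' ≤ Module.finrank ℚ V := by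
    have hne : {V : Submodule ℚ (Fin N → ℚ) | V ∈ insert ⊥ T ∧ zq ∉ V}.Nonempty :=
      ⟨⊥, Or.inl rfl, by simpa using hzq0⟩
    obtain ⟨V, hV, h⟩ := WellFounded.has_min (InvImage.wf (fun V : Submodule ℚ (Fin N → ℚ) =>
      N - Module.finrank ℚ V) Nat.lt_wfRel.wf) _ hne
    refine ⟨V, hV, fun V' hV' => ?_⟩
    have h1 : ¬ (N - Module.finrank ℚ V' < N - Module.finrank ℚ V) := h V' hV'
    have h2 := Submodule.finrank_le V
    have h3 := Submodule.finrank_le V'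
    simp only [Module.finrank_fintype_fun_eq_card, Fintype.card_fin] at h2 h3
    omega
  have hVle : covol (g y) (intBasis V) ≤ 1 := by
    rcases hV with rfl | hV
    · exact (covol_bot _).le
    · exact hT1 V hV
  set W := V ⊔ Submodule.span ℚ {zq} with hW
  have hzW : zq ∈ W := Submodule.mem_sup_right (Submodule.mem_span_singleton_self _)
  have hW0 : W ≠ ⊥ := fun h0 => hzq0 (by simpa [h0] using hzW)
  have hcomp : ∀ V' ∈ T, V' ≤ W ∨ W ≤ V' := by
    intro V' hV'
    have hc : V' ≤ V ∨ V ≤ V' := by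
      rcases hV with rfl | hV
      · exact Or.inr bot_le
      · exact hT.total hV' hV
    by_cases hzV' : zq ∈ V'
    · right
      have : V ≤ V' := hc.resolve_left fun h => hzV (h hzV')
      exact sup_le this (by simpa [Submodule.span_le] using hzV')
    · left
      rcases hc with h | h
      · exact h.trans le_sup_left
      · have := Submodule.eq_of_le_of_finrank_le h (hmax V' ⟨Or.inr hV', hzV'⟩)
        rw [← this]; exact le_sup_left
  have hεW : ε ≤ covol (g y) (intBasis W) := by
    by_cases hWt : W = ⊤
    · rw [hWt]; exact hε.trans (one_le_covol_top hg)
    · exact hTW W ⟨hW0, hWt⟩ hcomp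
  refine hεW.trans ((covol_sup_span_le (g y) hzV).trans ?_)
  have h0 := norm_nonneg ((g y).mulVec fun i => (z i : ℝ))
  calc _ ≤ (N : ℝ) * 1 * ‖(g y).mulVec fun i => (z i : ℝ)‖ := by gcongr
    _ = _ := by rw [mul_one]

end Covol

end

section

/-- Minkowski's theorem on linear forms. -/
lemma exists_int_norm_mulVec_lt {k : ℕ} (hk : 0 < k) {A : Matrix (Fin k) (Fin k) ℝ} {r : ℝ}
    (hr : 0 < r) (hA0 : A.det ≠ 0) (hA : |A.det| < r ^ k) :
    ∃ u : Fin k → ℤ, u ≠ 0 ∧ ‖A.mulVec fun i => (u i : ℝ)‖ < r := by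
  classical
  have : Nonempty (Fin k) := ⟨⟨0, hk⟩⟩
  have hind : LinearIndependent ℝ A.transpose.row :=
    Matrix.linearIndependent_rows_of_det_ne_zero (A := A.transpose)
      (by rwa [Matrix.det_transpose])
  let b := basisOfLinearIndependentOfCardEqFinrank hind (by simp)
  have hb : ⇑b = A.transpose.row := coe_basisOfLinearIndependentOfCardEqFinrank _ _
  have hvol : volume (ZSpan.fundamentalDomain b) = ENNReal.ofReal |A.det| := by
    rw [ZSpan.volume_fundamentalDomain, hb, ← Matrix.det_transpose A]
    rfl
  have : Countable (Submodule.span ℤ (range b)).toAddSubgroup :=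
    inferInstanceAs (Countable (Submodule.span ℤ (range b)))
  obtain ⟨x, hx0, hx⟩ := exists_ne_zero_mem_lattice_of_measure_mul_two_pow_lt_measure
    (s := Metric.ball (0 : Fin k → ℝ) r)
    (ZSpan.isAddFundamentalDomain' b volume) (by intro x hx; simpa using hx) (convex_ball _ _) (by
      rw [hvol, Real.volume_pi_ball _ hr, Module.finrank_fintype_fun_eq_card, Fintype.card_fin,
        mul_pow, mul_comm, ENNReal.ofReal_mul (by positivity)]
      have : ENNReal.ofReal (2 ^ k) = 2 ^ k := by
        rw [ENNReal.ofReal_pow (by norm_num)]; simp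
      rw [this, mul_comm, mul_comm (2 ^ k)]
      refine (ENNReal.mul_lt_mul_iff_left (by simp) (by simp)).2 ?_
      exact (ENNReal.ofReal_lt_ofReal_iff (by positivity)).2 hA)
  have hmem : (x : Fin k → ℝ) ∈ Submodule.span ℤ (range b) := x.2
  obtain ⟨u, hu⟩ := (Submodule.mem_span_range_iff_exists_fun ℤ).1 hmem
  have hAu : A.mulVec (fun i => (u i : ℝ)) = x := by
    rw [← hu]
    ext i
    simp [Matrix.mulVec, dotProduct, Finset.sum_apply, hb, Matrix.row, mul_comm]
  refine ⟨u, fun h0 => hx0 ?_, ?_⟩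
  · ext i
    rw [← hAu, h0]
    simp [Matrix.mulVec, dotProduct]
  · rw [hAu]; simpa using hx

variable {N : ℕ}

lemma covol_ge_of_forall_norm_ge {g : Matrix (Fin N) (Fin N) ℝ} (hg : g.det ≠ 0) {ε₀ : ℝ}
    (hε₀ : 0 < ε₀) (h : ∀ z : Fin N → ℤ, z ≠ 0 → ε₀ ≤ ‖g.mulVec fun i => (z i : ℝ)‖)
    {V : Submodule ℚ (Fin N → ℚ)} {k : ℕ} {B : Matrix (Fin N) (Fin k) ℤ} (hB : IsIntBasis V B) :
    (ε₀ / N) ^ k ≤ covol g B := by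
  classical
  rcases Nat.eq_zero_or_pos k with hk | hk
  · rw [covol_of_eq_zero g hk, hk, pow_zero]
  have hkN : k ≤ N := by
    rw [hB.card]; simpa using Submodule.finrank_le V
  set Bℝ := B.map (Int.castRingHom ℝ) with hBℝ
  set G := g * Bℝ with hG
  obtain ⟨σ₀, hσ₀⟩ := hB.exists_minor
  have : Nonempty (Fin k → Fin N) := ⟨σ₀⟩
  obtain ⟨σ, hσ⟩ := Finite.exists_max fun σ : Fin k → Fin N => |minor G σ|
  have hBG : Bℝ = g⁻¹ * G := by
    rw [hG, ← Matrix.mul_assoc, Matrix.nonsing_inv_mul _ (isUnit_iff_ne_zero.2 hg), Matrix.one_mul]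
  set A := G.submatrix σ id with hA
  have hA0 : A.det ≠ 0 := by
    intro h0
    have h1 : ∀ τ, minor G τ = 0 := fun τ => by
      have := hσ τ
      rw [show minor G σ = 0 from h0, abs_zero] at this
      exact abs_nonpos_iff.1 this
    have h2 : minor Bℝ σ₀ = 0 := by
      rw [hBG, minor_mul]; simp [h1]
    rw [hBℝ, minor_map] at h2
    exact hσ₀ (by simpa using h2)
  have hcov : |A.det| ≤ covol g B := abs_minor_le_covol g B σ
  by_contra! hlt
  have hkR : (0 : ℝ) < k := by exact_mod_cast hk
  have hrk : (ε₀ / N) ^ k ≤ (ε₀ / k) ^ k := by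
    have : (k : ℝ) ≤ N := by exact_mod_cast hkN
    gcongr
  obtain ⟨u, hu0, hu⟩ := exists_int_norm_mulVec_lt hk (div_pos hε₀ hkR) hA0
    (hcov.trans_lt (hlt.trans_le hrk))
  set uR : Fin k → ℝ := fun i => (u i : ℝ) with huR
  have huR0 : uR ≠ 0 := by
    intro h0; apply hu0; ext i
    have := congrFun h0 i
    simpa [uR] using this
  have hz : (fun i => ((B.mulVec u) i : ℝ)) = Bℝ.mulVec uR := by
    ext i
    simp [Matrix.mulVec, dotProduct, Bℝ, uR]
  have hGz : g.mulVec (fun i => ((B.mulVec u) i : ℝ)) = G.mulVec uR := by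
    rw [hz, Matrix.mulVec_mulVec]
  have hAu0 : A.mulVec uR ≠ 0 := fun h0 => huR0 (Matrix.eq_zero_of_mulVec_eq_zero hA0 h0)
  have hAG : ∀ i, (A.mulVec uR) i = (G.mulVec uR) (σ i) := fun i => rfl
  have hz0 : B.mulVec u ≠ 0 := by
    intro h0
    apply hAu0
    ext i
    rw [hAG, ← hGz, h0]
    simp [Matrix.mulVec, dotProduct]
  have hle : ‖G.mulVec uR‖ ≤ k * ‖A.mulVec uR‖ := by
    refine (pi_norm_le_iff_of_nonneg (by positivity)).2 fun i => ?_
    have hAi : (G.row i ᵥ* A⁻¹) ᵥ* A = G.row i := by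
      rw [Matrix.vecMul_vecMul, Matrix.nonsing_inv_mul _ (isUnit_iff_ne_zero.2 hA0),
          Matrix.vecMul_one]
    have hsum : (G.mulVec uR) i = (G.row i ᵥ* A⁻¹) ⬝ᵥ (A.mulVec uR) := by
      rw [Matrix.dotProduct_mulVec, hAi]
      rfl
    have hc : ∀ j, |(G.row i ᵥ* A⁻¹) j| ≤ 1 := by
      intro j
      have h1 := congrFun (Matrix.det_smul_inv_vecMul_eq_cramer_transpose A (G.row i)
        (isUnit_iff_ne_zero.2 hA0)) j
      rw [Matrix.cramer_transpose_apply] at h1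
      have h2 : A.updateRow j (G.row i) = G.submatrix (Function.update σ j i) id := by
        ext a b
        by_cases hab : a = j
        · subst hab; simp
        · simp [Matrix.updateRow_ne hab, A, Function.update_of_ne hab]
      have h3 : |A.det| * |(G.row i ᵥ* A⁻¹) j| ≤ |A.det| * 1 := by
        rw [← abs_mul, mul_one]
        have : A.det * (G.row i ᵥ* A⁻¹) j = minor G (Function.update σ j i) := by
          rw [minor, ← h2, ← h1]; rfl
        rw [this]
        exact hσ _
      exact le_of_mul_le_mul_left h3 (abs_pos.2 hA0)
    rw [hsum, dotProduct]
    refine (norm_sum_le _ _).trans ?_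
    calc _ ≤ ∑ j : Fin k, ‖A.mulVec uR‖ := by
          refine Finset.sum_le_sum fun j _ => ?_
          rw [norm_mul]
          calc _ ≤ 1 * ‖A.mulVec uR‖ :=
                  mul_le_mul (hc j) (norm_le_pi_norm _ j) (norm_nonneg _) zero_le_one
            _ = _ := one_mul _
      _ = _ := by simp
  have h1 := h _ hz0
  rw [hGz] at h1
  have h2 : (k : ℝ) * ‖A.mulVec uR‖ < k * (ε₀ / k) := by gcongr
  rw [mul_div_cancel₀ _ hkR.ne'] at h2
  linarith

end

section

section RankOne
variable {R : Type*} [CommRing R]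

lemma det_add_vecMulVec {k : ℕ} (M : Matrix (Fin k) (Fin k) R) (v ρ : Fin k → R) :
    (M + Matrix.vecMulVec v ρ).det = M.det + ∑ i, v i * (M.updateRow i ρ).det := by
  classical
  have key : ∀ t : Finset (Fin k),
      (M + Matrix.vecMulVec (fun i => if i ∈ t then v i else 0) ρ).det =
        M.det + ∑ i ∈ t, v i * (M.updateRow i ρ).det := by
    intro t
    induction t using Finset.induction_on with
    | empty =>
      have : M + Matrix.vecMulVec (fun i => if i ∈ (∅ : Finset (Fin k)) then v i else 0) ρ = M := by
        ext i j; simp [Matrix.vecMulVec_apply]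
      rw [this]; simp
    | insert i t hi ih =>
      set M' := M + Matrix.vecMulVec (fun i => if i ∈ t then v i else 0) ρ with hM'
      have h1 : M + Matrix.vecMulVec (fun j => if j ∈ insert i t then v j else 0) ρ =
          M'.updateRow i (M' i + v i • ρ) := by
        ext a b
        by_cases hai : a = i
        · subst hai
          simp [hM', Matrix.vecMulVec_apply, hi]
        · simp [hM', Matrix.vecMulVec_apply, hai]
      have h2 : (M'.updateRow i ρ).det = (M.updateRow i ρ).det := by
        refine Matrix.det_eq_of_forall_row_eq_smul_add_const (fun j => if j ∈ t then v j else 0) i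
          (by simp [hi]) fun a b => ?_
        by_cases hai : a = i
        · subst hai; simp [hi]
        · simp [hM', Matrix.vecMulVec_apply, Matrix.updateRow_ne hai]
      have h3 : M'.updateRow i (M' i) = M' := Matrix.updateRow_eq_self M' i
      rw [h1, Matrix.det_updateRow_add, Matrix.det_updateRow_smul, h3, ih, h2,
        Finset.sum_insert hi]
      ring
  simpa using key Finset.univ

variable {N k : ℕ}

lemma minor_one_add_vecMulVec_mul (G : Matrix (Fin N) (Fin k) R) (v : Fin N → R) (a : Fin N)
    (σ : Fin k → Fin N) :
    minor ((1 + Matrix.vecMulVec v (Pi.single a 1)) * G) σ =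
      minor G σ + ∑ i, v (σ i) * minor G (Function.update σ i a) := by
  have h1 : ((1 + Matrix.vecMulVec v (Pi.single a 1)) * G).submatrix σ id =
      G.submatrix σ id + Matrix.vecMulVec (v ∘ σ) (G a) := by
    rw [Matrix.add_mul, Matrix.one_mul, Matrix.vecMulVec_mul, Matrix.single_one_vecMul]
    rfl
  rw [minor, h1, det_add_vecMulVec]
  congr 1
  refine Finset.sum_congr rfl fun i _ => ?_
  congr 2
  ext c j
  by_cases hci : c = i
  · subst hci; simp
  · simp [Matrix.updateRow_ne hci, Function.update_of_ne hci]

lemma minor_mul_minor (G : Matrix (Fin N) (Fin k) R) (α β : Fin k → Fin N) (b : Fin k) :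
    minor G α * minor G β =
      ∑ i, minor G (Function.update α i (β b)) * minor G (Function.update β b (α i)) := by
  set A := G.submatrix α id with hA
  set B := G.submatrix β id with hB
  have hupd : ∀ (τ : Fin k → Fin N) (i : Fin k) (a : Fin N),
      (G.submatrix τ id).updateRow i (G a) = G.submatrix (Function.update τ i a) id := by
    intro τ i a
    ext c j
    by_cases hci : c = i
    · subst hci; simp
    · simp [Matrix.updateRow_ne hci, Function.update_of_ne hci]
  have hcr : A.det • G (β b) = ∑ i, minor G (Function.update α i (β b)) • G (α i) := by
    have h1 := Matrix.mulVec_cramer Aᵀ (G (β b))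
    rw [Matrix.det_transpose] at h1
    rw [← h1]
    ext j
    simp only [Matrix.mulVec, dotProduct, Matrix.cramer_transpose_apply, Finset.sum_apply,
      Pi.smul_apply, smul_eq_mul, hA, hupd, Matrix.transpose_apply, minor]
    exact Finset.sum_congr rfl fun i _ => mul_comm _ _
  have hBb : B.updateRow b (G (β b)) = B := Matrix.updateRow_eq_self B b
  calc minor G α * minor G β = A.det * B.det := rfl
    _ = (B.updateRow b (A.det • G (β b))).det := by
        rw [Matrix.det_updateRow_smul, hBb]
    _ = (B.updateRow b (∑ i, minor G (Function.update α i (β b)) • G (α i))).det := by rw [hcr]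
    _ = ∑ i, minor G (Function.update α i (β b)) * (B.updateRow b (G (α i))).det := by
        have := map_sum
          ((Matrix.detRowAlternating (n := Fin k) (R := R)).toMultilinearMap.toLinearMap B b)
          (fun i => minor G (Function.update α i (β b)) • G (α i)) Finset.univ
        refine this.trans (Finset.sum_congr rfl fun i _ => ?_)
        rw [map_smul]
        rfl
    _ = _ := by
        refine Finset.sum_congr rfl fun i _ => ?_
        rw [hB, hupd]; rfl

end RankOne

end

section

variable {d : ℕ}

/-- The matrix of the linear forms `z ↦ z i + f i * z 0 - ψ i * (z 1 + f 1 * z 0)`. -/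
noncomputable def curveMat (f ψ : Fin (d + 2) → ℝ) : Matrix (Fin (d + 2)) (Fin (d + 2)) ℝ :=
  (1 + Matrix.vecMulVec (-ψ) (Pi.single 1 1)) * (1 + Matrix.vecMulVec f (Pi.single 0 1))

lemma one_add_vecMulVec_mul_apply {N k : ℕ} (v : Fin N → ℝ) (a : Fin N)
    (M : Matrix (Fin N) (Fin k) ℝ) (i : Fin N) (j : Fin k) :
    ((1 + Matrix.vecMulVec v (Pi.single a 1)) * M : Matrix (Fin N) (Fin k) ℝ) i j =
      M i j + v i * M a j := by
  rw [Matrix.add_mul, Matrix.one_mul, Matrix.vecMulVec_mul, Matrix.single_one_vecMul]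
  rfl

lemma curveMat_apply (f ψ : Fin (d + 2) → ℝ) (i j : Fin (d + 2)) :
    curveMat f ψ i j = (if i = j then 1 else 0) + f i * (if j = 0 then 1 else 0) -
      ψ i * ((if j = 1 then 1 else 0) + f 1 * (if j = 0 then 1 else 0)) := by
  rw [curveMat, one_add_vecMulVec_mul_apply]
  simp only [Matrix.add_apply, Matrix.one_apply, Matrix.vecMulVec_apply, Pi.single_apply,
    Pi.neg_apply, @eq_comm _ (1 : Fin (d + 2)) j]
  ring

lemma curveMat_mulVec (f ψ : Fin (d + 2) → ℝ) (z : Fin (d + 2) → ℝ) (i : Fin (d + 2)) :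
    (curveMat f ψ).mulVec z i = z i + f i * z 0 - ψ i * (z 1 + f 1 * z 0) := by
  simp only [Matrix.mulVec, dotProduct, curveMat_apply]
  simp [sub_mul, add_mul, mul_add, Finset.sum_add_distrib, Finset.sum_sub_distrib, mul_assoc]

lemma det_one_add_vecMulVec {N : ℕ} (v : Fin N → ℝ) (a : Fin N) :
    (1 + Matrix.vecMulVec v (Pi.single a 1)).det = 1 + v a := by
  rw [Matrix.vecMulVec_eq Unit, Matrix.det_one_add_replicateCol_mul_replicateRow]
  simp

lemma det_curveMat {f ψ : Fin (d + 2) → ℝ} (hf : f 0 = 0) (hψ : ψ 1 = 0) :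
    (curveMat f ψ).det = 1 := by
  rw [curveMat, Matrix.det_mul, det_one_add_vecMulVec, det_one_add_vecMulVec]
  simp [hf, hψ]

lemma curveMat_eq_mul {f f' ψ : Fin (d + 2) → ℝ} (hf : f 0 = 0) (hψ : ψ 0 = 0) :
    curveMat f' ψ = (1 + Matrix.vecMulVec (fun i => f' i - f i - ψ i * (f' 1 - f 1))
      (Pi.single 0 1)) * curveMat f ψ := by
  ext i j
  rw [one_add_vecMulVec_mul_apply]
  simp only [curveMat_apply, hf, hψ, @eq_comm _ (0 : Fin (d + 2)) j]
  ring

/-- The exponents of the diagonal flow. -/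
noncomputable def wt (r : Fin (d + 2) → ℝ) (s C : ℝ) (i : Fin (d + 2)) : ℝ :=
  if i = 0 then -((1 - r 1) * C + s) / 2 else if i = 1 then (s - (1 - r 1) * C) / 2 else r i * C

/-- A weight with positive entries apart from the entry `0` and with maximal entry at `1`. -/
structure IsWeight (r : Fin (d + 2) → ℝ) (m : ℝ) : Prop where
  zero : r 0 = 0
  pos : 0 < m
  le : ∀ i, i ≠ 0 → m ≤ r i
  max : ∀ i, r i ≤ r 1
  sum : ∑ i, r i = 1

section count
variable {k : ℕ} {r : Fin (d + 2) → ℝ} {m : ℝ}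

/-- Number of times `σ` takes the value `a`. -/
noncomputable def cnt (a : Fin (d + 2)) (σ : Fin k → Fin (d + 2)) : ℝ :=
  ∑ i, if σ i = a then 1 else 0

/-- Total weight of the rows other than `0` and `1` selected by `σ`. -/
noncomputable def rsum (r : Fin (d + 2) → ℝ) (σ : Fin k → Fin (d + 2)) : ℝ :=
  ∑ i, if σ i = 0 then 0 else if σ i = 1 then 0 else r (σ i)

lemma sum_wt (r : Fin (d + 2) → ℝ) (s C : ℝ) (σ : Fin k → Fin (d + 2)) :
    ∑ i, wt r s C (σ i) = cnt 0 σ * (-((1 - r 1) * C + s) / 2) +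
      cnt 1 σ * ((s - (1 - r 1) * C) / 2) + rsum r σ * C := by
  simp only [cnt, rsum, Finset.sum_mul, ← Finset.sum_add_distrib]
  refine Finset.sum_congr rfl fun i _ => ?_
  by_cases h0 : σ i = 0
  · simp [wt, h0]
  · by_cases h1 : σ i = 1 <;> simp [wt, h0, h1]

lemma cnt_eq_one {σ : Fin k → Fin (d + 2)} (hσ : Function.Injective σ) {a : Fin (d + 2)} {i : Fin k}
    (hi : σ i = a) : cnt a σ = 1 := by
  have : ∀ j, (if σ j = a then (1 : ℝ) else 0) = if j = i then 1 else 0 := by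
    intro j
    simp only [← hi, hσ.eq_iff]
  simp [cnt, this]

lemma cnt_eq_zero {σ : Fin k → Fin (d + 2)} {a : Fin (d + 2)} (h : ∀ i, σ i ≠ a) : cnt a σ = 0 := by
  simp [cnt, h]

lemma IsWeight.nonneg (hr : IsWeight r m) (i : Fin (d + 2)) : 0 ≤ r i := by
  by_cases h : i = 0
  · rw [h, hr.zero]
  · exact hr.pos.le.trans (hr.le i h)

lemma rsum_nonneg (hr : IsWeight r m) (σ : Fin k → Fin (d + 2)) : 0 ≤ rsum r σ := by
  refine Finset.sum_nonneg fun i _ => ?_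
  split_ifs <;> first | exact le_rfl | exact hr.nonneg _

lemma IsWeight.sum_rest (hr : IsWeight r m) :
    ∑ i, (if i = 0 then 0 else if i = 1 then 0 else r i) = 1 - r 1 := by
  have : ∀ i, (if i = 0 then 0 else if i = 1 then 0 else r i) =
      r i - (if i = 1 then r 1 else 0) := by
    intro i
    by_cases h0 : i = 0
    · subst h0; simp [hr.zero]
    · by_cases h1 : i = 1
      · subst h1; simp
      · simp [h0, h1]
  simp_rw [this]
  rw [Finset.sum_sub_distrib, hr.sum]
  simp

lemma rsum_eq (r : Fin (d + 2) → ℝ) {σ : Fin k → Fin (d + 2)} (hσ : Function.Injective σ) :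
    rsum r σ = ∑ i ∈ Finset.univ.map ⟨σ, hσ⟩, (if i = 0 then 0 else if i = 1 then 0 else r i) := by
  rw [Finset.sum_map]; rfl

lemma rsum_le (hr : IsWeight r m) {σ : Fin k → Fin (d + 2)} (hσ : Function.Injective σ) :
    rsum r σ ≤ 1 - r 1 := by
  rw [rsum_eq r hσ, ← hr.sum_rest]
  refine Finset.sum_le_sum_of_subset_of_nonneg (Finset.subset_univ _) fun i _ _ => ?_
  split_ifs <;> first | exact le_rfl | exact hr.nonneg _

lemma le_rsum (hr : IsWeight r m) (hk : 0 < k) {σ : Fin k → Fin (d + 2)}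
    (h0 : ∀ i, σ i ≠ 0) (h1 : ∀ i, σ i ≠ 1) : m ≤ rsum r σ := by
  have hi : m ≤ (fun i => if σ i = 0 then 0 else if σ i = 1 then 0 else r (σ i))
      (⟨0, hk⟩ : Fin k) := by
    simp only [h0, h1, if_false]
    exact hr.le _ (h0 _)
  refine hi.trans (Finset.single_le_sum
      (f := fun i => if σ i = 0 then 0 else if σ i = 1 then 0 else r (σ i))
    (fun i _ => ?_) (Finset.mem_univ _))
  split_ifs <;> first | exact le_rfl | exact hr.nonneg _

lemma rsum_add_le (hr : IsWeight r m) (hk : k < d + 2) {σ : Fin k → Fin (d + 2)}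
    (hσ : Function.Injective σ) {i₀ i₁ : Fin k} (h0 : σ i₀ = 0) (h1 : σ i₁ = 1) :
    rsum r σ + m ≤ 1 - r 1 := by
  obtain ⟨j, hj⟩ : ∃ j, ∀ i, σ i ≠ j := by
    by_contra! h
    have := Fintype.card_le_of_surjective σ h
    simp at this; omega
  rw [rsum_eq r hσ, ← hr.sum_rest]
  have hj0 : j ≠ 0 := fun h => hj i₀ (h0.trans h.symm)
  have hj1 : j ≠ 1 := fun h => hj i₁ (h1.trans h.symm)
  have hjm : j ∉ Finset.univ.map ⟨σ, hσ⟩ := by simpa using hj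
  calc _ ≤ ∑ i ∈ insert j (Finset.univ.map ⟨σ, hσ⟩),
          (if i = 0 then 0 else if i = 1 then 0 else r i) := by
        rw [Finset.sum_insert hjm, add_comm]
        simp only [hj0, hj1, if_false]
        gcongr
        exact hr.le _ hj0
    _ ≤ _ := by
        refine Finset.sum_le_sum_of_subset_of_nonneg (Finset.subset_univ _) fun i _ _ => ?_
        split_ifs <;> first | exact le_rfl | exact hr.nonneg _

lemma local_minors_false (hr : IsWeight r m) (hk0 : 0 < k) (hkN : k < d + 2)
    (G : Matrix (Fin (d + 2)) (Fin k) ℝ) {s C l Δ K t : ℝ} (hΔ0 : 0 ≤ Δ) (hΔ : Δ ≤ l)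
    (h0 : ∀ σ : Fin k → Fin (d + 2), (∃ i, σ i = 0) → (∀ i, σ i ≠ 1) →
      |minor G σ| ≤ K * Real.exp (-∑ i, wt r s C (σ i) - 4 * l))
    (h1 : ∀ σ : Fin k → Fin (d + 2), |minor G σ| ≤ Real.exp (-∑ i, wt r s C (σ i)))
    (ht : 0 < t) (hK : 0 ≤ K) (ht1 : K * Real.exp (-(l * (3 / 2))) < t)
    (ht2 : Real.exp (-(l * (3 / 2))) < t)
    (ht3 : Real.exp (-(m * Δ)) < t) (ht4 : k * K * Real.exp (-(2 * l)) < t ^ 2)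
    (hp : ∃ α : Fin k → Fin (d + 2),
      t ≤ Real.exp (∑ i, wt r (s - 4 * l) (C + Δ) (α i)) * |minor G α|)
    (hm : ∃ β : Fin k → Fin (d + 2),
      t ≤ Real.exp (∑ i, wt r (s - 4 * l) (C - Δ) (β i)) * |minor G β|) : False := by
  obtain ⟨α, hα⟩ := hp
  obtain ⟨β, hβ⟩ := hm
  have hinj : ∀ {σ : Fin k → Fin (d + 2)} {x : ℝ}, t ≤ x * |minor G σ| → Function.Injective σ := by
    intro σ x h
    by_contra hσ
    rw [minor_eq_zero_of_not_injective G hσ] at h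
    simp at h; linarith
  have hαi := hinj hα
  have hβi := hinj hβ
  have hr1 : 0 ≤ r 1 := hr.nonneg 1
  have hr1' : r 1 ≤ 1 := by have := rsum_le hr hαi; have := rsum_nonneg hr α; linarith
  have hr1Δ : (1 - r 1) * Δ ≤ l := by nlinarith
  have hr1Δ0 : 0 ≤ (1 - r 1) * Δ := mul_nonneg (by linarith) hΔ0
  have e1 : ∀ {σ : Fin k → Fin (d + 2)} {x c : ℝ}, t ≤ Real.exp x * |minor G σ| →
      Real.exp c < t → ¬ (x - ∑ i, wt r s C (σ i) ≤ c) := by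
    intro σ x c h hc hle
    have := mul_le_mul_of_nonneg_left (h1 σ) (Real.exp_pos x).le
    rw [← Real.exp_add] at this
    have h3 : Real.exp (x + -∑ i, wt r s C (σ i)) ≤ Real.exp c := Real.exp_le_exp.2 (by linarith)
    linarith
  have e0 : ∀ {σ : Fin k → Fin (d + 2)} {x c : ℝ}, t ≤ Real.exp x * |minor G σ| →
      K * Real.exp c < t → (∃ i, σ i = 0) → (∀ i, σ i ≠ 1) →
      ¬ (x - ∑ i, wt r s C (σ i) - 4 * l ≤ c) := by
    intro σ x c h hc hs0 hs1 hle
    have := mul_le_mul_of_nonneg_left (h0 σ hs0 hs1) (Real.exp_pos x).le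
    rw [mul_left_comm, ← Real.exp_add] at this
    have h3 : K * Real.exp (x + (-∑ i, wt r s C (σ i) - 4 * l)) ≤ K * Real.exp c :=
      mul_le_mul_of_nonneg_left (Real.exp_le_exp.2 (by linarith)) hK
    linarith
  have hαΔ0 : 0 ≤ rsum r α * Δ := mul_nonneg (rsum_nonneg hr α) hΔ0
  have hβΔ0 : 0 ≤ rsum r β * Δ := mul_nonneg (rsum_nonneg hr β) hΔ0
  have hαΔ1 : rsum r α * Δ ≤ (1 - r 1) * Δ := mul_le_mul_of_nonneg_right (rsum_le hr hαi) hΔ0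
  -- `α` avoids both special rows
  have hα1 : ∀ i, α i ≠ 1 := by
    intro i₁ hi₁
    by_cases h : ∃ i₀, α i₀ = 0
    · obtain ⟨i₀, hi₀⟩ := h
      refine e1 hα ht3 ?_
      have := mul_le_mul_of_nonneg_right (rsum_add_le hr hkN hαi hi₀ hi₁) hΔ0
      rw [sum_wt, sum_wt, cnt_eq_one hαi hi₀, cnt_eq_one hαi hi₁]
      linarith
    · push Not at h
      refine e1 hα ht2 ?_
      rw [sum_wt, sum_wt, cnt_eq_zero h, cnt_eq_one hαi hi₁]
      linarith
  have hα0 : ∀ i, α i ≠ 0 := by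
    intro i₀ hi₀
    refine e0 hα ht1 ⟨i₀, hi₀⟩ hα1 ?_
    rw [sum_wt, sum_wt, cnt_eq_zero hα1, cnt_eq_one hαi hi₀]
    linarith
  obtain ⟨b₁, hb₁⟩ : ∃ b, β b = 1 := by
    by_contra! h
    by_cases h' : ∃ i₀, β i₀ = 0
    · obtain ⟨i₀, hi₀⟩ := h'
      refine e0 hβ ht1 ⟨i₀, hi₀⟩ h ?_
      rw [sum_wt, sum_wt, cnt_eq_zero h, cnt_eq_one hβi hi₀]
      linarith
    · push Not at h'
      refine e1 hβ ht3 ?_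
      have := mul_le_mul_of_nonneg_right (le_rsum hr hk0 h' h) hΔ0
      rw [sum_wt, sum_wt, cnt_eq_zero h, cnt_eq_zero h']
      linarith
  obtain ⟨b₀, hb₀⟩ : ∃ b, β b = 0 := by
    by_contra! h
    refine e1 hβ ht2 ?_
    rw [sum_wt, sum_wt, cnt_eq_zero h, cnt_eq_one hβi hb₁]
    linarith
  have hb01 : b₁ ≠ b₀ := fun h => by rw [h, hb₀] at hb₁; simp at hb₁
  -- lower bounds
  have hlow : ∀ {σ : Fin k → Fin (d + 2)} {x : ℝ}, t ≤ Real.exp x * |minor G σ| →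
      x - ∑ i, wt r s C (σ i) ≤ l → t * Real.exp (-∑ i, wt r s C (σ i) - l) ≤ |minor G σ| := by
    intro σ x h hx
    have h2 : t * Real.exp (-x) ≤ |minor G σ| := by
      have := mul_le_mul_of_nonneg_left h (Real.exp_pos (-x)).le
      rw [← mul_assoc, ← Real.exp_add, neg_add_cancel, Real.exp_zero, one_mul] at this
      linarith
    refine le_trans ?_ h2
    exact mul_le_mul_of_nonneg_left (Real.exp_le_exp.2 (by linarith)) ht.le
  have hαl := hlow hα (by
    rw [sum_wt, sum_wt, cnt_eq_zero hα0, cnt_eq_zero hα1]; linarith)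
  have hβl := hlow hβ (by
    rw [sum_wt, sum_wt, cnt_eq_one hβi hb₀, cnt_eq_one hβi hb₁]; linarith)
  have hprod := mul_le_mul hαl hβl (by positivity) (abs_nonneg _)
  rw [← abs_mul, minor_mul_minor G α β b₀, hb₀] at hprod
  have hterm : ∀ i, |minor G (Function.update α i 0) * minor G (Function.update β b₀ (α i))| ≤
      K * Real.exp (-∑ i, wt r s C (α i) - ∑ i, wt r s C (β i) - 4 * l) := by
    intro i
    rw [abs_mul]
    have h2 := h0 (Function.update α i 0) ⟨i, by simp⟩ (fun j => by
      by_cases hji : j = i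
      · subst hji; simp
      · rw [Function.update_of_ne hji]; exact hα1 j)
    have h3 := h1 (Function.update β b₀ (α i))
    have hupd : ∀ (σ : Fin k → Fin (d + 2)) (j : Fin k) (a : Fin (d + 2)),
        ∑ i, wt r s C (Function.update σ j a i) = ∑ i, wt r s C (σ i) - wt r s C (σ j) +
            wt r s C a := by
      intro σ j a
      rw [← Finset.add_sum_erase _ _ (Finset.mem_univ j),
        ← Finset.add_sum_erase Finset.univ (fun i => wt r s C (σ i)) (Finset.mem_univ j)]
      have : ∑ i ∈ Finset.univ.erase j, wt r s C (Function.update σ j a i) =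
          ∑ i ∈ Finset.univ.erase j, wt r s C (σ i) :=
        Finset.sum_congr rfl fun i hi => by rw [Function.update_of_ne (Finset.ne_of_mem_erase hi)]
      rw [this]; simp; ring
    refine (mul_le_mul h2 h3 (abs_nonneg _) (by positivity)).trans (le_of_eq ?_)
    rw [mul_assoc, ← Real.exp_add, hupd, hupd, hb₀]
    ring_nf
  have hsum := (Finset.abs_sum_le_sum_abs _ _).trans (Finset.sum_le_sum
    fun i (_ : i ∈ Finset.univ) => hterm i)
  have hfin := hprod.trans hsum
  simp only [Finset.sum_const, Finset.card_univ, Fintype.card_fin, nsmul_eq_mul] at hfin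
  set E := -∑ i, wt r s C (α i) - ∑ i, wt r s C (β i) with hE
  have hL : t * Real.exp (-∑ i, wt r s C (α i) - l) * (t * Real.exp (-∑ i, wt r s C (β i) - l)) =
      t ^ 2 * Real.exp (E - 2 * l) := by
    rw [mul_mul_mul_comm, ← Real.exp_add, hE]; ring_nf
  have hR : (k : ℝ) * (K * Real.exp (E - 4 * l)) = k * K * Real.exp (-(2 * l)) *
      Real.exp (E - 2 * l) := by
    rw [mul_assoc (k * K), ← Real.exp_add, mul_assoc (k : ℝ)]; ring_nf
  rw [hL, hR] at hfin
  have := le_of_mul_le_mul_right hfin (Real.exp_pos _)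
  linarith

end count

end

section

variable {d : ℕ}

/-- Quantitative data of a curve `f` whose coordinate `1` is a coordinate of the line,
`ψ` being the quotients of derivatives of the other coordinates. -/
structure IsCurve (f ψ : ℝ → Fin (d + 2) → ℝ) (D : Set ℝ) (c K : ℝ) : Prop where
  f_zero : ∀ x, f x 0 = 0
  ψ_zero : ∀ x, ψ x 0 = 0
  ψ_one : ∀ x, ψ x 1 = 0
  c_pos : 0 < c
  K_pos : 0 < K
  le_f_one : ∀ x ∈ D, ∀ y ∈ D, c * |y - x| ≤ |f y 1 - f x 1|
  f_lip : ∀ x ∈ D, ∀ y ∈ D, ∀ i, |f y i - f x i| ≤ K * |y - x|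
  ψ_lip : ∀ x ∈ D, ∀ y ∈ D, ∀ i, |ψ y i - ψ x i| ≤ K * |y - x|
  taylor : ∀ x ∈ D, ∀ y ∈ D, ∀ i, i ≠ 1 →
    |f y i - f x i - ψ x i * (f y 1 - f x 1)| ≤ K * |y - x| ^ 2

/-- The flow matrix along the curve. -/
noncomputable def flowMat (r : Fin (d + 2) → ℝ) (f ψ : ℝ → Fin (d + 2) → ℝ) (s C x : ℝ) :
    Matrix (Fin (d + 2)) (Fin (d + 2)) ℝ :=
  Matrix.diagonal (fun i => Real.exp (wt r s C i)) * curveMat (f x) (ψ x)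

section
variable {f ψ : ℝ → Fin (d + 2) → ℝ} {D : Set ℝ} {c K m : ℝ} {r : Fin (d + 2) → ℝ}

lemma flowMat_mulVec (s C x : ℝ) (z : Fin (d + 2) → ℝ) (i : Fin (d + 2)) :
    (flowMat r f ψ s C x).mulVec z i = Real.exp (wt r s C i) *
      (z i + f x i * z 0 - ψ x i * (z 1 + f x 1 * z 0)) := by
  rw [flowMat, ← Matrix.mulVec_mulVec, Matrix.mulVec_diagonal, curveMat_mulVec]

lemma IsWeight.sum_wt_univ (hr : IsWeight r m) (s C : ℝ) : ∑ i, wt r s C i = 0 := by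
  have h := sum_wt r s C (id : Fin (d + 2) → Fin (d + 2))
  simp only [id] at h
  have c0 : cnt 0 (id : Fin (d + 2) → Fin (d + 2)) = 1 :=
    cnt_eq_one Function.injective_id (i := 0) rfl
  have c1 : cnt 1 (id : Fin (d + 2) → Fin (d + 2)) = 1 :=
    cnt_eq_one Function.injective_id (i := 1) rfl
  rw [h, c0, c1]
  have : rsum r (id : Fin (d + 2) → Fin (d + 2)) = 1 - r 1 := hr.sum_rest
  rw [this]; ring

lemma det_flowMat (hc : IsCurve f ψ D c K) (hr : IsWeight r m) (s C x : ℝ) :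
    (flowMat r f ψ s C x).det = 1 := by
  rw [flowMat, Matrix.det_mul, Matrix.det_diagonal, det_curveMat (hc.f_zero x) (hc.ψ_one x),
    ← Real.exp_sum, hr.sum_wt_univ, Real.exp_zero, one_mul]

lemma minor_flowMat_mul {k : ℕ} (s C x : ℝ) (B : Matrix (Fin (d + 2)) (Fin k) ℝ)
    (σ : Fin k → Fin (d + 2)) :
    minor (flowMat r f ψ s C x * B) σ =
      Real.exp (∑ i, wt r s C (σ i)) * minor (curveMat (f x) (ψ x) * B) σ := by
  rw [flowMat, Matrix.mul_assoc, minor_diagonal_mul, Real.exp_sum]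

lemma exists_minor_eq_covol {N k : ℕ} (g : Matrix (Fin (N + 1)) (Fin (N + 1)) ℝ)
    (B : Matrix (Fin (N + 1)) (Fin k) ℤ) :
    ∃ σ, covol g B = |minor (g * B.map (Int.castRingHom ℝ)) σ| := by
  obtain ⟨σ, hσ⟩ := Finite.exists_max fun σ => |minor (g * B.map (Int.castRingHom ℝ)) σ|
  exact ⟨σ, le_antisymm (covol_le (abs_nonneg _) hσ) (abs_minor_le_covol g B σ)⟩

lemma minor_curveMat_of_one {k : ℕ} (g φ : Fin (d + 2) → ℝ) (hφ : φ 1 = 0)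
    (B : Matrix (Fin (d + 2)) (Fin k) ℝ) {τ : Fin k → Fin (d + 2)} {i₀ : Fin k} (h : τ i₀ = 1) :
    minor (curveMat g φ * B) τ =
      minor ((1 + Matrix.vecMulVec g (Pi.single (0 : Fin (d + 2)) (1 : ℝ))) * B) τ := by
  rw [curveMat, Matrix.mul_assoc, minor_one_add_vecMulVec_mul, Finset.sum_eq_zero, add_zero]
  intro i _
  by_cases hi : i = i₀
  · subst hi; simp [h, hφ]
  · rw [minor_eq_zero_of_not_injective, mul_zero]
    intro hinj
    refine hi (hinj ?_)
    rw [Function.update_self, Function.update_of_ne (Ne.symm hi), h]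

lemma sum_wt_update {k : ℕ} (s C : ℝ) (σ : Fin k → Fin (d + 2)) (j : Fin k) (a : Fin (d + 2)) :
    ∑ i, wt r s C (Function.update σ j a i) =
      ∑ i, wt r s C (σ i) - wt r s C (σ j) + wt r s C a := by
  rw [← Finset.add_sum_erase _ _ (Finset.mem_univ j),
    ← Finset.add_sum_erase Finset.univ (fun i => wt r s C (σ i)) (Finset.mem_univ j)]
  have : ∑ i ∈ Finset.univ.erase j, wt r s C (Function.update σ j a i) =
      ∑ i ∈ Finset.univ.erase j, wt r s C (σ i) :=
    Finset.sum_congr rfl fun i hi => by rw [Function.update_of_ne (Finset.ne_of_mem_erase hi)]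
  rw [this]; simp; ring

lemma abs_minor_zero_le (hc : IsCurve f ψ D c K) (hr : IsWeight r m) {k : ℕ} (hk : k ≤ d + 2)
    (B : Matrix (Fin (d + 2)) (Fin k) ℝ) {s C l : ℝ} (hl : 0 ≤ l) (hs : 9 * l ≤ s)
    (hC : (1 + r 1) * C = s + l) {x y : ℝ} (hx : x ∈ D) (hy : y ∈ D)
    (hxy1 : Real.exp (-(s - 4 * l)) ≤ |y - x|) (hxy2 : |y - x| ≤ 2 * Real.exp (-(s - 4 * l)))
    (h1x : ∀ σ, |minor (curveMat (f x) (ψ x) * B) σ| ≤ Real.exp (-∑ i, wt r s C (σ i)))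
    (h1y : ∀ σ, |minor (curveMat (f y) (ψ y) * B) σ| ≤ Real.exp (-∑ i, wt r s C (σ i)))
    {σ : Fin k → Fin (d + 2)} {i₀ : Fin k} (h0 : σ i₀ = 0) (h1 : ∀ i, σ i ≠ 1) :
    |minor (curveMat (f x) (ψ x) * B) σ| ≤
      ((2 + 4 * K * (d + 2)) / c) * Real.exp (-∑ i, wt r s C (σ i) - 4 * l) := by
  have hc0 := hc.c_pos
  have hK0 := hc.K_pos
  by_cases hσ : Function.Injective σ
  swap
  · rw [minor_eq_zero_of_not_injective _ hσ, abs_zero]; positivity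
  have hr1 := hr.nonneg 1
  have hC0 : 0 ≤ C := by
    by_contra! h
    nlinarith
  set τ := Function.update σ i₀ 1 with hτ
  have hτ0 : τ i₀ = 1 := by simp [hτ]
  have hback : Function.update τ i₀ 0 = σ := by
    rw [hτ, Function.update_idem, ← h0, Function.update_eq_self]
  set W := ∑ i, wt r s C (σ i) with hW
  have hWτ : ∑ i, wt r s C (τ i) = W + s := by
    have h3 : wt r s C 1 - wt r s C 0 = s := by simp [wt]; ring
    rw [hτ, sum_wt_update, h0, ← hW]; linarith
  have hmy : minor (curveMat (f y) (ψ y) * B) τ = minor (curveMat (f y) (ψ x) * B) τ := by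
    rw [minor_curveMat_of_one _ _ (hc.ψ_one y) B hτ0, minor_curveMat_of_one _ _ (hc.ψ_one x) B hτ0]
  rw [curveMat_eq_mul (f := f x) (f' := f y) (hc.f_zero x) (hc.ψ_zero x), Matrix.mul_assoc,
    minor_one_add_vecMulVec_mul, ← Finset.add_sum_erase _ _ (Finset.mem_univ i₀), hτ0, hback,
    hc.ψ_one x] at hmy
  set e := Real.exp (-(s - 4 * l)) with he
  have he0 : 0 < e := Real.exp_pos _
  have hrest : |∑ i ∈ Finset.univ.erase i₀, (f y (τ i) - f x (τ i) - ψ x (τ i) * (f y 1 - f x 1)) *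
      minor (curveMat (f x) (ψ x) * B) (Function.update τ i 0)| ≤
      (d + 2) * (K * (2 * e) ^ 2 * Real.exp (-W - 4 * l + (s - 4 * l))) := by
    refine (Finset.abs_sum_le_sum_abs _ _).trans ?_
    have hterm : ∀ i ∈ Finset.univ.erase i₀, |(f y (τ i) - f x (τ i) - ψ x (τ i) *
        (f y 1 - f x 1)) *
        minor (curveMat (f x) (ψ x) * B) (Function.update τ i 0)| ≤
        K * (2 * e) ^ 2 * Real.exp (-W - 4 * l + (s - 4 * l)) := by
      intro i hi
      have hii : i ≠ i₀ := Finset.ne_of_mem_erase hi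
      have hτi : τ i = σ i := by rw [hτ, Function.update_of_ne hii]
      have hσi0 : σ i ≠ 0 := fun h => hii (hσ (h.trans h0.symm))
      rw [abs_mul]
      refine mul_le_mul ?_ ?_ (abs_nonneg _) (by positivity)
      · refine (hc.taylor x hx y hy _ (by rw [hτi]; exact h1 i)).trans ?_
        gcongr
      · refine (h1x _).trans (Real.exp_le_exp.2 ?_)
        rw [sum_wt_update, hWτ, hτi]
        simp only [wt, hσi0, h1 i, if_true, if_false]
        have := mul_le_mul_of_nonneg_right (hr.max (σ i)) hC0
        linarith
    refine (Finset.sum_le_sum hterm).trans ?_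
    rw [Finset.sum_const, nsmul_eq_mul]
    refine mul_le_mul_of_nonneg_right ?_ (by positivity)
    have h2 : (Finset.univ.erase i₀).card ≤ d + 2 := by
      refine (Finset.card_le_univ _).trans (by simpa using hk)
    exact_mod_cast h2
  have hmain : c * e * |minor (curveMat (f x) (ψ x) * B) σ| ≤
      2 * Real.exp (-(W + s)) + (d + 2) * (K * (2 * e) ^ 2 *
          Real.exp (-W - 4 * l + (s - 4 * l))) := by
    have h2 : c * e ≤ |f y 1 - f x 1| :=
      (mul_le_mul_of_nonneg_left hxy1 hc0.le).trans (hc.le_f_one x hx y hy)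
    refine (mul_le_mul_of_nonneg_right h2 (abs_nonneg _)).trans ?_
    rw [← abs_mul]
    have h3 : (f y 1 - f x 1) * minor (curveMat (f x) (ψ x) * B) σ =
      minor (curveMat (f y) (ψ y) * B) τ - minor (curveMat (f x) (ψ x) * B) τ -
      ∑ i ∈ Finset.univ.erase i₀, (f y (τ i) - f x (τ i) - ψ x (τ i) * (f y 1 - f x 1)) *
      minor (curveMat (f x) (ψ x) * B) (Function.update τ i 0) := by
      rw [hmy]; ring
    rw [h3]
    have h4 := h1x τ
    have h5 := h1y τ
    rw [hWτ] at h4 h5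
    refine (abs_sub _ _).trans ?_
    have := abs_sub (minor (curveMat (f y) (ψ y) * B) τ) (minor (curveMat (f x) (ψ x) * B) τ)
    linarith
  have he1 : Real.exp (-(W + s)) = e * Real.exp (-W - 4 * l) := by
    rw [he, ← Real.exp_add]; ring_nf
  have he2 : e * Real.exp (-W - 4 * l + (s - 4 * l)) = Real.exp (-W - 4 * l) := by
    rw [he, ← Real.exp_add]; ring_nf
  have hR : 2 * Real.exp (-(W + s)) + (d + 2) * (K * (2 * e) ^ 2 *
      Real.exp (-W - 4 * l + (s - 4 * l))) =
      e * ((2 + 4 * K * (d + 2)) * Real.exp (-W - 4 * l)) := by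
    rw [he1, ← he2]
    have : K * (2 * e) ^ 2 * Real.exp (-W - 4 * l + (s - 4 * l)) =
      4 * K * e * (e * Real.exp (-W - 4 * l + (s - 4 * l))) := by ring
    rw [this, he2]; ring
  rw [hR, mul_comm c e, mul_assoc] at hmain
  have := le_of_mul_le_mul_left hmain he0
  rw [div_mul_eq_mul_div, le_div_iff₀ hc0]
  linarith

lemma exists_mul_exp_lt {δ : ℝ} (hδ : 0 < δ) (A : ℝ) {B : ℝ} (hB : 0 < B) :
    ∃ L, ∀ l, L ≤ l → A * Real.exp (-(δ * l)) < B := by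
  have h1 : Tendsto (fun l : ℝ => A * Real.exp (-(δ * l))) atTop (nhds (A * 0)) :=
    (Real.tendsto_exp_neg_atTop_nhds_zero.comp (tendsto_id.const_mul_atTop hδ)).const_mul A
  rw [mul_zero] at h1
  exact eventually_atTop.1 (h1.eventually (gt_mem_nhds hB))

lemma IsWeight.m_le_one (hr : IsWeight r m) : m ≤ 1 :=
  (hr.le 1 (by simp)).trans (by
    rw [← hr.sum]
    exact Finset.single_le_sum (fun i _ => hr.nonneg i) (Finset.mem_univ _))

lemma IsWeight.r_one_le (hr : IsWeight r m) : r 1 ≤ 1 := by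
  rw [← hr.sum]
  exact Finset.single_le_sum (fun i _ => hr.nonneg i) (Finset.mem_univ _)

lemma le_covol_of_survives (hc : IsCurve f ψ D c K) (hr : IsWeight r m) {s C x l : ℝ} (hl : 0 ≤ l)
    {η a : ℝ} (hη : η = m / (24 * (d + 2))) (ha : a ≤ 6 * l)
    (h : ∀ z : Fin (d + 2) → ℤ, z ≠ 0 →
      Real.exp (-(η * a)) ≤ ‖(flowMat r f ψ s C x).mulVec fun i => (z i : ℝ)‖)
    (V : Submodule ℚ (Fin (d + 2) → ℚ)) :
    ((d + 2 : ℕ) : ℝ)⁻¹ ^ (d + 2) * Real.exp (-(m / 4 * l)) ≤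
      covol (flowMat r f ψ s C x) (intBasis V) := by
  have hm := hr.pos
  have hη0 : 0 ≤ η := by rw [hη]; positivity
  have h6 : ∀ z : Fin (d + 2) → ℤ, z ≠ 0 →
      Real.exp (-(η * (6 * l))) ≤ ‖(flowMat r f ψ s C x).mulVec fun i => (z i : ℝ)‖ :=
    fun z hz => (Real.exp_le_exp.2 (by nlinarith)).trans (h z hz)
  have h1 := covol_ge_of_forall_norm_ge (by rw [det_flowMat hc hr]; exact one_ne_zero)
    (Real.exp_pos _) h6 (intBasis_spec V)
  refine le_trans ?_ h1
  have hN : (1 : ℝ) ≤ ((d + 2 : ℕ) : ℝ) := by exact_mod_cast Nat.succ_le_succ (Nat.zero_le _)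
  have hle : Real.exp (-(η * (6 * l))) / ((d + 2 : ℕ) : ℝ) ≤ 1 := by
    rw [div_le_one (by positivity)]
    refine le_trans ?_ hN
    rw [Real.exp_le_one_iff]
    have := mul_nonneg hη0 hl
    linarith
  have hk : Module.finrank ℚ V ≤ d + 2 := by
    simpa using Submodule.finrank_le V
  refine le_trans (le_of_eq ?_) (pow_le_pow_of_le_one (by positivity) hle hk)
  rw [div_eq_mul_inv (Real.exp _), mul_pow (Real.exp _), mul_comm, ← Real.exp_nat_mul]
  congr 2
  rw [hη]; push_cast; field_simp
  ring

/-- Local lemma: survival at two earlier parameters forces large covolumes somewhere on the ball. -/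
lemma exists_one_le_covol_local (hc : IsCurve f ψ D c K) (hr : IsWeight r m) {η : ℝ}
    (hη : η = m / (24 * (d + 2))) :
    ∃ L₀, ∀ l, L₀ ≤ l → 0 ≤ l → ∀ s C, 9 * l ≤ s → (1 + r 1) * C = s + l → ∀ a,
      Metric.closedBall a (Real.exp (-(s - 4 * l))) ⊆ D →
      ∀ x ∈ Metric.closedBall a (Real.exp (-(s - 4 * l))),
      (∀ z : Fin (d + 2) → ℤ, z ≠ 0 → Real.exp (-(η * (6 * l))) ≤
        ‖(flowMat r f ψ (s - 4 * l) (C + l / (1 + r 1)) x).mulVec fun i => (z i : ℝ)‖) →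
      (∀ z : Fin (d + 2) → ℤ, z ≠ 0 → Real.exp (-(η * (4 * l))) ≤
        ‖(flowMat r f ψ (s - 4 * l) (C - l / (1 + r 1)) x).mulVec fun i => (z i : ℝ)‖) →
      ∀ V ∈ properSub (d + 2), ∃ y ∈ Metric.closedBall a (Real.exp (-(s - 4 * l))),
        1 ≤ covol (flowMat r f ψ s C y) (intBasis V) := by
  have hc0 := hc.c_pos
  have hK0 := hc.K_pos
  have hm0 := hr.pos
  have hm1 := hr.m_le_one
  have hr1 := hr.nonneg 1
  have hr1' := hr.r_one_le
  set κ : ℝ := ((d + 2 : ℕ) : ℝ)⁻¹ ^ (d + 2) with hκ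
  have hκ0 : 0 < κ := by positivity
  set K' := (2 + 4 * K * (d + 2)) / c with hK'
  have hK'0 : 0 ≤ K' := by positivity
  obtain ⟨L1, hL1⟩ := exists_mul_exp_lt (δ := 5 / 4) (by norm_num) K' hκ0
  obtain ⟨L2, hL2⟩ := exists_mul_exp_lt (δ := 5 / 4) (by norm_num) 1 hκ0
  obtain ⟨L3, hL3⟩ := exists_mul_exp_lt (δ := m / 4) (by positivity) 1 hκ0
  obtain ⟨L4, hL4⟩ := exists_mul_exp_lt (δ := 3 / 2) (by norm_num)
    ((d + 2 : ℕ) * K') (pow_pos hκ0 2)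
  refine ⟨max (max L1 L2) (max L3 L4), ?_⟩
  intro l hl hl0 s C hs hC a hJ x hx hp hm V hV
  simp only [max_le_iff] at hl
  by_contra! hlt
  set k := Module.finrank ℚ V with hk
  have hk0 : 0 < k := by
    rw [Nat.pos_iff_ne_zero, hk, Ne, Submodule.finrank_eq_zero]; exact hV.1
  have hkN : k < d + 2 := by
    have := Submodule.finrank_lt hV.2
    simpa using this
  set B := (intBasis V).map (Int.castRingHom ℝ) with hB
  have h1 : ∀ y ∈ Metric.closedBall a (Real.exp (-(s - 4 * l))), ∀ σ,
      |minor (curveMat (f y) (ψ y) * B) σ| ≤ Real.exp (-∑ i, wt r s C (σ i)) := by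
    intro y hy σ
    have h2 := (abs_minor_le_covol (flowMat r f ψ s C y) (intBasis V) σ).trans (hlt y hy).le
    rw [minor_flowMat_mul, abs_mul, Real.abs_exp] at h2
    rw [Real.exp_neg, ← one_div, le_div_iff₀ (Real.exp_pos _), mul_comm]
    exact h2
  set e := Real.exp (-(s - 4 * l)) with he
  have he0 : 0 < e := Real.exp_pos _
  have hxa : |x - a| ≤ e := by simpa [Real.dist_eq] using hx
  obtain ⟨y, hy, hxy1⟩ : ∃ y ∈ Metric.closedBall a e, e ≤ |y - x| := by
    rcases le_total x a with h | h
    · refine ⟨a + e, by simp [abs_of_pos he0], ?_⟩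
      rw [abs_of_nonneg (by linarith)]; linarith
    · refine ⟨a - e, by simp [abs_of_pos he0], ?_⟩
      rw [abs_of_nonpos (by linarith)]; linarith
  have hxy2 : |y - x| ≤ 2 * e := by
    have hya : |y - a| ≤ e := by simpa [Real.dist_eq] using hy
    have : y - x = (y - a) - (x - a) := by ring
    rw [this]
    exact (abs_sub _ _).trans (by linarith)
  have hΔ0 : 0 ≤ l / (1 + r 1) := by positivity
  have hΔ1 : l / (1 + r 1) ≤ l := div_le_self hl0 (by linarith)
  have hΔ2 : l / 2 ≤ l / (1 + r 1) := by
    apply div_le_div_of_nonneg_left hl0 <;> linarith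
  set t := κ * Real.exp (-(m / 4 * l)) with ht
  have hsplit : ∀ a b : ℝ, Real.exp (-(a * l)) =
      Real.exp (-((a - b) * l)) * Real.exp (-(b * l)) := by
    intro a b; rw [← Real.exp_add]; ring_nf
  have hml : Real.exp (-(1 / 4 * l)) ≤ Real.exp (-(m / 4 * l)) := by
    apply Real.exp_le_exp.2; nlinarith
  refine local_minors_false hr hk0 hkN (curveMat (f x) (ψ x) * B) hΔ0 hΔ1 (K := K') (t := t)
    (fun σ h0 h1' => ?_) (h1 x hx) (by positivity) hK'0 ?_ ?_ ?_ ?_ ?_ ?_ (s := s) (C := C)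
  · obtain ⟨i₀, hi₀⟩ := h0
    exact abs_minor_zero_le hc hr hkN.le B hl0 hs hC (hJ hx) (hJ hy) hxy1 hxy2
      (h1 x hx) (h1 y hy) hi₀ h1'
  · have h2 := hL1 l hl.1.1
    have : K' * Real.exp (-(l * (3 / 2))) = K' * Real.exp (-(5 / 4 * l)) *
        Real.exp (-(1 / 4 * l)) := by
      rw [mul_assoc, ← Real.exp_add]; ring_nf
    rw [this]
    exact (mul_lt_mul_of_pos_right h2 (Real.exp_pos _)).trans_le
      (mul_le_mul_of_nonneg_left hml hκ0.le)
  · have h2 := hL2 l hl.1.2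
    have : Real.exp (-(l * (3 / 2))) = 1 * Real.exp (-(5 / 4 * l)) * Real.exp (-(1 / 4 * l)) := by
      rw [one_mul, ← Real.exp_add]; ring_nf
    rw [this]
    exact (mul_lt_mul_of_pos_right h2 (Real.exp_pos _)).trans_le
      (mul_le_mul_of_nonneg_left hml hκ0.le)
  · have h2 := hL3 l hl.2.1
    have h3 : Real.exp (-(m * (l / (1 + r 1)))) ≤ Real.exp (-(m / 2 * l)) := by
      apply Real.exp_le_exp.2; nlinarith
    have : Real.exp (-(m / 2 * l)) = 1 * Real.exp (-(m / 4 * l)) * Real.exp (-(m / 4 * l)) := by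
      rw [one_mul, ← Real.exp_add]; ring_nf
    rw [this] at h3
    exact h3.trans_lt (mul_lt_mul_of_pos_right h2 (Real.exp_pos _))
  · have h2 := hL4 l hl.2.2
    have h3 : (k : ℝ) * K' * Real.exp (-(2 * l)) ≤ ((d + 2 : ℕ) * K' * Real.exp (-(3 / 2 * l))) *
        Real.exp (-(1 / 2 * l)) := by
      rw [mul_assoc (((d + 2 : ℕ) : ℝ) * K'), ← Real.exp_add]
      have : (k : ℝ) ≤ ((d + 2 : ℕ) : ℝ) := by exact_mod_cast hkN.le
      have h4 : -(3 / 2 * l) + -(1 / 2 * l) = -(2 * l) := by ring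
      rw [h4]
      gcongr
    have h5 : t ^ 2 = κ ^ 2 * (Real.exp (-(m / 4 * l)) * Real.exp (-(m / 4 * l))) := by
      rw [ht]; ring
    rw [h5, ← Real.exp_add]
    have h6 : Real.exp (-(1 / 2 * l)) ≤ Real.exp (-(m / 4 * l) + -(m / 4 * l)) := by
      apply Real.exp_le_exp.2; nlinarith
    calc _ ≤ _ := h3
      _ < κ ^ 2 * Real.exp (-(1 / 2 * l)) := mul_lt_mul_of_pos_right h2 (Real.exp_pos _)
      _ ≤ _ := mul_le_mul_of_nonneg_left h6 (by positivity)
  · have h2 := le_covol_of_survives hc hr hl0 hη le_rfl hp V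
    obtain ⟨α, hα⟩ := exists_minor_eq_covol
      (flowMat r f ψ (s - 4 * l) (C + l / (1 + r 1)) x) (intBasis V)
    rw [hα, minor_flowMat_mul, abs_mul, Real.abs_exp] at h2
    exact ⟨α, h2⟩
  · have h2 := le_covol_of_survives hc hr hl0 hη (by linarith) hm V
    obtain ⟨α, hα⟩ := exists_minor_eq_covol
      (flowMat r f ψ (s - 4 * l) (C - l / (1 + r 1)) x) (intBasis V)
    rw [hα, minor_flowMat_mul, abs_mul, Real.abs_exp] at h2
    exact ⟨α, h2⟩

end

end

section

lemma exists_lt_abs_combo_of_indep {ι X : Type*} [Fintype ι] (b : ι → X → ℝ) (J : Set X)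
    (hnd : ∀ a : ι → ℝ, (∀ x ∈ J, ∑ i, a i * b i x = 0) → a = 0) :
    ∃ δ > 0, ∀ a : ι → ℝ, 1 ≤ ‖a‖ → ∃ x ∈ J, δ ≤ |∑ i, a i * b i x| := by
  by_contra! h
  have h' : ∀ n : ℕ, ∃ a : ι → ℝ, 1 ≤ ‖a‖ ∧ ∀ x ∈ J, |∑ i, a i * b i x| < 1 / ((n : ℝ) + 1) :=
    fun n => h _ (by positivity)
  choose a ha1 ha using h'
  set u : ℕ → ι → ℝ := fun n => ‖a n‖⁻¹ • a n with hu
  have hu1 : ∀ n, u n ∈ Metric.sphere (0 : ι → ℝ) 1 := by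
    intro n
    have : ‖a n‖ ≠ 0 := by linarith [ha1 n]
    simp [hu, norm_smul, this]
  obtain ⟨v, hv, φ, hφ, hlim⟩ := (isCompact_sphere (0 : ι → ℝ) 1).tendsto_subseq hu1
  have hv0 : v = 0 := by
    apply hnd
    intro x hx
    have hc : Tendsto (fun n => ∑ i, u (φ n) i * b i x) atTop (nhds (∑ i, v i * b i x)) :=
      tendsto_finsetSum _ fun i _ => ((tendsto_pi_nhds.1 hlim i).mul_const _)
    refine tendsto_nhds_unique hc (squeeze_zero_norm (fun n => ?_)
      (tendsto_one_div_add_atTop_nhds_zero_nat.comp hφ.tendsto_atTop))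
    have h1 : ∑ i, u (φ n) i * b i x = ‖a (φ n)‖⁻¹ * ∑ i, a (φ n) i * b i x := by
      simp only [hu, Pi.smul_apply, smul_eq_mul, Finset.mul_sum, mul_assoc]
    rw [h1, norm_mul, norm_inv, norm_norm, Real.norm_eq_abs]
    have h2 : ‖a (φ n)‖⁻¹ ≤ 1 := inv_le_one_of_one_le₀ (ha1 _)
    exact (mul_le_of_le_one_left (abs_nonneg _) h2).trans (ha _ x hx).le
  simp [hv0] at hv

variable {d : ℕ}

section
variable {f ψ : ℝ → Fin (d + 2) → ℝ} {D : Set ℝ} {c K m : ℝ} {r : Fin (d + 2) → ℝ}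

/-- Linear independence of `1` and the coordinates of `f` on `J`. -/
def IsNondeg (f : ℝ → Fin (d + 2) → ℝ) (J : Set ℝ) : Prop :=
  ∀ a : Fin (d + 2) → ℝ, (∀ x ∈ J, ∑ i, a i * Function.update (f x) 0 1 i = 0) → a = 0

lemma minor_mul_map_of_one {k : ℕ} (B : Matrix (Fin (d + 2)) (Fin k) ℤ)
    (x : ℝ) (σ : Fin k → Fin (d + 2)) :
    minor ((1 + Matrix.vecMulVec (f x) (Pi.single (0 : Fin (d + 2)) (1 : ℝ))) *
      B.map (Int.castRingHom ℝ)) σ =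
      (minor B σ : ℤ) + ∑ i, f x (σ i) * (minor B (Function.update σ i 0) : ℤ) := by
  rw [minor_one_add_vecMulVec_mul]
  have h : ∀ τ, minor (B.map (Int.castRingHom ℝ)) τ = (minor B τ : ℤ) := fun τ =>
    minor_map (Int.castRingHom ℝ) B τ
  simp only [h]

/-- The minors containing the coordinate `1` but not the coordinate `0` have small coefficients. -/
lemma minor_eq_zero_of_forall_lt {J : Set ℝ} {δ : ℝ}
    (hδ : ∀ a : Fin (d + 2) → ℝ, 1 ≤ ‖a‖ →
      ∃ x ∈ J, δ ≤ |∑ i, a i * Function.update (f x) 0 1 i|) {k : ℕ}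
    (B : Matrix (Fin (d + 2)) (Fin k) ℤ) {σ : Fin k → Fin (d + 2)} (hσ : Function.Injective σ)
    (h0 : ∀ i, σ i ≠ 0)
    (hlt : ∀ x ∈ J, |minor ((1 + Matrix.vecMulVec (f x) (Pi.single (0 : Fin (d + 2)) (1 : ℝ))) *
      B.map (Int.castRingHom ℝ)) σ| < δ) :
    minor B σ = 0 ∧ ∀ i, minor B (Function.update σ i 0) = 0 := by
  classical
  set b : Fin (d + 2) → ℤ := fun j => if j = 0 then minor B σ else
    ∑ i, if σ i = j then minor B (Function.update σ i 0) else 0 with hb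
  have hbσ : ∀ i, b (σ i) = minor B (Function.update σ i 0) := by
    intro i
    simp only [hb, h0 i, if_false, hσ.eq_iff]
    simp
  have hb0 : b 0 = minor B σ := by simp [hb]
  suffices h : b = 0 by
    exact ⟨by rw [← hb0, h]; rfl, fun i => by rw [← hbσ, h]; rfl⟩
  by_contra hne
  obtain ⟨j, hj⟩ : ∃ j, b j ≠ 0 := by
    by_contra! h
    exact hne (funext h)
  obtain ⟨x, hx, hge⟩ := hδ (fun j => (b j : ℝ)) (by
    refine le_trans ?_ (norm_le_pi_norm _ j)
    rw [Real.norm_eq_abs, ← Int.cast_abs]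
    exact_mod_cast Int.one_le_abs hj)
  refine absurd (hlt x hx) (not_lt.2 (hge.trans_eq ?_))
  rw [minor_mul_map_of_one]
  congr 1
  rw [Fin.sum_univ_succ]
  simp only [Function.update_self, hb0, mul_one]
  congr 1
  have : ∀ j : Fin (d + 1), (b j.succ : ℝ) * Function.update (f x) 0 1 j.succ =
      ∑ i, if σ i = j.succ then f x (σ i) * minor B (Function.update σ i 0) else 0 := by
    intro j
    rw [Function.update_of_ne (Fin.succ_ne_zero j)]
    simp only [hb, Fin.succ_ne_zero, if_false]
    push_cast
    rw [Finset.sum_mul]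
    refine Finset.sum_congr rfl fun i _ => ?_
    split_ifs with h
    · rw [h]; ring
    · simp
  rw [Finset.sum_congr rfl fun j _ => this j, Finset.sum_comm]
  refine Finset.sum_congr rfl fun i _ => ?_
  obtain ⟨j, hj⟩ := Fin.exists_succ_eq.2 (h0 i)
  simp [← hj]

lemma exists_one_le_covol_global (hc : IsCurve f ψ D c K) (hr : IsWeight r m) {J : Set ℝ}
    (hne : J.Nonempty) (hnd : IsNondeg f J) :
    ∃ S₀, ∀ s, S₀ ≤ s → 0 ≤ s → ∀ l, 0 ≤ l → l ≤ r 1 * s → ∀ C, (1 + r 1) * C = s + l →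
      ∀ V ∈ properSub (d + 2), ∃ y ∈ J, 1 ≤ covol (flowMat r f ψ s C y) (intBasis V) := by
  obtain ⟨δ, hδ0, hδ⟩ := exists_lt_abs_combo_of_indep
    (fun i x => Function.update (f x) 0 1 i) J hnd
  have hm := hr.pos
  have hr1 := hr.nonneg 1
  have hmr : m ≤ r 1 := hr.le 1 (by simp)
  obtain ⟨S₀, hS₀⟩ := exists_mul_exp_lt (δ := m / 2) (by positivity) 1 hδ0
  refine ⟨S₀, fun s hs hs0 l hl0 hl C hC V hV => ?_⟩
  by_contra! hlt
  set k := Module.finrank ℚ V with hk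
  have hkN : k < d + 2 := by
    have := Submodule.finrank_lt hV.2
    simpa using this
  have hC0 : 0 ≤ C := by
    by_contra! h
    nlinarith
  have hCs : C ≤ s := by
    by_contra! h
    nlinarith
  set B := intBasis V with hB
  have h1 : ∀ y ∈ J, ∀ σ, |minor (curveMat (f y) (ψ y) * B.map (Int.castRingHom ℝ)) σ| <
      Real.exp (-∑ i, wt r s C (σ i)) := by
    intro y hy σ
    have h2 := (abs_minor_le_covol (flowMat r f ψ s C y) B σ).trans_lt (hlt y hy)
    rw [minor_flowMat_mul, abs_mul, Real.abs_exp] at h2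
    rw [Real.exp_neg, ← one_div, lt_div_iff₀ (Real.exp_pos _), mul_comm]
    exact h2
  -- minors with `1` and without `0`
  have hA : ∀ σ : Fin k → Fin (d + 2), Function.Injective σ → (∀ i, σ i ≠ 0) → (∃ i, σ i = 1) →
      minor B σ = 0 ∧ ∀ i, minor B (Function.update σ i 0) = 0 := by
    intro σ hσ h0 ⟨i₀, hi₀⟩
    refine minor_eq_zero_of_forall_lt hδ B hσ h0 fun x hx => ?_
    rw [← minor_curveMat_of_one _ _ (hc.ψ_one x) _ hi₀]
    refine (h1 x hx σ).trans_le (le_trans (Real.exp_le_exp.2 ?_)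
      ((one_mul _).symm.le.trans (hS₀ s hs).le))
    rw [sum_wt, cnt_eq_zero h0, cnt_eq_one hσ hi₀]
    have := mul_nonneg (rsum_nonneg hr σ) hC0
    nlinarith [mul_le_mul_of_nonneg_right hmr hs0, hr.r_one_le]
  have hzero : ∀ σ : Fin k → Fin (d + 2), (∃ i, σ i = 0) → minor B σ = 0 := by
    rintro σ ⟨i₀, hi₀⟩
    by_cases hσ : Function.Injective σ
    swap
    · exact minor_eq_zero_of_not_injective _ hσ
    have hupd : ∀ j, (∀ i, σ i ≠ j) → j ≠ 0 → (∃ i, Function.update σ i₀ j i = 1) →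
        minor B σ = 0 := by
      intro j hj hj0 h1'
      have hinj : Function.Injective (Function.update σ i₀ j) := by
        intro a b hab
        by_cases ha : a = i₀ <;> by_cases hb : b = i₀
        · rw [ha, hb]
        · subst ha
          rw [Function.update_self, Function.update_of_ne hb] at hab
          exact absurd hab.symm (hj b)
        · subst hb
          rw [Function.update_self, Function.update_of_ne ha] at hab
          exact absurd hab (hj a)
        · rw [Function.update_of_ne ha, Function.update_of_ne hb] at hab
          exact hσ hab
      have h2 := (hA (Function.update σ i₀ j) hinj (fun i => ?_) h1').2 i₀
      · rwa [Function.update_idem, ← hi₀, Function.update_eq_self] at h2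
      · by_cases hi : i = i₀
        · rw [hi, Function.update_self]; exact hj0
        · rw [Function.update_of_ne hi]
          exact fun h => hi (hσ (h.trans hi₀.symm))
    by_cases h1' : ∃ i, σ i = 1
    · obtain ⟨i₁, hi₁⟩ := h1'
      obtain ⟨j, hj⟩ : ∃ j, ∀ i, σ i ≠ j := by
        by_contra! h
        have := Fintype.card_le_of_surjective σ h
        simp at this
        omega
      refine hupd j hj (fun h => hj i₀ (hi₀.trans h.symm)) ⟨i₁, ?_⟩
      rw [Function.update_of_ne, hi₁]
      rintro rfl
      rw [hi₀] at hi₁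
      simp at hi₁
    · push Not at h1'
      exact hupd 1 h1' (by simp) ⟨i₀, by simp⟩
  have hone : ∀ σ : Fin k → Fin (d + 2), (∃ i, σ i = 1) → minor B σ = 0 := by
    intro σ h1'
    by_cases hσ : Function.Injective σ
    swap
    · exact minor_eq_zero_of_not_injective _ hσ
    by_cases h0 : ∃ i, σ i = 0
    · exact hzero σ h0
    · push Not at h0
      exact (hA σ hσ h0 h1').1
  obtain ⟨σ, hσ⟩ := (intBasis_spec V).exists_minor
  have h0 : ∀ i, σ i ≠ 0 := fun i hi => hσ (hzero σ ⟨i, hi⟩)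
  have h1' : ∀ i, σ i ≠ 1 := fun i hi => hσ (hone σ ⟨i, hi⟩)
  obtain ⟨x, hx⟩ := hne
  have h2 := h1 x hx σ
  have hG : ∀ τ : Fin k → Fin (d + 2), minor ((1 + Matrix.vecMulVec (f x)
      (Pi.single (0 : Fin (d + 2)) (1 : ℝ))) * B.map (Int.castRingHom ℝ)) τ =
          ((minor B τ : ℤ) : ℝ) := by
    intro τ
    rw [minor_mul_map_of_one, Finset.sum_eq_zero, add_zero]
    intro i _
    rw [hzero _ ⟨i, Function.update_self ..⟩, Int.cast_zero, mul_zero]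
  rw [curveMat, Matrix.mul_assoc, minor_one_add_vecMulVec_mul, Finset.sum_eq_zero, add_zero, hG,
    ← Int.cast_abs] at h2
  · have h3 : Real.exp (-∑ i, wt r s C (σ i)) ≤ 1 := by
      rw [Real.exp_le_one_iff, sum_wt, cnt_eq_zero h0, cnt_eq_zero h1']
      have := mul_nonneg (rsum_nonneg hr σ) hC0
      linarith
    have h4 : |minor B σ| < 1 := by exact_mod_cast h2.trans_le h3
    exact hσ (Int.abs_lt_one_iff.1 h4)
  · intro i _
    rw [hG, hone _ ⟨i, Function.update_self ..⟩, Int.cast_zero, mul_zero]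

end

end

section

variable {d : ℕ} {f ψ : ℝ → Fin (d + 2) → ℝ} {D : Set ℝ} {c₀ K₀ m : ℝ} {r : Fin (d + 2) → ℝ}

lemma continuousOn_of_abs_sub_le {g : ℝ → ℝ} {K : ℝ} (hK : 0 < K)
    (h : ∀ x ∈ D, ∀ y ∈ D, |g y - g x| ≤ K * |y - x|) : ContinuousOn g D := by
  refine (LipschitzOnWith.of_dist_le_mul (K := ⟨K, hK.le⟩) fun x hx y hy => ?_).continuousOn
  rw [Real.dist_eq, Real.dist_eq]
  exact h y hy x hx

lemma continuousOn_curveMat (hc : IsCurve f ψ D c₀ K₀) (i j : Fin (d + 2)) :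
    ContinuousOn (fun x => curveMat (f x) (ψ x) i j) D := by
  have hf : ∀ i, ContinuousOn (fun x => f x i) D := fun i =>
    continuousOn_of_abs_sub_le hc.K_pos fun x hx y hy => hc.f_lip x hx y hy i
  have hψ : ∀ i, ContinuousOn (fun x => ψ x i) D := fun i =>
    continuousOn_of_abs_sub_le hc.K_pos fun x hx y hy => hc.ψ_lip x hx y hy i
  simp only [curveMat_apply]
  exact ((continuousOn_const.add ((hf i).mul continuousOn_const))).sub
    ((hψ i).mul (continuousOn_const.add ((hf 1).mul continuousOn_const)))

lemma analyticAt_curveMat {x₀ : ℝ} (hf : ∀ i, AnalyticAt ℝ (fun x => f x i) x₀)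
    (hψ : ∀ i, AnalyticAt ℝ (fun x => ψ x i) x₀) (i j : Fin (d + 2)) :
    AnalyticAt ℝ (fun x => curveMat (f x) (ψ x) i j) x₀ := by
  simp only [curveMat_apply]
  exact ((analyticAt_const.add ((hf i).mul analyticAt_const))).sub
    ((hψ i).mul (analyticAt_const.add ((hf 1).mul analyticAt_const)))

lemma minor_flowMat_mul_eq_combo {k : ℕ} (s C x : ℝ) (B : Matrix (Fin (d + 2)) (Fin k) ℝ)
    (σ : Fin k → Fin (d + 2)) :
    minor (flowMat r f ψ s C x * B) σ =
      combo (fun (τ : Fin k → Fin (d + 2)) x => ∏ i, curveMat (f x) (ψ x) (σ i) (τ i))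
        (fun τ => Real.exp (∑ i, wt r s C (σ i)) * minor B τ) x := by
  rw [minor_flowMat_mul, minor_mul, combo, Finset.mul_sum]
  exact Finset.sum_congr rfl fun τ _ => by ring

lemma continuousOn_covol (hc : IsCurve f ψ D c₀ K₀) {k : ℕ} (s C : ℝ)
    (B : Matrix (Fin (d + 2)) (Fin k) ℤ) :
    ContinuousOn (fun x => covol (flowMat r f ψ s C x) B) D := by
  unfold covol
  refine ContinuousOn.norm (continuousOn_pi.2 fun σ => ?_)
  simp only [minor_flowMat_mul_eq_combo, combo]
  exact continuousOn_finsetSum _ fun τ _ => continuousOn_const.mul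
    (continuousOn_finsetProd _ fun i _ => continuousOn_curveMat hc _ _)

/-- Quantitative nondivergence for the flow along an analytic curve, on trees. -/
lemma exists_coins_short_le (hc : IsCurve f ψ D c₀ K₀) (hr : IsWeight r m) {x₀ : ℝ}
    (hf : ∀ i, AnalyticAt ℝ (fun x => f x i) x₀) (hψ : ∀ i, AnalyticAt ℝ (fun x => ψ x i) x₀) :
    ∃ N : ℕ, ∃ K : ℝ, 1 ≤ K ∧ ∃ h₀ > 0, ∀ (β ρ : ℝ) (c : ℕ → (ℕ → Bool) → ℝ), IsTree β ρ c →
      0 < β → β < 1 → 0 < ρ → (∀ ω, node β ρ c 0 ω ⊆ Metric.closedBall x₀ h₀) →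
      (∀ ω, node β ρ c 0 ω ⊆ D) → ∀ (j : ℕ) (ε : ℝ), 0 ≤ ε → ε ≤ 1 → K * (β ^ j)⁻¹ ^ N * ε < 1 →
      ∀ s C n ω, (∀ V ∈ properSub (d + 2), ∃ y ∈ node β ρ c n ω,
        1 ≤ covol (flowMat r f ψ s C y) (intBasis V)) →
      coins ({ω' | ∃ z : Fin (d + 2) → ℤ, z ≠ 0 ∧ ((d + 2 : ℕ) : ℝ) *
        ‖(flowMat r f ψ s C (limPt c ω')).mulVec fun i => (z i : ℝ)‖ < ε} ∩ cyl ω n) ≤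
        (4 ^ (d + 2) * (N * 2⁻¹ ^ j)) * coins (cyl ω n) := by
  have key : ∀ p : (k : Fin (d + 3)) × (Fin k → Fin (d + 2)), _ := fun p =>
    exists_good_tree (ι := Fin p.1 → Fin (d + 2))
      (b := fun τ x => ∏ i, curveMat (f x) (ψ x) (p.2 i) (τ i)) (x₀ := x₀)
      (fun τ => Finset.analyticAt_fun_prod _ fun i _ => analyticAt_curveMat hf hψ _ _)
  choose N K hK h₀ hh₀ hgood using key
  have : Nonempty ((k : Fin (d + 3)) × (Fin k → Fin (d + 2))) := ⟨⟨0, fun _ => 0⟩⟩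
  obtain ⟨p₀, hp₀⟩ := Finite.exists_min h₀
  have hK' : ∀ p, K p ≤ ∑ q, K q := fun p =>
    Finset.single_le_sum (fun q _ => zero_le_one.trans (hK q)) (Finset.mem_univ p)
  have hN' : ∀ p, N p ≤ ∑ q, N q := fun p =>
    Finset.single_le_sum (fun q _ => Nat.zero_le _) (Finset.mem_univ p)
  refine ⟨∑ q, N q, ∑ q, K q, (hK p₀).trans (hK' p₀), h₀ p₀, hh₀ p₀, ?_⟩
  intro β ρ c h hβ0 hβ1 hρ hroot hD j ε hε0 hε1 hKε s C n ω hV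
  set cov : Submodule ℚ (Fin (d + 2) → ℚ) → ℝ → ℝ :=
    fun V x => covol (flowMat r f ψ s C x) (intBasis V) with hcov
  have hbase := coins_unmarked_le h hβ0 hβ1 hρ
    (fun V : Submodule ℚ (Fin (d + 2) → ℚ) => Module.finrank ℚ V)
    (fun V W hVW => Submodule.finrank_lt_finrank_of_lt hVW) cov hε1
    ((∑ q, N q : ℕ) * 2⁻¹ ^ j) D hD (fun V => continuousOn_covol hc s C _) ?_
    (d + 2) (properSub (d + 2)) (Finset.range (d + 2)) (by simp) ?_ n ω hV
  · refine le_trans (measure_mono (inter_subset_inter_left _ ?_)) hbase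
    rintro ω' ⟨z, hz, hlt⟩ hm
    refine not_le.2 hlt (le_norm_mulVec_of_marked (g := flowMat r f ψ s C) ?_ hε1 hm hz)
    rw [det_flowMat hc hr, abs_one]
  · rintro V n ω ⟨x, hx, hx1⟩
    obtain ⟨σ, hσ⟩ := exists_minor_eq_covol (flowMat r f ψ s C x) (intBasis V)
    have hfin : Module.finrank ℚ V < d + 3 := by
      have := Submodule.finrank_le V
      rw [Module.finrank_fin_fun] at this
      omega
    set p : (k : Fin (d + 3)) × (Fin k → Fin (d + 2)) := ⟨⟨_, hfin⟩, σ⟩ with hp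
    have h1 := hgood p β ρ c h hβ0 hβ1 hρ
      (fun ω => (hroot ω).trans (Metric.closedBall_subset_closedBall (hp₀ p)))
      (fun τ => Real.exp (∑ i, wt r s C (σ i)) *
        minor ((intBasis V).map (Int.castRingHom ℝ)) τ) j ε hε0 ?_ n ω ⟨x, hx, ?_⟩
    · refine (measure_mono (inter_subset_inter_left _ ?_)).trans (h1.trans ?_)
      · intro ω' (hω' : cov V (limPt c ω') < ε)
        refine lt_of_le_of_lt (a := |_|) ?_ hω'
        have := abs_minor_le_covol (flowMat r f ψ s C (limPt c ω')) (intBasis V) σ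
        rwa [minor_flowMat_mul_eq_combo] at this
      · gcongr
        exact hN' p
    · refine lt_of_le_of_lt ?_ hKε
      have h2 : 1 ≤ (β ^ j)⁻¹ := one_le_inv₀ (by positivity) |>.2 (pow_le_one₀ hβ0.le hβ1.le)
      refine mul_le_mul_of_nonneg_right (mul_le_mul (hK' p) (pow_le_pow_right₀ h2 (hN' p))
        (by positivity) (zero_le_one.trans ((hK p).trans (hK' p)))) hε0
    · rw [← minor_flowMat_mul_eq_combo, ← hσ]
      exact hx1
  · intro V hV
    have := Submodule.finrank_lt hV.2
    simpa using this

end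

section

variable {d : ℕ} {f ψ : ℝ → Fin (d + 2) → ℝ} {D : Set ℝ} {c₀ K m : ℝ} {r : Fin (d + 2) → ℝ}

lemma norm_flowMat_mulVec_le (hc : IsCurve f ψ D c₀ K) (hr : IsWeight r m) {s l C : ℝ}
    (hl0 : 0 ≤ l) (hl : l ≤ r 1 * s) (hC : (1 + r 1) * C = s + l) {x y : ℝ}
    (hx : x ∈ D) (hy : y ∈ D) (hxy : |y - x| ≤ 2 * Real.exp (-s)) (z : Fin (d + 2) → ℝ) :
    ‖(flowMat r f ψ s C y).mulVec z‖ ≤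
      (1 + 6 * K + 8 * K ^ 2) * ‖(flowMat r f ψ s C x).mulVec z‖ := by
  have hK := hc.K_pos
  have hr1 := hr.nonneg 1
  have hr1' := hr.r_one_le
  have hr10 : 0 < r 1 := hr.pos.trans_le (hr.le 1 (by simp))
  have hs0 : 0 ≤ s := by
    by_contra! h
    nlinarith
  have hls : l ≤ s := hl.trans (by nlinarith)
  have hC0 : 0 ≤ C := by
    by_contra! h
    nlinarith
  set R := ‖(flowMat r f ψ s C x).mulVec z‖ with hR
  have hrow : ∀ i, Real.exp (wt r s C i) *
      |z i + f x i * z 0 - ψ x i * (z 1 + f x 1 * z 0)| ≤ R := by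
    intro i
    have h := norm_le_pi_norm ((flowMat r f ψ s C x).mulVec z) i
    rwa [flowMat_mulVec, Real.norm_eq_abs, abs_mul, Real.abs_exp] at h
  have hR0 : 0 ≤ R := norm_nonneg _
  set E := Real.exp (-s) with hE
  have hE0 : 0 < E := Real.exp_pos _
  have h0 := hrow 0
  simp only [hc.f_zero, hc.ψ_zero, zero_mul, add_zero, sub_zero] at h0
  have h1 := hrow 1
  simp only [hc.ψ_one, zero_mul, sub_zero] at h1
  set F := z 1 + f x 1 * z 0 with hF
  set q := z 0 with hq
  have hw1 : ∀ t, 0 ≤ t → Real.exp (wt r s C 1) * (E * t) = Real.exp (wt r s C 0) * t := by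
    intro t _
    rw [← mul_assoc, hE, ← Real.exp_add]
    congr 2
    simp [wt]; ring
  refine (pi_norm_le_iff_of_nonneg (by positivity)).2 fun i => ?_
  rw [flowMat_mulVec, Real.norm_eq_abs, abs_mul, Real.abs_exp]
  by_cases hi0 : i = 0
  · subst hi0
    simp only [hc.f_zero, hc.ψ_zero, zero_mul, add_zero, sub_zero]
    refine h0.trans ?_
    nlinarith [mul_nonneg hK.le hR0, mul_nonneg (sq_nonneg K) hR0]
  have hΔ := fun j => (hc.f_lip x hx y hy j).trans (mul_le_mul_of_nonneg_left hxy hK.le)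
  by_cases hi1 : i = 1
  · subst hi1
    simp only [hc.ψ_one, zero_mul, sub_zero]
    have h2 : z 1 + f y 1 * q = F + (f y 1 - f x 1) * q := by rw [hF]; ring
    rw [h2]
    calc Real.exp (wt r s C 1) * |F + (f y 1 - f x 1) * q|
        ≤ Real.exp (wt r s C 1) * (|F| + K * (2 * E) * |q|) := by
          gcongr
          refine (abs_add_le _ _).trans ?_
          rw [abs_mul]
          gcongr
          exact hΔ 1
      _ = Real.exp (wt r s C 1) * |F| + 2 * K * (Real.exp (wt r s C 1) * (E * |q|)) := by ring
      _ ≤ R + 2 * K * R := by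
          rw [hw1 _ (abs_nonneg _)]
          gcongr
      _ ≤ _ := by nlinarith [mul_nonneg hK.le hR0, mul_nonneg (sq_nonneg K) hR0]
  · have hwi : wt r s C i = r i * C := by simp [wt, hi0, hi1]
    have hriC : r i * C ≤ r 1 * C := mul_le_mul_of_nonneg_right (hr.max i) hC0
    have hwi0 : Real.exp (wt r s C i) * (E ^ 2 * |q|) ≤ Real.exp (wt r s C 0) * |q| := by
      rw [← mul_assoc, hE, ← Real.exp_nat_mul, ← Real.exp_add]
      refine mul_le_mul_of_nonneg_right (Real.exp_le_exp.2 ?_) (abs_nonneg _)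
      rw [hwi]; simp only [wt, if_true]; push_cast
      linarith
    have hwi1 : Real.exp (wt r s C i) * (E * |F|) ≤ Real.exp (wt r s C 1) * |F| := by
      rw [← mul_assoc, hE, ← Real.exp_add]
      refine mul_le_mul_of_nonneg_right (Real.exp_le_exp.2 ?_) (abs_nonneg _)
      rw [hwi]; simp [wt]
      linarith
    have h2 : z i + f y i * q - ψ y i * (z 1 + f y 1 * q) =
        (z i + f x i * q - ψ x i * F) + (f y i - f x i - ψ x i * (f y 1 - f x 1)) * q -
        (ψ y i - ψ x i) * F - (ψ y i - ψ x i) * (f y 1 - f x 1) * q := by rw [hF]; ring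
    have hψ := (hc.ψ_lip x hx y hy i).trans (mul_le_mul_of_nonneg_left hxy hK.le)
    have hT : |f y i - f x i - ψ x i * (f y 1 - f x 1)| ≤ K * (2 * E) ^ 2 :=
      (hc.taylor x hx y hy i hi1).trans (by gcongr)
    rw [h2]
    calc Real.exp (wt r s C i) * |(z i + f x i * q - ψ x i * F) +
          (f y i - f x i - ψ x i * (f y 1 - f x 1)) * q -
          (ψ y i - ψ x i) * F - (ψ y i - ψ x i) * (f y 1 - f x 1) * q|
        ≤ Real.exp (wt r s C i) * (|z i + f x i * q - ψ x i * F| + K * (2 * E) ^ 2 * |q| +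
          K * (2 * E) * |F| + K * (2 * E) * (K * (2 * E)) * |q|) := by
          gcongr
          refine (abs_sub _ _).trans (add_le_add ((abs_sub _ _).trans (add_le_add
            ((abs_add_le _ _).trans (add_le_add le_rfl ?_)) ?_)) ?_)
          · rw [abs_mul]; gcongr
          · rw [abs_mul]; gcongr
          · rw [abs_mul, abs_mul]; gcongr; exact hΔ 1
      _ = Real.exp (wt r s C i) * |z i + f x i * q - ψ x i * F| +
          (4 * K + 4 * K ^ 2) * (Real.exp (wt r s C i) * (E ^ 2 * |q|)) +
          2 * K * (Real.exp (wt r s C i) * (E * |F|)) := by ring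
      _ ≤ R + (4 * K + 4 * K ^ 2) * R + 2 * K * R := by
          gcongr
          · exact hrow i
          · exact hwi0.trans h0
          · exact hwi1.trans h1
      _ ≤ _ := by nlinarith [mul_nonneg hK.le hR0, mul_nonneg (sq_nonneg K) hR0]

set_option maxHeartbeats 2000000 in
lemma abs_sub_lt_of_two_solutions (hc : IsCurve f ψ D c₀ K) (hr : IsWeight r m) {P Kθ η : ℝ}
    (hP0 : 0 ≤ P) (hP : ∀ x ∈ D, ∀ i, |ψ x i| ≤ P) (hη : η ≤ 1 / 2) (hKθ : 0 ≤ Kθ) :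
    ∃ L₀, ∀ L, L₀ ≤ L → ∃ ε > 0, ∀ Θ : ℝ → Fin (d + 2) → ℝ,
      (∀ x ∈ D, ∀ y ∈ D, ∀ i, |Θ y i - Θ x i| ≤ Kθ * |y - x|) → ∀ s C T, 4 * L ≤ s →
      (1 + r 1) * C = s + L → (1 + r 1) * T = s - 3 * L → ∀ x ∈ D, ∀ y ∈ D,
      |y - x| ≤ 2 * Real.exp (-s) →
      (∀ z : Fin (d + 2) → ℤ, z ≠ 0 → Real.exp (-(η * L)) ≤
        ‖(flowMat r f ψ s C x).mulVec fun i => (z i : ℝ)‖) →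
      ∀ z w : Fin (d + 2) → ℤ, Real.exp T ≤ |(z 0 : ℝ)| → |(z 0 : ℝ)| ≤
          Real.exp (T + L / (1 + r 1)) →
      Real.exp T ≤ |(w 0 : ℝ)| → |(w 0 : ℝ)| ≤ Real.exp (T + L / (1 + r 1)) →
      (∀ i, i ≠ 0 → |z i + f x i * z 0 - Θ x i| ≤ ε * |(z 0 : ℝ)| ^ (-(r i))) →
      (∀ i, i ≠ 0 → |w i + f y i * w 0 - Θ y i| ≤ ε * |(w 0 : ℝ)| ^ (-(r i))) →
      |y - x| < Real.exp (-(s + L)) := by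
  have hK := hc.K_pos
  have hc0 := hc.c_pos
  have hr1 := hr.nonneg 1
  have hr1' := hr.r_one_le
  set A := 2 * (1 + P) with hA
  set B := 2 + 4 * K + 2 * (1 + P) * Kθ with hB
  have hA0 : 0 < A := by positivity
  have hB0 : 0 < B := by positivity
  obtain ⟨L1, hL1⟩ := exists_mul_exp_lt (δ := 1 / 2) (by norm_num) B (B := 1 / 2) (by norm_num)
  obtain ⟨L2, hL2⟩ := exists_mul_exp_lt (δ := 1) (by norm_num) 4 (B := c₀ * A) (by positivity)
  obtain ⟨L3, hL3⟩ := exists_mul_exp_lt (δ := 1 / 2) (by norm_num) (2 * Kθ) (B := c₀) hc0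
  refine ⟨max (max L1 L2) (max L3 0), fun L hL => ?_⟩
  simp only [max_le_iff] at hL
  obtain ⟨⟨hl1, hl2⟩, hl3, hL0⟩ := hL
  have hL1 := hL1 L hl1
  have hL2 := hL2 L hl2
  have hL3 := hL3 L hl3
  set ε := Real.exp (-(5 * L)) / (2 * A) with hε
  have hε0 : 0 < ε := by positivity
  refine ⟨ε, hε0, ?_⟩
  intro Θ hΘ s C T hs hC hT x hx y hy hxy hsurv z w hz1 hz2 hw1 hw2 hz hw
  have hs0 : 0 ≤ s := by linarith
  have hT' : L / 2 ≤ T := by nlinarith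
  have hT0 : 0 ≤ T := by linarith
  have hC5 : 5 / 2 * L ≤ C := by nlinarith
  have hC0 : 0 ≤ C := by linarith
  have hCT : C - T ≤ 4 * L := by nlinarith
  set T' := T + L / (1 + r 1) with hTT
  have hT'C : T' ≤ C - 3 / 2 * L := by
    have : (1 + r 1) * T' = s - 2 * L := by
      rw [hTT, mul_add, hT]; field_simp; ring
    nlinarith
  have hpow : ∀ u : Fin (d + 2) → ℤ, Real.exp T ≤ |(u 0 : ℝ)| → ∀ i,
      |(u 0 : ℝ)| ^ (-(r i)) ≤ Real.exp (-(r i * T)) := by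
    intro u hu i
    calc |(u 0 : ℝ)| ^ (-(r i)) ≤ (Real.exp T) ^ (-(r i)) :=
          Real.rpow_le_rpow_of_nonpos (Real.exp_pos _) hu (by linarith [hr.nonneg i])
      _ = _ := by rw [← Real.exp_mul]; ring_nf
  by_cases hzw : z = w
  · subst hzw
    have h1 := hz 1 (by simp)
    have h2 := hw 1 (by simp)
    have hΘ1 := hΘ x hx y hy 1
    have hle := hc.le_f_one x hx y hy
    set q := |(z 0 : ℝ)| with hq
    set t := ε * q ^ (-(r 1)) with ht
    have h3 : q * |f y 1 - f x 1| ≤ 2 * t + Kθ * |y - x| := by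
      rw [hq, ← abs_mul]
      have : (z 0 : ℝ) * (f y 1 - f x 1) = (z 1 + f y 1 * z 0 - Θ y 1) - (z 1 + f x 1 * z 0 - Θ x 1)
        + (Θ y 1 - Θ x 1) := by ring
      rw [this]
      refine (abs_add_le _ _).trans (add_le_add ((abs_sub _ _).trans ?_) hΘ1)
      linarith
    have hqpos : 0 < q := (Real.exp_pos T).trans_le hz1
    have h4 : 2 * Kθ ≤ c₀ * q := by
      have h5 : Real.exp (L / 2) ≤ q := (Real.exp_le_exp.2 hT').trans hz1
      have h6 : 2 * Kθ * Real.exp (-(1 / 2 * L)) * Real.exp (L / 2) = 2 * Kθ := by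
        rw [mul_assoc, ← Real.exp_add]; ring_nf; simp
      rw [← h6]
      exact mul_le_mul hL3.le h5 (Real.exp_pos _).le hc0.le
    have h5 : q * (c₀ * |y - x|) ≤ 2 * t + Kθ * |y - x| :=
      (mul_le_mul_of_nonneg_left hle hqpos.le).trans h3
    have h6 : c₀ * q * |y - x| ≤ 4 * t := by
      nlinarith [mul_le_mul_of_nonneg_right h4 (abs_nonneg (y - x))]
    have h7 : t ≤ ε * Real.exp (-(r 1 * T)) := mul_le_mul_of_nonneg_left (hpow z hz1 1) hε0.le
    have h8 : c₀ * Real.exp T * |y - x| ≤ 4 * (ε * Real.exp (-(r 1 * T))) := by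
      refine le_trans ?_ (h6.trans (by linarith))
      gcongr
    have h9 : c₀ * |y - x| ≤ 4 * ε * Real.exp (-(s - 3 * L)) := by
      have : 4 * (ε * Real.exp (-(r 1 * T))) = (4 * ε * Real.exp (-(s - 3 * L))) * Real.exp T := by
        rw [← hT, mul_assoc, mul_assoc, ← Real.exp_add]; ring_nf
      rw [this] at h8
      refine le_of_mul_le_mul_right ?_ (Real.exp_pos T)
      linarith
    refine lt_of_mul_lt_mul_left (h9.trans_lt ?_) hc0.le
    have h10 : 4 * ε * Real.exp (-(s - 3 * L)) =
        (4 * Real.exp (-(1 * L))) / (2 * A) * Real.exp (-(s + L)) := by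
      have : Real.exp (-(5 * L)) * Real.exp (-(s - 3 * L)) =
        Real.exp (-(1 * L)) * Real.exp (-(s + L)) := by
        rw [← Real.exp_add, ← Real.exp_add]; ring_nf
      rw [hε]
      calc 4 * (Real.exp (-(5 * L)) / (2 * A)) * Real.exp (-(s - 3 * L))
          = 4 * (Real.exp (-(5 * L)) * Real.exp (-(s - 3 * L))) / (2 * A) := by ring
        _ = _ := by rw [this]; ring
    rw [h10]
    refine mul_lt_mul_of_pos_right ?_ (Real.exp_pos _)
    rw [div_lt_iff₀ (by positivity)]
    nlinarith
  exfalso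
  have hne : z - w ≠ 0 := sub_ne_zero.2 hzw
  have hlt : ‖(flowMat r f ψ s C x).mulVec fun i => ((z - w) i : ℝ)‖ < Real.exp (-(η * L)) := by
    set X := A * ε * Real.exp (4 * L) + B * Real.exp (-L) with hX
    have hXlt : X < Real.exp (-(η * L)) := by
      have h1 : A * ε * Real.exp (4 * L) = Real.exp (-L) / 2 := by
        have : Real.exp (-(5 * L)) * Real.exp (4 * L) = Real.exp (-L) := by
          rw [← Real.exp_add]; ring_nf
        rw [hε, ← this]; field_simp
      have h2 : Real.exp (-L) = Real.exp (-(1 / 2 * L)) * Real.exp (-(1 / 2 * L)) := by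
        rw [← Real.exp_add]; ring_nf
      have h3 : Real.exp (-(1 / 2 * L)) ≤ 1 := by
        rw [Real.exp_le_one_iff]; linarith
      have h4 := Real.exp_pos (-(1 / 2 * L))
      have h5 : X < Real.exp (-(1 / 2 * L)) := by
        rw [hX, h1, h2]
        nlinarith
      refine h5.trans_le (Real.exp_le_exp.2 ?_)
      nlinarith
    refine lt_of_le_of_lt ?_ hXlt
    have hX0 : 0 ≤ X := by positivity
    refine (pi_norm_le_iff_of_nonneg hX0).2 fun i => ?_
    rw [flowMat_mulVec, Real.norm_eq_abs, abs_mul, Real.abs_exp]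
    simp only [Pi.sub_apply, Int.cast_sub]
    have hexp : ∀ a b t : ℝ, 0 ≤ t → a + b ≤ -L → Real.exp a * (Real.exp b * t) ≤
        Real.exp (-L) * t := by
      intro a b t ht hab
      rw [← mul_assoc, ← Real.exp_add]
      exact mul_le_mul_of_nonneg_right (Real.exp_le_exp.2 hab) ht
    have hεe : ∀ a b : ℝ, a + b ≤ 4 * L → Real.exp a * (ε * Real.exp b) ≤ ε * Real.exp (4 * L) := by
      intro a b hab
      rw [mul_left_comm, ← Real.exp_add]
      exact mul_le_mul_of_nonneg_left (Real.exp_le_exp.2 hab) hε0.le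
    have hP1 : 0 ≤ (1 + P) * Kθ := by positivity
    have hεpos : 0 ≤ ε * Real.exp (4 * L) := by positivity
    have hEL := Real.exp_pos (-L)
    by_cases hi0 : i = 0
    · subst hi0
      simp only [hc.f_zero, hc.ψ_zero, zero_mul, add_zero, sub_zero]
      have h1 : |(z 0 : ℝ) - w 0| ≤ Real.exp T' * 2 := (abs_sub _ _).trans (by linarith)
      refine (mul_le_mul_of_nonneg_left h1 (Real.exp_pos _).le).trans
        ((hexp _ _ _ (by norm_num) ?_).trans ?_)
      · simp only [wt, if_true]; linarith
      · rw [hX]; nlinarith [mul_nonneg hA0.le hεpos, mul_pos hK hEL, mul_nonneg hP1 hEL.le]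
    have hE : ∀ j, j ≠ 0 → |(z j + f x j * z 0 - Θ x j) - (w j + f y j * w 0 - Θ y j)| ≤
        2 * (ε * Real.exp (-(r j * T))) := by
      intro j hj
      refine (abs_sub _ _).trans ?_
      have h1 := (hz j hj).trans (mul_le_mul_of_nonneg_left (hpow z hz1 j) hε0.le)
      have h2 := (hw j hj).trans (mul_le_mul_of_nonneg_left (hpow w hw1 j) hε0.le)
      linarith
    have hΘ' : ∀ j, |Θ y j - Θ x j| ≤ Real.exp (-s) * (2 * Kθ) := by
      intro j
      refine (hΘ x hx y hy j).trans ?_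
      have := mul_le_mul_of_nonneg_left hxy hKθ
      linarith
    by_cases hi1 : i = 1
    · subst hi1
      simp only [hc.ψ_one, zero_mul, sub_zero]
      have hdec : (z 1 : ℝ) - w 1 + f x 1 * (z 0 - w 0) =
          ((z 1 + f x 1 * z 0 - Θ x 1) - (w 1 + f y 1 * w 0 - Θ y 1)) +
          w 0 * (f y 1 - f x 1) - (Θ y 1 - Θ x 1) := by ring
      have h2 : |(w 0 : ℝ) * (f y 1 - f x 1)| ≤ Real.exp (T' - s) * (2 * K) := by
        rw [abs_mul]
        calc |(w 0 : ℝ)| * |f y 1 - f x 1| ≤ Real.exp T' * (K * (2 * Real.exp (-s))) := by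
              gcongr
              exact (hc.f_lip x hx y hy 1).trans (by gcongr)
          _ = Real.exp T' * Real.exp (-s) * (2 * K) := by ring
          _ = _ := by rw [← Real.exp_add]; ring_nf
      have hw1' : wt r s C 1 = r 1 * C - L / 2 := by
        simp [wt]; linarith
      rw [hdec]
      calc Real.exp (wt r s C 1) * |((z 1 + f x 1 * z 0 - Θ x 1) - (w 1 + f y 1 * w 0 - Θ y 1)) +
          w 0 * (f y 1 - f x 1) - (Θ y 1 - Θ x 1)|
          ≤ Real.exp (wt r s C 1) * (2 * (ε * Real.exp (-(r 1 * T))) + Real.exp (T' - s) * (2 * K) +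
            Real.exp (-s) * (2 * Kθ)) := by
            refine mul_le_mul_of_nonneg_left ?_ (Real.exp_pos _).le
            exact (abs_sub _ _).trans (add_le_add ((abs_add_le _ _).trans
              (add_le_add (hE 1 hi0) h2)) (hΘ' 1))
        _ = 2 * (Real.exp (wt r s C 1) * (ε * Real.exp (-(r 1 * T)))) +
            Real.exp (wt r s C 1) * (Real.exp (T' - s) * (2 * K)) +
            Real.exp (wt r s C 1) * (Real.exp (-s) * (2 * Kθ)) := by ring
        _ ≤ 2 * (ε * Real.exp (4 * L)) + Real.exp (-L) * (2 * K) + Real.exp (-L) * (2 * Kθ) := by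
            refine add_le_add (add_le_add ?_ ?_) ?_
            · refine mul_le_mul_of_nonneg_left (hεe _ _ ?_) (by norm_num)
              rw [hw1']; nlinarith
            · refine hexp _ _ _ (by positivity) ?_
              rw [hw1']; linarith
            · refine hexp _ _ _ (by positivity) ?_
              rw [hw1']; linarith
        _ ≤ X := by
            rw [hX, hA, hB]
            nlinarith [mul_nonneg hP0 hεpos, mul_pos hK hEL, mul_nonneg hP0 (mul_nonneg hKθ hEL.le)]
    · have hwi : wt r s C i = r i * C := by simp [wt, hi0, hi1]
      have hri := hr.max i
      have hriC : r i * C ≤ r 1 * C := mul_le_mul_of_nonneg_right hri hC0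
      have hriT : r i * T ≤ r 1 * T := mul_le_mul_of_nonneg_right hri hT0
      have hψ := hP x hx i
      have hdec : (z i : ℝ) - w i + f x i * (z 0 - w 0) - ψ x i *
          (z 1 - w 1 + f x 1 * (z 0 - w 0)) =
          ((z i + f x i * z 0 - Θ x i) - (w i + f y i * w 0 - Θ y i)) -
          ψ x i * ((z 1 + f x 1 * z 0 - Θ x 1) - (w 1 + f y 1 * w 0 - Θ y 1)) +
          w 0 * (f y i - f x i - ψ x i * (f y 1 - f x 1)) - (Θ y i - Θ x i) +
          ψ x i * (Θ y 1 - Θ x 1) := by ring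
      have h2 : |(w 0 : ℝ) * (f y i - f x i - ψ x i * (f y 1 - f x 1))| ≤
          Real.exp (T' - 2 * s) * (4 * K) := by
        rw [abs_mul]
        calc |(w 0 : ℝ)| * |f y i - f x i - ψ x i * (f y 1 - f x 1)|
            ≤ Real.exp T' * (K * (2 * Real.exp (-s)) ^ 2) := by
              gcongr
              exact (hc.taylor x hx y hy i hi1).trans (by gcongr)
          _ = Real.exp T' * (Real.exp (-s) * Real.exp (-s)) * (4 * K) := by ring
          _ = _ := by rw [← Real.exp_add, ← Real.exp_add]; ring_nf
      have h3 : |ψ x i * ((z 1 + f x 1 * z 0 - Θ x 1) - (w 1 + f y 1 * w 0 - Θ y 1))| ≤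
          P * (2 * (ε * Real.exp (-(r i * T)))) := by
        rw [abs_mul]
        refine mul_le_mul hψ ((hE 1 (by simp)).trans ?_) (abs_nonneg _) hP0
        gcongr
      have h4 : |ψ x i * (Θ y 1 - Θ x 1)| ≤ P * (Real.exp (-s) * (2 * Kθ)) := by
        rw [abs_mul]
        exact mul_le_mul hψ (hΘ' 1) (abs_nonneg _) hP0
      rw [hdec]
      calc Real.exp (wt r s C i) * |((z i + f x i * z 0 - Θ x i) - (w i + f y i * w 0 - Θ y i)) -
          ψ x i * ((z 1 + f x 1 * z 0 - Θ x 1) - (w 1 + f y 1 * w 0 - Θ y 1)) +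
          w 0 * (f y i - f x i - ψ x i * (f y 1 - f x 1)) - (Θ y i - Θ x i) +
          ψ x i * (Θ y 1 - Θ x 1)|
          ≤ Real.exp (wt r s C i) * (2 * (ε * Real.exp (-(r i * T))) +
            P * (2 * (ε * Real.exp (-(r i * T)))) + Real.exp (T' - 2 * s) * (4 * K) +
            Real.exp (-s) * (2 * Kθ) + P * (Real.exp (-s) * (2 * Kθ))) := by
            refine mul_le_mul_of_nonneg_left ?_ (Real.exp_pos _).le
            exact (abs_add_le _ _).trans (add_le_add ((abs_sub _ _).trans (add_le_add
              ((abs_add_le _ _).trans (add_le_add ((abs_sub _ _).trans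
              (add_le_add (hE i hi0) h3)) h2)) (hΘ' i))) h4)
        _ = A * (Real.exp (wt r s C i) * (ε * Real.exp (-(r i * T)))) +
            Real.exp (wt r s C i) * (Real.exp (T' - 2 * s) * (4 * K)) +
            Real.exp (wt r s C i) * (Real.exp (-s) * (2 * (1 + P) * Kθ)) := by rw [hA]; ring
        _ ≤ A * (ε * Real.exp (4 * L)) + Real.exp (-L) * (4 * K) +
            Real.exp (-L) * (2 * (1 + P) * Kθ) := by
            refine add_le_add (add_le_add ?_ ?_) ?_
            · refine mul_le_mul_of_nonneg_left (hεe _ _ ?_) hA0.le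
              rw [hwi]
              have hri1 : r i ≤ 1 := hri.trans hr1'
              have := hr.nonneg i
              nlinarith
            · refine hexp _ _ _ (by positivity) ?_
              rw [hwi]; linarith
            · refine hexp _ _ _ (by positivity) ?_
              rw [hwi]; linarith
        _ ≤ X := by
            rw [hX, hB]
            nlinarith [mul_pos hK hEL]
  exact not_le.2 hlt (hsurv _ hne)

end

section

/-! ### Removing bad branches -/

lemma DepOn.isOpen {n : ℕ} {E : Set (ℕ → Bool)} (hE : DepOn n E) : IsOpen E := by
  rw [hE.eq_iUnion]
  refine isOpen_biUnion fun s _ => ?_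
  rw [cyl_eq_pi]
  exact isOpen_set_pi (Finset.finite_toSet _) fun _ _ => isOpen_discrete _

lemma DepOn.isClosed {n : ℕ} {E : Set (ℕ → Bool)} (hE : DepOn n E) : IsClosed E :=
  isOpen_compl_iff.1 hE.compl.isOpen

/-- The branches that avoid all bad sets of index less than `n`. -/
def survivors (Bd : ℕ → ℕ → Set (ℕ → Bool)) (In : ℕ → Set (ℕ → Bool)) (n : ℕ) :
    Set (ℕ → Bool) :=
  {ω | ∀ n' < n, (∀ M, ω ∉ Bd n' M) ∧ ω ∉ In n'}

section Survivors

variable {Bd : ℕ → ℕ → Set (ℕ → Bool)} {In : ℕ → Set (ℕ → Bool)} {k : ℕ}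

lemma survivors_zero : survivors Bd In 0 = univ := by
  ext; simp [survivors]

lemma survivors_anti {m n : ℕ} (h : m ≤ n) : survivors Bd In n ⊆ survivors Bd In m :=
  fun _ hω n' hn' => hω n' (hn'.trans_le h)

lemma depOn_survivors (hBd : ∀ n M, DepOn (k * n) (Bd n M)) (hIn : ∀ n, DepOn (k * n) (In n))
    (n : ℕ) : DepOn (k * (n - 1)) (survivors Bd In n) := by
  intro ω hω ω' hω' n' hn'
  have h1 : k * n' ≤ k * (n - 1) := Nat.mul_le_mul_left _ (by omega)
  have h2 := cyl_anti ω h1 hω'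
  exact ⟨fun M h => (hω n' hn').1 M (((hBd n' M).mem_iff h2).1 h),
    fun h => (hω n' hn').2 (((hIn n').mem_iff h2).1 h)⟩

lemma exists_survivor (hBd : ∀ n M, DepOn (k * n) (Bd n M)) (hIn : ∀ n, DepOn (k * n) (In n))
    {c : ℕ} (hc : 4 ≤ c) (κ : ℕ → ℝ≥0∞)
    (hκ : ∀ M, 1 ≤ M → κ M * 2 ^ (c * M) ≤ 4⁻¹ * 2⁻¹ ^ M)
    (hzero : ∀ n, Bd n 0 = ∅)
    (hloc : ∀ n M, 1 ≤ M → c * M ≤ n → ∀ ω ∈ survivors Bd In (n - 4 * M + 1),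
      coins (Bd n M ∩ cyl ω (k * (n - 4 * M))) ≤ κ M * coins (cyl ω (k * (n - 4 * M))))
    (hglob : ∀ n M, 1 ≤ M → n < c * M → coins (Bd n M) ≤ κ M)
    (hinh : ∀ n, ∀ ω ∈ survivors Bd In n,
      coins (In n ∩ cyl ω (k * (n - 1))) ≤ 4⁻¹ * coins (cyl ω (k * (n - 1)))) :
    ∃ ω, ∀ n, (∀ M, ω ∉ Bd n M) ∧ ω ∉ In n := by
  have hstep : ∀ n, coins (survivors Bd In n) ≤ 2 * coins (survivors Bd In (n + 1)) := by
    intro n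
    induction n using Nat.strong_induction_on with
    | _ n ih =>
    have hpow : ∀ p ≤ n, coins (survivors Bd In (n - p)) ≤ 2 ^ p * coins (survivors Bd In n) := by
      intro p
      induction p with
      | zero => simp
      | succ p ihp =>
        intro hp
        have h1 := ih (n - (p + 1)) (by omega)
        rw [show n - (p + 1) + 1 = n - p by omega] at h1
        refine h1.trans ?_
        rw [pow_succ', mul_assoc]
        gcongr
        exact ihp (by omega)
    have hB : ∀ M, coins (survivors Bd In n ∩ Bd n M)
        ≤ 4⁻¹ * 2⁻¹ ^ M * (if M = 0 then 0 else coins (survivors Bd In n)) := by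
      intro M
      rcases Nat.eq_zero_or_pos M with rfl | hM
      · simp [hzero]
      rw [if_neg hM.ne']
      have key : ∃ p ≤ n, p ≤ c * M ∧
          coins (survivors Bd In n ∩ Bd n M) ≤ κ M * coins (survivors Bd In (n - p)) := by
        rcases le_or_gt (c * M) n with h | h
        · have h4 : 4 * M ≤ c * M := Nat.mul_le_mul_right _ hc
          refine ⟨4 * M - 1, by omega, by omega, ?_⟩
          have hE := depOn_survivors hBd hIn (n - 4 * M + 1)
          have h5 := coins_inter_le hE (Bd n M) (κ M) (by simpa using hloc n M hM h)
          rw [show n - (4 * M - 1) = n - 4 * M + 1 by omega]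
          refine le_trans (measure_mono ?_) h5
          rw [inter_comm]
          exact inter_subset_inter_right _ (survivors_anti (by omega))
        · refine ⟨n, le_rfl, h.le, ?_⟩
          rw [Nat.sub_self, survivors_zero, measure_univ, mul_one]
          exact (measure_mono inter_subset_right).trans (hglob n M hM h)
      obtain ⟨p, hpn, hpc, h⟩ := key
      calc _ ≤ κ M * coins (survivors Bd In (n - p)) := h
        _ ≤ κ M * (2 ^ (c * M) * coins (survivors Bd In n)) := by
          gcongr
          refine (hpow p hpn).trans ?_
          gcongr
          norm_num
        _ = κ M * 2 ^ (c * M) * coins (survivors Bd In n) := by rw [mul_assoc]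
        _ ≤ _ := mul_le_mul_left (hκ M hM) _
    have hI : coins (survivors Bd In n ∩ In n) ≤ 4⁻¹ * coins (survivors Bd In n) := by
      rw [inter_comm]
      exact coins_inter_le (depOn_survivors hBd hIn n) (In n) 4⁻¹ (hinh n)
    set a := coins (survivors Bd In n) with ha
    have hsum : ∑' M : ℕ, (4⁻¹ * 2⁻¹ ^ M * (if M = 0 then 0 else a) : ℝ≥0∞) ≤ 4⁻¹ * a := by
      rw [tsum_eq_zero_add' ENNReal.summable]
      simp only [if_true, mul_zero, zero_add, Nat.add_eq_zero_iff, one_ne_zero, and_false, if_false]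
      rw [ENNReal.tsum_mul_right, ENNReal.tsum_mul_left]
      have : ∑' M : ℕ, (2⁻¹ : ℝ≥0∞) ^ (M + 1) = 1 := by
        rw [ENNReal.tsum_geometric_add_one, ENNReal.one_sub_inv_two, inv_inv]
        exact ENNReal.inv_mul_cancel (by norm_num) (by norm_num)
      rw [this, mul_one]
    have hcov : survivors Bd In n ⊆ survivors Bd In (n + 1) ∪
        ((⋃ M, survivors Bd In n ∩ Bd n M) ∪ (survivors Bd In n ∩ In n)) := by
      intro ω hω
      by_cases h : (∀ M, ω ∉ Bd n M) ∧ ω ∉ In n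
      · left
        intro n' hn'
        rcases Nat.lt_succ_iff_lt_or_eq.1 hn' with h' | rfl
        · exact hω n' h'
        · exact h
      · right
        by_cases h2 : ω ∈ In n
        · exact Or.inr ⟨hω, h2⟩
        · left
          have h3 : ∃ M, ω ∈ Bd n M := by
            by_contra h3
            push Not at h3
            exact h ⟨h3, h2⟩
          obtain ⟨M, hM⟩ := h3
          exact mem_iUnion.2 ⟨M, hω, hM⟩
    have hle : a ≤ coins (survivors Bd In (n + 1)) + (4⁻¹ * a + 4⁻¹ * a) := by
      refine (measure_mono hcov).trans ((measure_union_le _ _).trans ?_)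
      gcongr
      refine (measure_union_le _ _).trans ?_
      gcongr
      exact (measure_iUnion_le _).trans ((ENNReal.tsum_le_tsum hB).trans hsum)
    have hfa : a ≠ ⊤ := measure_ne_top _ _
    have hfb : coins (survivors Bd In (n + 1)) ≠ ⊤ := measure_ne_top _ _
    clear_value a
    generalize coins (survivors Bd In (n + 1)) = b at hle hfb ⊢
    rw [← ENNReal.ofReal_toReal hfa, ← ENNReal.ofReal_toReal hfb] at hle ⊢
    have h4 : (4⁻¹ : ℝ≥0∞) = ENNReal.ofReal 4⁻¹ := by
      rw [ENNReal.ofReal_inv_of_pos (by norm_num)]; norm_num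
    have ha0 := a.toReal_nonneg
    have hb0 := b.toReal_nonneg
    rw [h4, ← ENNReal.ofReal_mul (by norm_num),
        ← ENNReal.ofReal_add (by positivity) (by positivity),
      ← ENNReal.ofReal_add (by positivity) (by positivity),
      ENNReal.ofReal_le_ofReal_iff (by positivity)] at hle
    rw [show (2 : ℝ≥0∞) = ENNReal.ofReal 2 by norm_num, ← ENNReal.ofReal_mul (by norm_num)]
    exact ENNReal.ofReal_le_ofReal (by linarith)
  have hpos : ∀ n, 0 < coins (survivors Bd In n) := by
    intro n
    induction n with
    | zero => rw [survivors_zero]; simp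
    | succ n ih =>
      by_contra h
      have h0 : coins (survivors Bd In (n + 1)) = 0 := by simpa using h
      have := hstep n
      rw [h0, mul_zero] at this
      exact absurd this (not_le.2 ih)
  have hclosed : ∀ n, IsClosed (survivors Bd In n) := fun n => (depOn_survivors hBd hIn n).isClosed
  obtain ⟨ω, hω⟩ := IsCompact.nonempty_iInter_of_sequence_nonempty_isCompact_isClosed
    (fun n => survivors Bd In n) (fun n => survivors_anti (Nat.le_succ n))
    (fun n => nonempty_of_measure_ne_zero (hpos n).ne') (hclosed 0).isCompact hclosed
  exact ⟨ω, fun n => mem_iInter.1 hω (n + 1) n (Nat.lt_succ_self n)⟩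

end Survivors

end

section

variable {d : ℕ} {f ψ : ℝ → Fin (d + 2) → ℝ} {D : Set ℝ} {c₀ K m : ℝ} {r : Fin (d + 2) → ℝ}

/-- Some lattice at a point of `E` has a nonzero vector shorter than `ε`. -/
def ShortIn (r : Fin (d + 2) → ℝ) (f ψ : ℝ → Fin (d + 2) → ℝ) (s C ε : ℝ) (E : Set ℝ) : Prop :=
  ∃ x ∈ E, ∃ z : Fin (d + 2) → ℤ, z ≠ 0 ∧
    ‖(flowMat r f ψ s C x).mulVec fun i => (z i : ℝ)‖ < ε

/-- Some point of `E` is well approximated by a rational point with denominator in a range. -/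
def ApproxIn (r : Fin (d + 2) → ℝ) (f Θ : ℝ → Fin (d + 2) → ℝ) (ε T L : ℝ) (E : Set ℝ) : Prop :=
  ∃ x ∈ E, ∃ z : Fin (d + 2) → ℤ, Real.exp T ≤ |(z 0 : ℝ)| ∧ |(z 0 : ℝ)| ≤ Real.exp (T + L) ∧
    ∀ i, i ≠ 0 → |z i + f x i * z 0 - Θ x i| ≤ ε * |(z 0 : ℝ)| ^ (-(r i))

/-- The branches whose node of level `k * n` sees a lattice vector that is too short. -/
def shortBranches (r : Fin (d + 2) → ℝ) (f ψ : ℝ → Fin (d + 2) → ℝ) (η β ρ s₀ L : ℝ)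
    (c : ℕ → (ℕ → Bool) → ℝ) (k n M : ℕ) : Set (ℕ → Bool) :=
  {ω | M ≠ 0 ∧ M * L ≤ r 1 * (s₀ + n * L) ∧
    ShortIn r f ψ (s₀ + n * L) ((s₀ + n * L + M * L) / (1 + r 1)) (Real.exp (-(η * (M * L))))
      (node β ρ c (k * n) ω)}

/-- The branches whose node of level `k * n` meets a well approximable point. -/
def approxBranches (r : Fin (d + 2) → ℝ) (f Θ : ℝ → Fin (d + 2) → ℝ) (ε β ρ s₀ L : ℝ)
    (c : ℕ → (ℕ → Bool) → ℝ) (k n₁ n : ℕ) : Set (ℕ → Bool) :=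
  {ω | n₁ ≤ n ∧ ApproxIn r f Θ ε ((s₀ + n * L - 4 * L) / (1 + r 1)) (L / (1 + r 1))
    (node β ρ c (k * n) ω)}

section Branches

variable {Θ : ℝ → Fin (d + 2) → ℝ} {η ε β ρ s₀ L : ℝ} {c : ℕ → (ℕ → Bool) → ℝ} {k n₁ : ℕ}

lemma depOn_shortBranches (h : IsTree β ρ c) (n M : ℕ) :
    DepOn (k * n) (shortBranches r f ψ η β ρ s₀ L c k n M) := by
  intro ω hω ω' hω'
  refine ⟨hω.1, hω.2.1, ?_⟩
  rw [h.node_congr hω']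
  exact hω.2.2

lemma depOn_approxBranches (h : IsTree β ρ c) (n : ℕ) :
    DepOn (k * n) (approxBranches r f Θ ε β ρ s₀ L c k n₁ n) := by
  intro ω hω ω' hω'
  refine ⟨hω.1, ?_⟩
  rw [h.node_congr hω']
  exact hω.2

lemma shortBranches_zero (n : ℕ) : shortBranches r f ψ η β ρ s₀ L c k n 0 = ∅ := by
  ext; simp [shortBranches]

/-- A branch in `shortBranches` has a short vector at its limit point. -/
lemma shortBranches_subset (hc : IsCurve f ψ D c₀ K) (hr : IsWeight r m) (h : IsTree β ρ c)
    (hβ0 : 0 < β) (hβ1 : β < 1) (hρ : 0 < ρ) (hD : ∀ ω, node β ρ c 0 ω ⊆ D) (hL : 0 ≤ L) {n M : ℕ}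
    (hrad : β ^ (k * n) * ρ = Real.exp (-(s₀ + n * L))) :
    shortBranches r f ψ η β ρ s₀ L c k n M ⊆ {ω' | ∃ z : Fin (d + 2) → ℤ, z ≠ 0 ∧
      ((d + 2 : ℕ) : ℝ) * ‖(flowMat r f ψ (s₀ + n * L) ((s₀ + n * L + M * L) / (1 + r 1))
        (limPt c ω')).mulVec fun i => (z i : ℝ)‖ <
        ((d + 2 : ℕ) : ℝ) * ((1 + 6 * K + 8 * K ^ 2) * Real.exp (-(η * (M * L))))} := by
  rintro ω ⟨-, hM, x, hx, z, hz, hzx⟩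
  refine ⟨z, hz, ?_⟩
  have hr1 := hr.nonneg 1
  have hK := hc.K_pos
  have hlim := h.limPt_mem hβ0 hβ1 hρ (k * n) ω
  have hxD := hD ω (h.node_anti (Nat.zero_le _) ω hx)
  have hyD := hD ω (h.node_anti (Nat.zero_le _) ω hlim)
  have hxy : |limPt c ω - x| ≤ 2 * Real.exp (-(s₀ + n * L)) := by
    rw [← hrad]
    have h1 := Metric.mem_closedBall.1 hlim
    have h2 := Metric.mem_closedBall'.1 hx
    have := dist_triangle (limPt c ω) (c (k * n) ω) x
    rw [← Real.dist_eq]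
    linarith
  have := norm_flowMat_mulVec_le hc hr (s := s₀ + n * L) (l := M * L)
    (C := (s₀ + n * L + M * L) / (1 + r 1)) (by positivity) hM (by field_simp) hxD hyD hxy
    (fun i => (z i : ℝ))
  have hQ : 0 < 1 + 6 * K + 8 * K ^ 2 := by positivity
  refine mul_lt_mul_of_pos_left (this.trans_lt ?_) (by positivity)
  exact mul_lt_mul_of_pos_left hzx hQ

lemma not_shortIn {s C ε : ℝ} {E : Set ℝ} (h : ¬ ShortIn r f ψ s C ε E) {x : ℝ} (hx : x ∈ E)
    (z : Fin (d + 2) → ℤ) (hz : z ≠ 0) :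
    ε ≤ ‖(flowMat r f ψ s C x).mulVec fun i => (z i : ℝ)‖ := by
  by_contra hlt
  exact h ⟨x, hx, z, hz, not_le.1 hlt⟩

/-- Only one child can meet the well approximable points. -/
lemma coins_approxBranches_le (hr : IsWeight r m) (h : IsTree β ρ c)
    (hβ0 : 0 < β) (hβ1 : β < 1) (hρ : 0 < ρ) (hD : ∀ ω, node β ρ c 0 ω ⊆ D) (hL : 0 < L)
    (hs₀ : 0 ≤ s₀) (hrad : ∀ n : ℕ, β ^ (k * n) * ρ = Real.exp (-(s₀ + n * L))) (hk : 2 ≤ k)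
    (hn₁ : 5 ≤ n₁) (hn₁' : 1 ≤ r 1 * ((n₁ : ℝ) - 1))
    (htwo : ∀ s C T, 4 * L ≤ s → (1 + r 1) * C = s + L → (1 + r 1) * T = s - 3 * L →
      ∀ x ∈ D, ∀ y ∈ D, |y - x| ≤ 2 * Real.exp (-s) →
      (∀ z : Fin (d + 2) → ℤ, z ≠ 0 → Real.exp (-(η * L)) ≤
        ‖(flowMat r f ψ s C x).mulVec fun i => (z i : ℝ)‖) →
      ∀ z w : Fin (d + 2) → ℤ, Real.exp T ≤ |(z 0 : ℝ)| → |(z 0 : ℝ)| ≤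
          Real.exp (T + L / (1 + r 1)) →
      Real.exp T ≤ |(w 0 : ℝ)| → |(w 0 : ℝ)| ≤ Real.exp (T + L / (1 + r 1)) →
      (∀ i, i ≠ 0 → |z i + f x i * z 0 - Θ x i| ≤ ε * |(z 0 : ℝ)| ^ (-(r i))) →
      (∀ i, i ≠ 0 → |w i + f y i * w 0 - Θ y i| ≤ ε * |(w 0 : ℝ)| ^ (-(r i))) →
      |y - x| < Real.exp (-(s + L)))
    (n : ℕ) (ω : ℕ → Bool)
    (hω : ∀ n' < n, ω ∉ shortBranches r f ψ η β ρ s₀ L c k n' 1) :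
    coins (approxBranches r f Θ ε β ρ s₀ L c k n₁ n ∩ cyl ω (k * (n - 1))) ≤
      4⁻¹ * coins (cyl ω (k * (n - 1))) := by
  have hr1 := hr.nonneg 1
  rcases Set.eq_empty_or_nonempty
    (approxBranches r f Θ ε β ρ s₀ L c k n₁ n ∩ cyl ω (k * (n - 1))) with h0 | ⟨ω', hω', hcyl'⟩
  · rw [h0]; simp
  obtain ⟨hn, x, hx, z, hz1, hz2, hz⟩ := hω'
  obtain ⟨p, rfl⟩ : ∃ p, n = p + 1 := ⟨n - 1, by omega⟩
  rw [Nat.add_sub_cancel] at hcyl' ⊢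
  set s := s₀ + p * L with hs
  have hsn : s₀ + ((p + 1 : ℕ) : ℝ) * L = s + L := by push_cast; ring
  have hp4 : (4 : ℝ) ≤ p := by exact_mod_cast (show 4 ≤ p by omega)
  have hpr : 1 ≤ r 1 * (p : ℝ) := by
    refine hn₁'.trans (mul_le_mul_of_nonneg_left ?_ hr1)
    have : ((n₁ : ℕ) : ℝ) ≤ ((p + 1 : ℕ) : ℝ) := by exact_mod_cast hn
    push_cast at this; linarith
  have hsub : ∀ {ω₁ y}, ω₁ ∈ cyl ω (k * p) → y ∈ node β ρ c (k * (p + 1)) ω₁ →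
      y ∈ node β ρ c (k * p) ω := by
    intro ω₁ y h1 hy
    rw [← h.node_congr h1]
    exact h.node_anti (Nat.mul_le_mul_left _ (Nat.le_succ p)) ω₁ hy
  have hDn : ∀ {y}, y ∈ node β ρ c (k * p) ω → y ∈ D := fun hy =>
    hD ω (h.node_anti (Nat.zero_le _) ω hy)
  have hns : ¬ ShortIn r f ψ s ((s + L) / (1 + r 1)) (Real.exp (-(η * L)))
      (node β ρ c (k * p) ω) := by
    intro hsh
    refine hω p (Nat.lt_succ_self p) ⟨one_ne_zero, ?_, ?_⟩
    · push_cast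
      nlinarith [mul_nonneg hr1 hs₀]
    · simpa [hs] using hsh
  have hsubset : approxBranches r f Θ ε β ρ s₀ L c k n₁ (p + 1) ∩ cyl ω (k * p) ⊆
      cyl ω' (k * (p + 1)) := by
    rintro ω'' ⟨⟨-, y, hy, w, hw1, hw2, hw⟩, hcyl''⟩
    by_contra hnot
    have hsep := h.sep_of_notMem hβ0 hβ1 hρ hnot hx hy
    rw [hrad, hsn, abs_sub_comm] at hsep
    have hx' := hsub hcyl' hx
    have hy' := hsub hcyl'' hy
    have hxy : |y - x| ≤ 2 * Real.exp (-s) := by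
      have e := hrad p
      have h1 := Metric.mem_closedBall.1 hy'
      have h2 := Metric.mem_closedBall'.1 hx'
      have := dist_triangle y (c (k * p) ω) x
      rw [← Real.dist_eq, ← e]
      linarith
    rw [hsn] at hz1 hz2 hw1 hw2
    have := htwo s ((s + L) / (1 + r 1)) ((s + L - 4 * L) / (1 + r 1))
      (by rw [hs]; nlinarith) (by field_simp) (by field_simp; ring) x (hDn hx') y (hDn hy') hxy
      (not_shortIn hns hx') z w hz1 hz2 hw1 hw2 hz hw
    linarith
  refine (measure_mono hsubset).trans ?_
  rw [coins_cyl, coins_cyl, Nat.mul_succ, pow_add, mul_comm]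
  gcongr
  calc (2⁻¹ : ℝ≥0∞) ^ k ≤ 2⁻¹ ^ 2 := pow_le_pow_right_of_le_one' (by simp) hk
    _ = 4⁻¹ := by rw [← ENNReal.inv_pow]; norm_num

end Branches

end

section

variable {d : ℕ} {f ψ : ℝ → Fin (d + 2) → ℝ} {D : Set ℝ} {c₀ K m : ℝ} {r : Fin (d + 2) → ℝ}

lemma exists_exponent (N d cc : ℕ) : ∃ j₀ : ℕ, ∀ M : ℕ, 1 ≤ M →
    (4 ^ (d + 2) * (N * 2⁻¹ ^ (j₀ * M)) : ℝ≥0∞) * 2 ^ (cc * M) ≤ 4⁻¹ * 2⁻¹ ^ M := by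
  obtain ⟨B, hB⟩ := pow_unbounded_of_one_lt (4 ^ (d + 3) * N : ℝ) one_lt_two
  refine ⟨cc + 1 + B, fun M hM => ?_⟩
  have e : ∀ n : ℕ, (2⁻¹ : ℝ≥0∞) ^ n = ENNReal.ofReal (2⁻¹ ^ n) := by
    intro n
    rw [ENNReal.ofReal_pow (by norm_num), ENNReal.ofReal_inv_of_pos (by norm_num)]
    norm_num
  have e2 : ∀ n : ℕ, (2 : ℝ≥0∞) ^ n = ENNReal.ofReal (2 ^ n) := by
    intro n; rw [ENNReal.ofReal_pow (by norm_num)]; norm_num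
  have e3 : ∀ n : ℕ, (4 : ℝ≥0∞) ^ n = ENNReal.ofReal (4 ^ n) := by
    intro n; rw [ENNReal.ofReal_pow (by norm_num)]; norm_num
  have e4 : (4⁻¹ : ℝ≥0∞) = ENNReal.ofReal 4⁻¹ := by
    rw [ENNReal.ofReal_inv_of_pos (by norm_num)]; norm_num
  have e5 : (N : ℝ≥0∞) = ENNReal.ofReal N := by simp
  rw [e, e, e2, e3, e4, e5, ← ENNReal.ofReal_mul (by positivity),
      ← ENNReal.ofReal_mul (by positivity),
    ← ENNReal.ofReal_mul (by positivity), ← ENNReal.ofReal_mul (by positivity)]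
  apply ENNReal.ofReal_le_ofReal
  have h1 : (2⁻¹ : ℝ) ^ ((cc + 1 + B) * M) = (2 ^ (cc * M))⁻¹ * 2⁻¹ ^ M * 2⁻¹ ^ (B * M) := by
    rw [← inv_pow, ← pow_add, ← pow_add]; ring_nf
  have h2 : (2⁻¹ : ℝ) ^ (B * M) ≤ 2⁻¹ ^ B :=
    pow_le_pow_of_le_one (by norm_num) (by norm_num) (Nat.le_mul_of_pos_right _ hM)
  have h3 : (4 : ℝ) ^ (d + 2) * N * 2⁻¹ ^ B ≤ 4⁻¹ := by
    rw [inv_pow, ← div_eq_mul_inv, div_le_iff₀ (by positivity)]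
    have : (4 : ℝ) ^ (d + 3) * N = 4 * (4 ^ (d + 2) * N) := by ring
    rw [this] at hB
    linarith
  rw [h1]
  calc (4 : ℝ) ^ (d + 2) * (N * ((2 ^ (cc * M))⁻¹ * 2⁻¹ ^ M * 2⁻¹ ^ (B * M))) * 2 ^ (cc * M)
      = (4 ^ (d + 2) * N * 2⁻¹ ^ (B * M)) * 2⁻¹ ^ M := by field_simp
    _ ≤ (4 ^ (d + 2) * N * 2⁻¹ ^ B) * 2⁻¹ ^ M := by gcongr
    _ ≤ _ := by gcongr

/-- The points that are badly approximable with constant `1 / (e + 1)`. -/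
def badSet (r : Fin (d + 2) → ℝ) (f Θ : ℝ → Fin (d + 2) → ℝ) (e : ℕ) : Set ℝ :=
  {x | ∀ z : Fin (d + 2) → ℤ, (e : ℝ) + 1 ≤ |(z 0 : ℝ)| → ∃ i, i ≠ 0 ∧
    1 / ((e : ℝ) + 1) * |(z 0 : ℝ)| ^ (-(r i)) ≤ |z i + f x i * z 0 - Θ x i|}

lemma exists_mem_badSet_of_not_approxIn (hr : IsWeight r m) {Θ : ℝ → Fin (d + 2) → ℝ}
    {ε s₀ L : ℝ} (hε : 0 < ε) (hL : 0 < L) (n₁ : ℕ) :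
    ∃ e : ℕ, ∀ x, (∀ n, n₁ ≤ n →
      ¬ ApproxIn r f Θ ε ((s₀ + n * L - 4 * L) / (1 + r 1)) (L / (1 + r 1)) {x}) →
      x ∈ badSet r f Θ e := by
  have hr1 := hr.nonneg 1
  set T₁ := (s₀ + n₁ * L - 4 * L) / (1 + r 1) with hT₁
  obtain ⟨e, he⟩ := exists_nat_gt (Real.exp T₁ + ε⁻¹)
  refine ⟨e, fun x hx z hz => ?_⟩
  have hz0 : 0 < |(z 0 : ℝ)| := lt_of_lt_of_le (by positivity) hz
  have hT : T₁ ≤ Real.log |(z 0 : ℝ)| := by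
    rw [Real.le_log_iff_exp_le hz0]
    have : 0 < ε⁻¹ := by positivity
    linarith
  set Λ := L / (1 + r 1) with hΛ
  have hΛ0 : 0 < Λ := by positivity
  set p := ⌊(Real.log |(z 0 : ℝ)| - T₁) / Λ⌋₊ with hp
  have h1 : (p : ℝ) ≤ (Real.log |(z 0 : ℝ)| - T₁) / Λ :=
    Nat.floor_le (div_nonneg (by linarith) hΛ0.le)
  have h2 : (Real.log |(z 0 : ℝ)| - T₁) / Λ < p + 1 := Nat.lt_floor_add_one _
  rw [le_div_iff₀ hΛ0] at h1
  rw [div_lt_iff₀ hΛ0] at h2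
  have hTn : (s₀ + ((n₁ + p : ℕ) : ℝ) * L - 4 * L) / (1 + r 1) = T₁ + p * Λ := by
    rw [hT₁, hΛ]; push_cast; field_simp; ring
  by_contra hcon
  push Not at hcon
  refine hx (n₁ + p) (Nat.le_add_right _ _) ⟨x, rfl, z, ?_, ?_, fun i hi => ?_⟩
  · rw [hTn, ← Real.le_log_iff_exp_le hz0]; linarith
  · rw [hTn, ← Real.log_le_iff_le_exp hz0]; linarith
  · refine (hcon i hi).le.trans ?_
    gcongr
    rw [one_div]
    have h3 : ε⁻¹ ≤ e + 1 := by linarith [Real.exp_pos T₁]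
    exact inv_le_of_inv_le₀ hε h3

end

section

variable {d : ℕ} {f ψ : ℝ → Fin (d + 2) → ℝ} {D : Set ℝ} {c₀ K m : ℝ} {r : Fin (d + 2) → ℝ}

set_option maxHeartbeats 2000000 in
/-- Every binary tree of balls in a small interval has a branch with badly approximable limit. -/
theorem exists_branch_mem_badSet (hc : IsCurve f ψ D c₀ K) (hr : IsWeight r m) {x₀ : ℝ}
    (hf : ∀ i, AnalyticAt ℝ (fun x => f x i) x₀) (hψ : ∀ i, AnalyticAt ℝ (fun x => ψ x i) x₀)
    {P Kθ : ℝ} (hP0 : 0 ≤ P) (hP : ∀ x ∈ D, ∀ i, |ψ x i| ≤ P) (hKθ : 0 ≤ Kθ)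
    (hnd : ∀ a ρ, 0 < ρ → Metric.closedBall a ρ ⊆ D → IsNondeg f (Metric.closedBall a ρ))
    {Θ : ℝ → Fin (d + 2) → ℝ} (hΘ : ∀ x ∈ D, ∀ y ∈ D, ∀ i, |Θ y i - Θ x i| ≤ Kθ * |y - x|) :
    ∃ h₀ > 0, ∀ β, 0 < β → β < 1 → ∀ a ρ, 0 < ρ → ρ ≤ 1 →
      Metric.closedBall a ρ ⊆ Metric.closedBall x₀ h₀ → Metric.closedBall a ρ ⊆ D →
      ∃ e : ℕ, ∀ c, IsTree β ρ c → (∀ ω, c 0 ω = a) → ∃ ω, limPt c ω ∈ badSet r f Θ e := by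
  obtain ⟨N, K', hK', h₀, hh₀, hshort⟩ := exists_coins_short_le hc hr hf hψ
  refine ⟨h₀, hh₀, fun β hβ0 hβ1 a ρ hρ hρ1 hah haD => ?_⟩
  have hK := hc.K_pos
  have hm0 := hr.pos
  have hm1 := hr.m_le_one
  have hr1 := hr.nonneg 1
  have hr1pos : 0 < r 1 := hm0.trans_le (hr.le 1 (by simp))
  set η := m / (24 * ((d : ℝ) + 2)) with hη
  have hη0 : 0 < η := by positivity
  have hη2 : η ≤ 1 / 2 := by
    rw [hη, div_le_iff₀ (by positivity)]
    have : (0 : ℝ) ≤ d := Nat.cast_nonneg d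
    linarith
  obtain ⟨Lloc, hLloc⟩ := exists_one_le_covol_local hc hr hη
  obtain ⟨S₀, hS₀⟩ := exists_one_le_covol_global hc hr (J := Metric.closedBall a ρ)
    ⟨a, Metric.mem_closedBall_self hρ.le⟩ (hnd a ρ hρ haD)
  obtain ⟨L₂, hL₂⟩ := abs_sub_lt_of_two_solutions hc hr hP0 hP hη2 hKθ
  obtain ⟨cc, hcc⟩ := exists_nat_ge (9 + 6 / r 1)
  have hcc9 : 9 ≤ cc := by
    have : (9 : ℝ) ≤ cc := le_trans (by simp; positivity) hcc
    exact_mod_cast this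
  have hccr : 6 ≤ r 1 * ((cc : ℝ) - 4) := by
    have h1 : 6 / r 1 ≤ (cc : ℝ) - 4 := by linarith
    rw [div_le_iff₀ hr1pos] at h1
    linarith
  obtain ⟨j₀, hj₀⟩ := exists_exponent N d cc
  set b := Real.log β⁻¹ with hb
  have hb0 : 0 < b := Real.log_pos ((one_lt_inv₀ hβ0).2 hβ1)
  have hβb : β = Real.exp (-b) := by
    rw [hb, Real.log_inv, neg_neg, Real.exp_log hβ0]
  set Q := ((d + 2 : ℕ) : ℝ) * (1 + 6 * K + 8 * K ^ 2) with hQ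
  have hQ0 : 0 < Q := by positivity
  obtain ⟨t, ht⟩ := exists_mul_exp_lt hb0 (K' * Q) one_pos
  set s₀ := -Real.log ρ with hs₀
  have hs₀0 : 0 ≤ s₀ := by rw [hs₀]; simpa using Real.log_nonpos hρ.le hρ1
  have hρs : ρ = Real.exp (-s₀) := by rw [hs₀, neg_neg, Real.exp_log hρ]
  -- the number of levels per step
  obtain ⟨k, hk2, hkη, hkL⟩ : ∃ k : ℕ, 2 ≤ k ∧ j₀ * N + max t 0 ≤ η * k ∧
      max (max Lloc S₀) (max L₂ (s₀ + 1)) ≤ k * b := by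
    obtain ⟨k₁, h₁⟩ := exists_nat_ge ((j₀ * N + max t 0) / η)
    obtain ⟨k₂, h₂⟩ := exists_nat_ge (max (max Lloc S₀) (max L₂ (s₀ + 1)) / b)
    rw [div_le_iff₀ hη0] at h₁
    rw [div_le_iff₀ hb0] at h₂
    refine ⟨2 + k₁ + k₂, by omega, h₁.trans ?_, h₂.trans ?_⟩
    · push_cast
      nlinarith [Nat.cast_nonneg (α := ℝ) k₂]
    · push_cast
      nlinarith [Nat.cast_nonneg (α := ℝ) k₁]
  set L := k * b with hLdef
  have hLs : s₀ + 1 ≤ L := (le_max_right _ _).trans ((le_max_right _ _).trans hkL)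
  have hLL2 : L₂ ≤ L := (le_max_left _ _).trans ((le_max_right _ _).trans hkL)
  have hLS : S₀ ≤ L := (le_max_right _ _).trans ((le_max_left _ _).trans hkL)
  have hLLl : Lloc ≤ L := (le_max_left _ _).trans ((le_max_left _ _).trans hkL)
  have hL0 : 0 < L := by linarith
  obtain ⟨ε, hε, htwo⟩ := hL₂ L hLL2
  obtain ⟨n₁', hn₁'⟩ := exists_nat_ge (1 / r 1)
  set n₁ := n₁' + 5 with hn₁
  have hn₁r : 1 ≤ r 1 * ((n₁ : ℝ) - 1) := by
    rw [div_le_iff₀ hr1pos] at hn₁'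
    rw [hn₁]; push_cast
    nlinarith
  obtain ⟨e, he⟩ := exists_mem_badSet_of_not_approxIn (f := f) (Θ := Θ) (s₀ := s₀) hr hε hL0 n₁
  refine ⟨e, fun c hT hc0 => ?_⟩
  have hnode0 : ∀ ω, node β ρ c 0 ω = Metric.closedBall a ρ := fun ω => by
    simp [node, hc0]
  have hD : ∀ ω, node β ρ c 0 ω ⊆ D := fun ω => by rw [hnode0]; exact haD
  have hrad : ∀ n : ℕ, β ^ (k * n) * ρ = Real.exp (-(s₀ + n * L)) := by
    intro n
    rw [hβb, hρs, ← Real.exp_nat_mul, ← Real.exp_add, hLdef]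
    congr 1; push_cast; ring
  have hcoins := hshort β ρ c hT hβ0 hβ1 hρ (fun ω => by rw [hnode0]; exact hah) hD
  -- the common part of the two estimates
  have hest : ∀ n M n' : ℕ, 1 ≤ M → ∀ ω, (∀ V ∈ properSub (d + 2), ∃ y ∈ node β ρ c n' ω,
        1 ≤ covol (flowMat r f ψ (s₀ + n * L) ((s₀ + n * L + M * L) / (1 + r 1)) y)
          (intBasis V)) →
      coins (shortBranches r f ψ η β ρ s₀ L c k n M ∩ cyl ω n') ≤
        (4 ^ (d + 2) * (N * 2⁻¹ ^ (j₀ * M))) * coins (cyl ω n') := by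
    intro n M n' hM ω hV
    have hM1 : (1 : ℝ) ≤ M := by exact_mod_cast hM
    set ε' := ((d + 2 : ℕ) : ℝ) * ((1 + 6 * K + 8 * K ^ 2) * Real.exp (-(η * (M * L)))) with hε'
    have hε'0 : 0 ≤ ε' := by positivity
    have hpow : (β ^ (j₀ * M))⁻¹ ^ N = Real.exp (b * (j₀ * M * N)) := by
      rw [hβb, ← Real.exp_nat_mul, ← Real.exp_neg, ← Real.exp_nat_mul]
      congr 1; push_cast; ring
    have hlt : K' * (β ^ (j₀ * M))⁻¹ ^ N * ε' < 1 := by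
      refine lt_of_le_of_lt ?_ (ht (max t 0) (le_max_left _ _))
      rw [hpow, hε']
      have : K' * Real.exp (b * (j₀ * M * N)) *
          (((d + 2 : ℕ) : ℝ) * ((1 + 6 * K + 8 * K ^ 2) * Real.exp (-(η * (M * L))))) =
          K' * Q * Real.exp (b * (j₀ * M * N) + -(η * (M * L))) := by
        rw [Real.exp_add, hQ]; ring
      rw [this]
      have hK'0 : 0 ≤ K' := zero_le_one.trans hK'
      gcongr
      rw [hLdef]
      have h1 : M * (j₀ * N + max t 0) ≤ M * (η * k) := by gcongr
      have h2 : max t 0 ≤ M * max t 0 := le_mul_of_one_le_left (le_max_right _ _) hM1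
      have h3 := mul_le_mul_of_nonneg_left h1 hb0.le
      have h4 := mul_le_mul_of_nonneg_left h2 hb0.le
      linarith only [h3, h4]
    have hone : 1 ≤ (β ^ (j₀ * M))⁻¹ ^ N := by
      rw [hpow]; exact Real.one_le_exp (by positivity)
    have hε'1 : ε' ≤ 1 := by
      have : 1 * 1 * ε' ≤ K' * (β ^ (j₀ * M))⁻¹ ^ N * ε' := by gcongr
      linarith
    refine le_trans (measure_mono (inter_subset_inter_left _ ?_))
      (hcoins (j₀ * M) ε' hε'0 hε'1 hlt _ _ n' ω hV)
    exact shortBranches_subset hc hr hT hβ0 hβ1 hρ hD hL0.le (hrad n)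
  obtain ⟨ω, hω⟩ := exists_survivor (k := k)
    (Bd := fun n M => shortBranches r f ψ η β ρ s₀ L c k n M)
    (In := fun n => approxBranches r f Θ ε β ρ s₀ L c k n₁ n)
    (fun n M => depOn_shortBranches hT n M) (fun n => depOn_approxBranches hT n)
    (c := cc) (by omega) (fun M => 4 ^ (d + 2) * (N * 2⁻¹ ^ (j₀ * M))) hj₀
    (fun n => shortBranches_zero n)
    (by
      intro n M hM hn ω hω
      have hM1 : (1 : ℝ) ≤ M := by exact_mod_cast hM
      have h4 : 9 * M ≤ cc * M := Nat.mul_le_mul_right _ hcc9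
      obtain ⟨p, rfl⟩ : ∃ p, n = p + 4 * M := ⟨n - 4 * M, by omega⟩
      rw [Nat.add_sub_cancel] at hω ⊢
      apply hest _ _ _ hM
      have hsp : s₀ + ((p + 4 * M : ℕ) : ℝ) * L - 4 * (M * L) = s₀ + p * L := by
        push_cast; ring
      have hnR : (cc : ℝ) * M ≤ p + 4 * M := by exact_mod_cast hn
      have hn9 : (9 : ℝ) * M ≤ p + 4 * M := by exact_mod_cast h4.trans hn
      have hrp : 6 * (M : ℝ) ≤ r 1 * p := by
        have h1 : r 1 * (((cc : ℝ) - 4) * M) ≤ r 1 * p :=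
          mul_le_mul_of_nonneg_left (by linarith) hr1
        nlinarith
      have hrpL : 6 * (M * L) ≤ r 1 * (s₀ + p * L) := by
        have := mul_le_mul_of_nonneg_right hrp hL0.le
        nlinarith [mul_nonneg hr1 hs₀0]
      have hML : 0 ≤ (M : ℝ) * L := by positivity
      have hball : Metric.closedBall (c (k * p) ω)
          (Real.exp (-(s₀ + ((p + 4 * M : ℕ) : ℝ) * L - 4 * (M * L)))) = node β ρ c (k * p) ω := by
        rw [hsp, node, hrad]
      have hs6 : ¬ ShortIn r f ψ (s₀ + p * L) ((s₀ + p * L + 6 * (M * L)) / (1 + r 1))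
          (Real.exp (-(η * (6 * (M * L))))) (node β ρ c (k * p) ω) := by
        intro hsh
        have e : ((6 * M : ℕ) : ℝ) * L = 6 * (M * L) := by push_cast; ring
        refine (hω p (Nat.lt_succ_self p)).1 (6 * M) ⟨by omega, ?_, ?_⟩
        · rw [e]; linarith
        · rwa [e]
      have hs4 : ¬ ShortIn r f ψ (s₀ + p * L) ((s₀ + p * L + 4 * (M * L)) / (1 + r 1))
          (Real.exp (-(η * (4 * (M * L))))) (node β ρ c (k * p) ω) := by
        intro hsh
        have e : ((4 * M : ℕ) : ℝ) * L = 4 * (M * L) := by push_cast; ring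
        refine (hω p (Nat.lt_succ_self p)).1 (4 * M) ⟨by omega, ?_, ?_⟩
        · rw [e]; linarith
        · rwa [e]
      have hcen : c (k * p) ω ∈ node β ρ c (k * p) ω :=
        Metric.mem_closedBall_self (by positivity)
      have hC6 : (s₀ + ((p + 4 * M : ℕ) : ℝ) * L + M * L) / (1 + r 1) + M * L / (1 + r 1) =
          (s₀ + p * L + 6 * (M * L)) / (1 + r 1) := by
        push_cast; ring
      have hC4 : (s₀ + ((p + 4 * M : ℕ) : ℝ) * L + M * L) / (1 + r 1) - M * L / (1 + r 1) =
          (s₀ + p * L + 4 * (M * L)) / (1 + r 1) := by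
        push_cast; ring
      have := hLloc (M * L) (hLLl.trans (le_mul_of_one_le_left hL0.le hM1)) hML
        (s₀ + ((p + 4 * M : ℕ) : ℝ) * L)
        ((s₀ + ((p + 4 * M : ℕ) : ℝ) * L + M * L) / (1 + r 1))
        (by push_cast; nlinarith) (by field_simp) (c (k * p) ω)
        (by rw [hball]; exact (hT.node_anti (Nat.zero_le _) ω).trans (hD ω)) (c (k * p) ω)
        (by rw [hball]; exact hcen)
        (by
          intro z hz
          have := not_shortIn hs6 hcen z hz
          rwa [hsp, hC6])
        (by
          intro z hz
          have := not_shortIn hs4 hcen z hz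
          rwa [hsp, hC4])
      rw [hball] at this
      exact this)
    (by
      intro n M hM hn
      have hM1 : (1 : ℝ) ≤ M := by exact_mod_cast hM
      by_cases hact : (M : ℝ) * L ≤ r 1 * (s₀ + n * L)
      swap
      · have : shortBranches r f ψ η β ρ s₀ L c k n M = ∅ := by
          ext ω; simp only [shortBranches, mem_ofPred_eq, mem_empty_iff_false, iff_false]
          exact fun h => hact h.2.1
        simp only [this, measure_empty]
        exact zero_le
      have hLM : L ≤ M * L := le_mul_of_one_le_left hL0.le hM1
      have hsn0 : 0 ≤ s₀ + n * L := by positivity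
      have hsnL : L ≤ s₀ + n * L := by
        have := hr.r_one_le
        nlinarith
      have h1 := hest n M 0 hM (fun _ => false) (by
        rw [hnode0]
        exact hS₀ _ (hLS.trans hsnL) hsn0 (M * L) (by positivity) hact _ (by field_simp))
      rwa [cyl_zero, inter_univ, measure_univ, mul_one] at h1)
    (by
      intro n ω hω
      exact coins_approxBranches_le hr hT hβ0 hβ1 hρ hD hL0 hs₀0 hrad hk2 (by omega) hn₁r
        (htwo Θ hΘ) n ω fun n' hn' => (hω n' hn').1 1)
  refine ⟨ω, he _ fun n hn => ?_⟩
  rintro ⟨x, hx, hz⟩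
  rw [mem_singleton_iff] at hx
  subst hx
  exact (hω n).2 ⟨hn, _, hT.limPt_mem hβ0 hβ1 hρ _ ω, hz⟩

end

/-! ### A potential free game -/

/-- Every tree of ratio `β` rooted at a ball has a branch with limit in `S`. -/
def TreeWin (S : Set ℝ) (β a ρ : ℝ) : Prop :=
  ∀ c, IsTree β ρ c → (∀ ω, c 0 ω = a) → ∃ ω, limPt c ω ∈ S

lemma exists_isTree {β ρ : ℝ} (hβ0 : 0 < β) (hβ : β ≤ 1 / 3) (hρ : 0 < ρ) (a : ℝ) :
    ∃ c, IsTree β ρ c ∧ ∀ ω, c 0 ω = a := by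
  refine ⟨fun n ω => a + ∑ i ∈ Finset.range n, (if ω i then 2 else -2) * (β ^ (i + 1) * ρ),
    ⟨?_, ?_, ?_⟩, fun ω => by simp⟩
  · intro n ω ω' h
    congr 1
    refine Finset.sum_congr rfl fun i hi => ?_
    rw [h i (Finset.mem_range.1 hi)]
  · intro n ω
    have h0 : 0 < β ^ n * ρ := by positivity
    have e : β ^ (n + 1) * ρ = β * (β ^ n * ρ) := by ring
    rw [Finset.sum_range_succ, ← add_assoc, add_sub_cancel_left, abs_mul, e,
      abs_of_nonneg (a := β * (β ^ n * ρ)) (by positivity)]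
    have : |(if ω n then (2 : ℝ) else -2)| = 2 := by split_ifs <;> norm_num
    rw [this]
    nlinarith
  · intro n ω ω' h hne
    have hs : ∑ i ∈ Finset.range n, (if ω i then (2 : ℝ) else -2) * (β ^ (i + 1) * ρ) =
        ∑ i ∈ Finset.range n, (if ω' i then 2 else -2) * (β ^ (i + 1) * ρ) := by
      refine Finset.sum_congr rfl fun i hi => ?_
      rw [h i (Finset.mem_range.1 hi)]
    have h0 : 0 < β ^ (n + 1) * ρ := by positivity
    rw [Finset.sum_range_succ, Finset.sum_range_succ, hs, ← add_assoc, ← add_assoc,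
      add_sub_add_left_eq_sub, ← sub_mul, abs_mul, abs_of_pos h0]
    have : |(if ω n then (2 : ℝ) else -2) - (if ω' n then 2 else -2)| = 4 := by
      cases h1 : ω n <;> cases h2 : ω' n <;> simp_all <;> norm_num
    rw [this]
    linarith

/-- The tree obtained from two trees by adding a root. -/
def glueTree (a : ℝ) (c₁ c₂ : ℕ → (ℕ → Bool) → ℝ) : ℕ → (ℕ → Bool) → ℝ
  | 0, _ => a
  | n + 1, ω => (if ω 0 then c₂ else c₁) n fun i => ω (i + 1)

lemma isTree_glueTree {β ρ a x₁ x₂ : ℝ} {c₁ c₂ : ℕ → (ℕ → Bool) → ℝ}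
    (h₁ : IsTree β (β * ρ) c₁) (h₂ : IsTree β (β * ρ) c₂)
    (hx₁ : ∀ ω, c₁ 0 ω = x₁) (hx₂ : ∀ ω, c₂ 0 ω = x₂) (ha₁ : |x₁ - a| + β * ρ ≤ ρ)
    (ha₂ : |x₂ - a| + β * ρ ≤ ρ) (hsep : 3 * (β * ρ) ≤ |x₂ - x₁|) :
    IsTree β ρ (glueTree a c₁ c₂) := by
  have hh : ∀ b : Bool, IsTree β (β * ρ) (if b then c₂ else c₁) := by
    intro b; cases b <;> simpa
  refine ⟨?_, ?_, ?_⟩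
  · rintro (_ | n) ω ω' h
    · rfl
    · simp only [glueTree]
      rw [h 0 (Nat.succ_pos n)]
      exact (hh (ω 0)).dep n _ _ fun i hi => h (i + 1) (by omega)
  · rintro (_ | n) ω
    · simp only [glueTree, zero_add, pow_one, pow_zero, one_mul]
      cases ω 0 <;> simp [hx₁, hx₂, ha₁, ha₂]
    · simp only [glueTree]
      have := (hh (ω 0)).nest n fun i => ω (i + 1)
      have e₁ : β ^ (n + 1 + 1) * ρ = β ^ (n + 1) * (β * ρ) := by ring
      have e₂ : β ^ (n + 1) * ρ = β ^ n * (β * ρ) := by ring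
      rw [e₁]
      exact this.trans_eq e₂.symm
  · rintro (_ | n) ω ω' h hne
    · simp only [glueTree, zero_add, pow_one]
      cases h1 : ω 0 <;> cases h2 : ω' 0 <;> simp_all [abs_sub_comm]
    · simp only [glueTree]
      rw [h 0 (Nat.succ_pos n)]
      have := (hh (ω 0)).sep n (fun i => ω (i + 1)) (fun i => ω' (i + 1))
        (fun i hi => h (i + 1) (by omega)) hne
      convert this using 1; ring

lemma limPt_glueTree {β ρ a : ℝ} {c₁ c₂ : ℕ → (ℕ → Bool) → ℝ} (hβ0 : 0 < β) (hβ1 : β < 1)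
    (hρ : 0 < ρ) (h₁ : IsTree β (β * ρ) c₁) (h₂ : IsTree β (β * ρ) c₂)
    (h : IsTree β ρ (glueTree a c₁ c₂)) (ω : ℕ → Bool) :
    limPt (glueTree a c₁ c₂) ω = limPt (if ω 0 then c₂ else c₁) fun i => ω (i + 1) := by
  have hh : IsTree β (β * ρ) (if ω 0 then c₂ else c₁) := by
    cases ω 0 <;> simpa
  have t1 := (h.tendsto hβ0 hβ1 hρ ω).comp (tendsto_add_atTop_nat 1)
  exact tendsto_nhds_unique t1 (hh.tendsto hβ0 hβ1 (by positivity) _)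

lemma TreeWin.exists_forbidden {S : Set ℝ} {β a ρ : ℝ} (h : TreeWin S β a ρ) (hβ0 : 0 < β)
    (hβ1 : β < 1) (hρ : 0 < ρ) :
    ∃ b, ∀ x, |x - a| + β * ρ ≤ ρ → 3 * (β * ρ) ≤ |x - b| → TreeWin S β x (β * ρ) := by
  by_contra! hcon
  obtain ⟨x₁, hx₁, -, hn₁⟩ := hcon a
  obtain ⟨x₂, hx₂, hsep, hn₂⟩ := hcon x₁
  simp only [TreeWin, not_forall] at hn₁ hn₂
  obtain ⟨c₁, h₁, e₁, hc₁⟩ := hn₁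
  obtain ⟨c₂, h₂, e₂, hc₂⟩ := hn₂
  have hT := isTree_glueTree h₁ h₂ e₁ e₂ hx₁ hx₂ hsep
  obtain ⟨ω, hω⟩ := h _ hT fun ω => rfl
  rw [limPt_glueTree hβ0 hβ1 hρ h₁ h₂ hT] at hω
  cases h0 : ω 0
  · rw [h0] at hω; exact hc₁ ⟨_, by simpa using hω⟩
  · rw [h0] at hω; exact hc₂ ⟨_, by simpa using hω⟩

/-- A positional strategy that forbids one ball at each turn forces the outcome into `S`. -/
def Wins (β : ℝ) (D S : Set ℝ) : Prop :=
  ∃ A : ℝ → ℝ → ℝ, ∀ (x : ℕ → ℝ) (ρ : ℝ), 0 < ρ → ρ ≤ 1 → Metric.closedBall (x 0) ρ ⊆ D →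
    (∀ k, |x (k + 1) - x k| + β ^ (k + 1) * ρ ≤ β ^ k * ρ) →
    (∀ k, 3 * (β ^ (k + 1) * ρ) ≤ |x (k + 1) - A (x k) (β ^ k * ρ)|) →
    ∀ y, (∀ k, |y - x k| ≤ β ^ k * ρ) → y ∈ S

lemma wins_iUnion {β : ℝ} (hβ0 : 0 < β) (hβ : β ≤ 1 / 3) {D : Set ℝ} {S : ℕ → Set ℝ}
    (hS : Monotone S) (hcl : ∀ e, IsClosed (S e ∩ D))
    (h : ∀ a ρ, 0 < ρ → ρ ≤ 1 → Metric.closedBall a ρ ⊆ D → ∃ e, TreeWin (S e) β a ρ) :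
    Wins β D (⋃ e, S e) := by
  classical
  have hβ1 : β < 1 := by linarith
  have hA : ∀ a ρ, ∃ b, ∀ (_ : 0 < ρ) (hex : ∃ e, TreeWin (S e) β a ρ), ∀ x,
      |x - a| + β * ρ ≤ ρ → 3 * (β * ρ) ≤ |x - b| → TreeWin (S (Nat.find hex)) β x (β * ρ) := by
    intro a ρ
    by_cases hc : 0 < ρ ∧ ∃ e, TreeWin (S e) β a ρ
    · obtain ⟨b, hb⟩ := (Nat.find_spec hc.2).exists_forbidden hβ0 hβ1 hc.1
      exact ⟨b, fun _ _ => hb⟩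
    · exact ⟨0, fun h1 h2 => absurd ⟨h1, h2⟩ hc⟩
  choose A hA using hA
  refine ⟨A, fun x ρ hρ hρ1 hD hnest hav y hy => ?_⟩
  have hex0 := h _ ρ hρ hρ1 hD
  have hpos : ∀ k, 0 < β ^ k * ρ := fun k => by positivity
  have hsucc : ∀ k, β * (β ^ k * ρ) = β ^ (k + 1) * ρ := fun k => by ring
  have hk : ∀ k, ∃ e ≤ Nat.find hex0, TreeWin (S e) β (x k) (β ^ k * ρ) := by
    intro k
    induction k with
    | zero => exact ⟨_, le_rfl, by simpa using Nat.find_spec hex0⟩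
    | succ k ih =>
      obtain ⟨e, he, hwin⟩ := ih
      have := hA (x k) (β ^ k * ρ) (hpos k) ⟨e, hwin⟩ (x (k + 1)) (by rw [hsucc]; exact hnest k)
        (by rw [hsucc]; exact hav k)
      rw [hsucc] at this
      exact ⟨_, (Nat.find_min' _ hwin).trans he, this⟩
  have hballs : ∀ k, Metric.closedBall (x k) (β ^ k * ρ) ⊆ D := by
    intro k
    induction k with
    | zero => simpa using hD
    | succ k ih =>
      refine (Metric.closedBall_subset_closedBall' ?_).trans ih
      rw [Real.dist_eq]
      linarith [hnest k]
  have hpt : ∀ k, ∃ p ∈ S (Nat.find hex0) ∩ D, |p - x k| ≤ β ^ k * ρ := by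
    intro k
    obtain ⟨e, he, hwin⟩ := hk k
    obtain ⟨c, hc, hc0⟩ := exists_isTree hβ0 hβ (hpos k) (x k)
    obtain ⟨ω, hω⟩ := hwin c hc hc0
    have hm := hc.limPt_mem hβ0 hβ1 (hpos k) 0 ω
    simp only [node, pow_zero, one_mul, hc0] at hm
    refine ⟨_, ⟨hS he hω, hballs k hm⟩, ?_⟩
    rwa [Metric.mem_closedBall, Real.dist_eq] at hm
  choose p hp hpx using hpt
  have hlim : Tendsto p atTop (nhds y) := by
    rw [tendsto_iff_dist_tendsto_zero]
    have h0 : Tendsto (fun k : ℕ => 2 * (β ^ k * ρ)) atTop (nhds 0) := by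
      simpa using ((tendsto_pow_atTop_nhds_zero_of_lt_one hβ0.le hβ1).mul_const ρ).const_mul 2
    refine squeeze_zero (fun _ => dist_nonneg) (fun k => ?_) h0
    have h1 := hpx k
    have h2 := hy k
    rw [← Real.dist_eq] at h1 h2
    rw [dist_comm] at h2
    linarith [dist_triangle (p k) (x k) y]
  exact mem_iUnion.2 ⟨_, ((hcl _).mem_of_tendsto hlim (Eventually.of_forall hp)).1⟩

/-- One can avoid a point. -/
lemma wins_compl_singleton {β : ℝ} (hβ0 : 0 < β) (z : ℝ) : Wins β univ {z}ᶜ := by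
  refine ⟨fun _ _ => z, fun x ρ hρ _ _ _ hav y hy hyz => ?_⟩
  rw [mem_singleton_iff] at hyz
  subst hyz
  have h1 := hy 1
  have h2 := hav 0
  rw [abs_sub_comm] at h1
  have : 0 < β ^ (0 + 1) * ρ := by positivity
  simp only [zero_add] at *
  linarith

section

/-! ### Ahlfors regular measures -/

/-- Ahlfors regularity with explicit constants. -/
structure IsAhlfors (μ : Measure ℝ) (C α ρ₀ : ℝ) : Prop where
  one_le : 1 ≤ C
  α_pos : 0 < α
  ρ₀_pos : 0 < ρ₀
  lower : ∀ x ∈ msupport μ, ∀ ρ, 0 < ρ → ρ ≤ ρ₀ →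
    ENNReal.ofReal (C⁻¹ * ρ ^ α) ≤ μ (Metric.ball x ρ)
  upper : ∀ x ∈ msupport μ, ∀ ρ, 0 < ρ → ρ ≤ ρ₀ →
    μ (Metric.ball x ρ) ≤ ENNReal.ofReal (C * ρ ^ α)

lemma measure_compl_msupport (μ : Measure ℝ) : μ (msupport μ)ᶜ = 0 := by
  refine measure_null_of_locally_null _ fun x hx => ?_
  simp only [msupport, mem_compl_iff, Set.mem_ofPred_eq, not_forall, not_lt,
    nonpos_iff_eq_zero] at hx
  obtain ⟨ρ, hρ, h⟩ := hx
  exact ⟨_, mem_nhdsWithin_of_mem_nhds (Metric.ball_mem_nhds x hρ), h⟩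

lemma isClosed_msupport (μ : Measure ℝ) : IsClosed (msupport μ) := by
  rw [← isOpen_compl_iff, Metric.isOpen_iff]
  intro x hx
  simp only [msupport, mem_compl_iff, Set.mem_ofPred_eq, not_forall, not_lt,
    nonpos_iff_eq_zero] at hx
  obtain ⟨ρ, hρ, h⟩ := hx
  refine ⟨ρ / 2, half_pos hρ, fun y hy hmem => ?_⟩
  refine (hmem (ρ / 2) (half_pos hρ)).ne' (measure_mono_null (Metric.ball_subset_ball' ?_) h)
  have := Metric.mem_ball.1 hy
  linarith

variable {μ : Measure ℝ} {C α ρ₀ : ℝ}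

lemma IsAhlfors.measure_le (h : IsAhlfors μ C α ρ₀) {A : Set ℝ} {R : ℝ} (hR : 0 < R)
    (hR0 : R ≤ ρ₀) (hA : ∀ x ∈ A, ∀ y ∈ A, dist x y < R) :
    μ A ≤ ENNReal.ofReal (C * R ^ α) := by
  have h0 : μ A ≤ μ (A ∩ msupport μ) := by
    refine (measure_le_inter_add_sdiff μ A (msupport μ)).trans ?_
    have : μ (A \ msupport μ) = 0 :=
      measure_mono_null (fun x hx => hx.2) (measure_compl_msupport μ)
    rw [this, add_zero]
  refine h0.trans ?_
  rcases (A ∩ msupport μ).eq_empty_or_nonempty with he | ⟨x, hx⟩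
  · simp [he]
  · exact (measure_mono fun y hy => Metric.mem_ball.2 (hA y hy.1 x hx.1)).trans
      (h.upper x hx.2 R hR hR0)

/-! ### The covering potential -/

/-- Total weight of the sets `E i` at distance at most `ρ` from `x`. -/
noncomputable def coverPot (E : ℕ → Set ℝ) (w : ℕ → ℝ≥0∞) (x ρ : ℝ) : ℝ≥0∞ :=
  ∑' i, (Metric.cthickening ρ (E i)).indicator (fun _ => w i) x

lemma le_coverPot {E : ℕ → Set ℝ} {w : ℕ → ℝ≥0∞} {x ρ : ℝ} {i : ℕ}
    (hx : x ∈ Metric.cthickening ρ (E i)) : w i ≤ coverPot E w x ρ := by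
  refine le_trans ?_ (ENNReal.le_tsum i)
  rw [indicator_of_mem hx]

lemma mem_cthickening_of_mem {E : Set ℝ} {x x' ρ ρ' : ℝ} (hρ' : 0 ≤ ρ')
    (h : |x' - x| + ρ' ≤ ρ) (hx' : x' ∈ Metric.cthickening ρ' E) :
    x ∈ Metric.cthickening ρ E := by
  rw [Metric.mem_cthickening_iff] at *
  refine (Metric.infEDist_le_infEDist_add_edist (y := x')).trans ?_
  rw [edist_dist, dist_comm, Real.dist_eq]
  refine (add_le_add_left hx' _).trans ?_
  rw [← ENNReal.ofReal_add hρ' (abs_nonneg _)]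
  exact ENNReal.ofReal_le_ofReal (by linarith)

lemma exists_child (h : IsAhlfors μ C α ρ₀) {s β : ℝ} (hs : 0 < s) (hβ0 : 0 < β)
    (hβ8 : β ≤ 1 / 8)
    (hβ : C * (8 * β) ^ α + C * (4 * β) ^ α * β ^ (-s) < C⁻¹ * (1 / 2) ^ α)
    {E : ℕ → Set ℝ} {w : ℕ → ℝ≥0∞}
    (hw : ∀ i, (E i).Nonempty → Metric.ediam (E i) ^ s ≤ w i) {x ρ : ℝ} (hx : x ∈ msupport μ)
    (hρ : 0 < ρ) (hρ0 : ρ ≤ ρ₀) (hpot : coverPot E w x ρ ≤ ENNReal.ofReal ((β * ρ) ^ s)) (A : ℝ) :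
    ∃ x' ∈ msupport μ, |x' - x| ≤ ρ / 2 ∧ 4 * (β * ρ) ≤ |x' - A| ∧
      coverPot E w x' (β * ρ) ≤ ENNReal.ofReal ((β * (β * ρ)) ^ s) := by
  classical
  by_contra! hcon
  have hC : 0 < C := lt_of_lt_of_le one_pos h.one_le
  have hβρ : 0 < β * ρ := by positivity
  have hsub : Metric.ball x (ρ / 2) ⊆ Metric.ball A (4 * (β * ρ)) ∪ ((msupport μ)ᶜ ∪
      {x' ∈ Metric.ball x (ρ / 2) | ENNReal.ofReal ((β * (β * ρ)) ^ s) ≤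
        coverPot E w x' (β * ρ)}) := by
    intro y hy
    by_cases h1 : y ∈ msupport μ
    · by_cases h2 : 4 * (β * ρ) ≤ |y - A|
      · refine Or.inr (Or.inr ⟨hy, (hcon y h1 ?_ h2).le⟩)
        rw [Metric.mem_ball, Real.dist_eq] at hy; exact hy.le
      · left
        rw [Metric.mem_ball, Real.dist_eq]; exact not_le.1 h2
    · exact Or.inr (Or.inl h1)
  have hmeas : Measurable fun x' => coverPot E w x' (β * ρ) :=
    Measurable.tsum fun i =>
      measurable_const.indicator Metric.isClosed_cthickening.measurableSet
  have hnear : ∀ i, ∀ y ∈ Metric.ball x (ρ / 2), y ∈ Metric.cthickening (β * ρ) (E i) →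
      x ∈ Metric.cthickening ρ (E i) := by
    intro i y hy hyE
    refine mem_cthickening_of_mem hβρ.le ?_ hyE
    rw [Metric.mem_ball, Real.dist_eq] at hy
    nlinarith
  have hterm : ∀ i, ∫⁻ x' in Metric.ball x (ρ / 2),
      (Metric.cthickening (β * ρ) (E i)).indicator (fun _ => w i) x' ∂μ ≤
      (Metric.cthickening ρ (E i)).indicator (fun _ => w i) x *
        ENNReal.ofReal (C * (4 * (β * ρ)) ^ α) := by
    intro i
    rw [lintegral_indicator_const Metric.isClosed_cthickening.measurableSet,
      Measure.restrict_apply Metric.isClosed_cthickening.measurableSet]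
    by_cases hxi : x ∈ Metric.cthickening ρ (E i)
    · rw [indicator_of_mem hxi]
      refine mul_le_mul_right (h.measure_le (by positivity) (by nlinarith) ?_) _
      have hne : (E i).Nonempty := by
        rw [nonempty_iff_ne_empty]
        rintro h0
        rw [h0] at hxi; simp at hxi
      have hd : Metric.ediam (E i) ≤ ENNReal.ofReal (β * ρ) := by
        have := (hw i hne).trans ((le_coverPot hxi).trans hpot)
        rw [← ENNReal.ofReal_rpow_of_pos hβρ] at this
        exact (ENNReal.rpow_le_rpow_iff hs).1 this
      have hd' : Metric.ediam (Metric.cthickening (β * ρ) (E i)) ≤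
          ENNReal.ofReal (3 * (β * ρ)) := by
        have e := Metric.ediam_cthickening_le (ε := (β * ρ).toNNReal) (s := E i)
        rw [Real.coe_toNNReal _ hβρ.le] at e
        refine e.trans ?_
        change _ + 2 * ENNReal.ofReal (β * ρ) ≤ _
        rw [show 3 * (β * ρ) = β * ρ + 2 * (β * ρ) by ring,
          ENNReal.ofReal_add hβρ.le (by positivity), ENNReal.ofReal_mul (p := 2) (by norm_num)]
        simpa using add_le_add_left hd _
      intro y hy z hz
      have := (Metric.edist_le_ediam_of_mem hy.1 hz.1).trans hd'
      rw [edist_dist, ENNReal.ofReal_le_ofReal_iff (by positivity)] at this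
      linarith
    · rw [indicator_of_notMem hxi, zero_mul]
      have : Metric.cthickening (β * ρ) (E i) ∩ Metric.ball x (ρ / 2) = ∅ := by
        rw [eq_empty_iff_forall_notMem]
        exact fun y hy => hxi (hnear i y hy.2 hy.1)
      rw [this]; simp
  have hint_le : ∫⁻ x' in Metric.ball x (ρ / 2), coverPot E w x' (β * ρ) ∂μ ≤
      ENNReal.ofReal ((β * ρ) ^ s) * ENNReal.ofReal (C * (4 * (β * ρ)) ^ α) := by
    unfold coverPot
    rw [lintegral_tsum fun i => (measurable_const.indicator
      Metric.isClosed_cthickening.measurableSet).aemeasurable]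
    refine (ENNReal.tsum_le_tsum hterm).trans ?_
    rw [ENNReal.tsum_mul_right]
    exact mul_le_mul_left hpot _
  have hT0 : 0 < (β * (β * ρ)) ^ s := by positivity
  have hmark : μ {x' ∈ Metric.ball x (ρ / 2) | ENNReal.ofReal ((β * (β * ρ)) ^ s) ≤
      coverPot E w x' (β * ρ)} ≤ ENNReal.ofReal (C * (4 * β) ^ α * β ^ (-s) * ρ ^ α) := by
    have hm := meas_ge_le_lintegral_div (μ := μ.restrict (Metric.ball x (ρ / 2)))
      hmeas.aemeasurable (ε := ENNReal.ofReal ((β * (β * ρ)) ^ s))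
      (by simpa using hT0) ENNReal.ofReal_ne_top
    rw [Measure.restrict_apply (measurableSet_le measurable_const hmeas)] at hm
    have hm' := hm.trans (ENNReal.div_le_div_right hint_le _)
    rw [inter_comm] at hm'
    refine (le_of_eq (by rfl)).trans (hm'.trans (le_of_eq ?_))
    rw [← ENNReal.ofReal_mul (by positivity), ← ENNReal.ofReal_div_of_pos hT0]
    congr 1
    rw [Real.mul_rpow hβ0.le hβρ.le, ← mul_assoc 4,
      Real.mul_rpow (x := 4 * β) (by positivity) hρ.le, Real.rpow_neg hβ0.le]
    have : 0 < (β * ρ) ^ s := by positivity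
    have : 0 < β ^ s := by positivity
    field_simp
  have hA : μ (Metric.ball A (4 * (β * ρ))) ≤ ENNReal.ofReal (C * (8 * β) ^ α * ρ ^ α) := by
    refine (h.measure_le (R := 8 * (β * ρ)) (by positivity) (by nlinarith) ?_).trans_eq ?_
    · intro y hy z hz
      rw [Metric.mem_ball] at hy hz
      rw [dist_comm] at hz
      linarith [dist_triangle y A z]
    · rw [← mul_assoc 8, Real.mul_rpow (by positivity) hρ.le, mul_assoc]
  have hlow := h.lower x hx (ρ / 2) (by positivity) (by linarith)
  have htot := hlow.trans ((measure_mono hsub).trans ((measure_union_le _ _).trans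
    (add_le_add hA ((measure_union_le _ _).trans (add_le_add
      (measure_compl_msupport μ).le hmark)))))
  rw [zero_add, ← ENNReal.ofReal_add (by positivity) (by positivity),
    ENNReal.ofReal_le_ofReal_iff (by positivity), ← add_mul, div_eq_mul_one_div ρ, mul_comm ρ,
    Real.mul_rpow (by norm_num) hρ.le, ← mul_assoc] at htot
  have : 0 < ρ ^ α := by positivity
  exact absurd (le_of_mul_le_mul_right htot this) (not_le.2 hβ)

end

section

variable {μ : Measure ℝ} {C α ρ₀ : ℝ}

lemma exists_play (h : IsAhlfors μ C α ρ₀) {s β : ℝ} (hs : 0 < s) (hβ0 : 0 < β)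
    (hβ8 : β ≤ 1 / 8)
    (hβ : C * (8 * β) ^ α + C * (4 * β) ^ α * β ^ (-s) < C⁻¹ * (1 / 2) ^ α)
    {E : ℕ → Set ℝ} {w : ℕ → ℝ≥0∞} (hw0 : ∀ i, w i ≠ 0)
    (hw : ∀ i, (E i).Nonempty → Metric.ediam (E i) ^ s ≤ w i) {x ρ : ℝ} (hx : x ∈ msupport μ)
    (hρ : 0 < ρ) (hρ0 : ρ ≤ ρ₀) (hρ1 : ρ ≤ 1)
    (hsum : ∑' i, w i ≤ ENNReal.ofReal ((β * ρ) ^ s))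
    {D S : ℕ → Set ℝ} (hwin : ∀ c, ∀ β, 0 < β → β ≤ 1 / 3 → Wins β (D c) (S c)) :
    ∃ y ∈ msupport μ, |y - x| ≤ ρ ∧ (∀ i, y ∉ E i) ∧ ∀ c, y ∈ interior (D c) → y ∈ S c := by
  have hβ1 : β < 1 := by linarith
  have hpow : ∀ n, 0 < β ^ n * ρ := fun n => by positivity
  have hsucc : ∀ n, β * (β ^ n * ρ) = β ^ (n + 1) * ρ := fun n => by ring
  have hle : ∀ n, β ^ n * ρ ≤ ρ := fun n =>
    mul_le_of_le_one_left hρ.le (pow_le_one₀ hβ0.le hβ1.le)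
  have hβc : ∀ c, β ^ 2 ^ (c + 1) ≤ 1 / 3 := fun c =>
    (pow_le_of_le_one hβ0.le hβ1.le (by positivity)).trans (by linarith)
  choose A hA using fun c => hwin c (β ^ 2 ^ (c + 1)) (by positivity) (hβc c)
  have hstep : ∀ (n : ℕ) (z a : ℝ), z ∈ msupport μ ∧
      coverPot E w z (β ^ n * ρ) ≤ ENNReal.ofReal ((β ^ (n + 1) * ρ) ^ s) →
      ∃ z', (z' ∈ msupport μ ∧
        coverPot E w z' (β ^ (n + 1) * ρ) ≤ ENNReal.ofReal ((β ^ (n + 2) * ρ) ^ s)) ∧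
        |z' - z| ≤ β ^ n * ρ / 2 ∧ 4 * (β ^ (n + 1) * ρ) ≤ |z' - a| := by
    intro n z a hz
    obtain ⟨z', h1, h2, h3, h4⟩ := exists_child h hs hβ0 hβ8 hβ hw hz.1 (hpow n)
      ((hle n).trans hρ0) (by rw [hsucc]; exact hz.2) a
    rw [hsucc] at h3 h4
    rw [hsucc] at h4
    exact ⟨z', ⟨h1, h4⟩, h2, h3⟩
  choose! F hF using hstep
  let y : ℕ → ℝ := fun n => Nat.rec x
    (fun n z => F n z (A (padicValNat 2 (n + 1)) z (β ^ n * ρ))) n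
  have hy0 : y 0 = x := rfl
  have hyS : ∀ n, y (n + 1) = F n (y n) (A (padicValNat 2 (n + 1)) (y n) (β ^ n * ρ)) :=
    fun n => rfl
  have hinv : ∀ n, y n ∈ msupport μ ∧
      coverPot E w (y n) (β ^ n * ρ) ≤ ENNReal.ofReal ((β ^ (n + 1) * ρ) ^ s) := by
    intro n
    induction n with
    | zero =>
      refine ⟨hx, (ENNReal.tsum_le_tsum fun i => ?_).trans (hsum.trans_eq (by simp))⟩
      exact indicator_le_self' (fun _ _ => zero_le) _
    | succ n ih => rw [hyS]; exact (hF n _ _ ih).1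
  have hd : ∀ n, |y (n + 1) - y n| ≤ β ^ n * ρ / 2 := fun n => by
    rw [hyS]; exact (hF n _ _ (hinv n)).2.1
  have hav : ∀ n, 4 * (β ^ (n + 1) * ρ) ≤
      |y (n + 1) - A (padicValNat 2 (n + 1)) (y n) (β ^ n * ρ)| := fun n => by
    rw [hyS]; exact (hF n _ _ (hinv n)).2.2
  clear_value y
  have hnest : ∀ n, |y (n + 1) - y n| + β ^ (n + 1) * ρ ≤ β ^ n * ρ := fun n => by
    have := hd n
    have := hsucc n
    have := hpow n
    nlinarith
  have hnest' : ∀ n k, |y (n + k) - y n| + β ^ (n + k) * ρ ≤ β ^ n * ρ := by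
    intro n k
    induction k with
    | zero => simp
    | succ k ih =>
      have := hnest (n + k)
      have := abs_sub_le (y (n + (k + 1))) (y (n + k)) (y n)
      rw [← add_assoc] at *
      linarith
  have hlim0 : Tendsto (fun n : ℕ => β ^ n * ρ) atTop (nhds 0) := by
    simpa using (tendsto_pow_atTop_nhds_zero_of_lt_one hβ0.le hβ1).mul_const ρ
  have hcau : CauchySeq y := by
    refine cauchySeq_of_le_tendsto_0 (fun n => 2 * (β ^ n * ρ)) ?_
      (by simpa using hlim0.const_mul 2)
    intro n m N hn hm
    obtain ⟨n, rfl⟩ := Nat.exists_eq_add_of_le hn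
    obtain ⟨m, rfl⟩ := Nat.exists_eq_add_of_le hm
    rw [Real.dist_eq]
    have h1 := hnest' N n
    have h2 := hnest' N m
    have h3 := abs_sub_le (y (N + n)) (y N) (y (N + m))
    rw [abs_sub_comm (y N)] at h3
    linarith [hpow (N + n), hpow (N + m)]
  obtain ⟨z, hz⟩ := cauchySeq_tendsto_of_complete hcau
  have hzn : ∀ n, |z - y n| ≤ β ^ n * ρ := by
    intro n
    have ht : Tendsto (fun k => |y (k + n) - y n|) atTop (nhds |z - y n|) :=
      (((tendsto_add_atTop_iff_nat n).2 hz).sub_const _).abs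
    refine le_of_tendsto' ht fun k => ?_
    rw [add_comm]
    linarith [hnest' n k, hpow (n + k)]
  refine ⟨z, (isClosed_msupport μ).mem_of_tendsto hz (Eventually.of_forall fun n => (hinv n).1),
    by simpa [hy0] using hzn 0, ?_, ?_⟩
  · intro i hi
    have hle' : ∀ n, w i ≤ ENNReal.ofReal ((β ^ (n + 1) * ρ) ^ s) := by
      intro n
      refine (le_coverPot ?_).trans (hinv n).2
      refine Metric.mem_cthickening_of_dist_le _ z _ _ hi ?_
      rw [dist_comm, Real.dist_eq]
      exact hzn n
    have ht : Tendsto (fun n : ℕ => ENNReal.ofReal ((β ^ (n + 1) * ρ) ^ s)) atTop (nhds 0) := by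
      have := (((tendsto_add_atTop_iff_nat 1).2 hlim0).rpow_const (p := s) (Or.inr hs.le))
      rw [Real.zero_rpow hs.ne'] at this
      simpa using ENNReal.tendsto_ofReal this
    exact hw0 i (le_antisymm (ge_of_tendsto' ht hle') zero_le)
  · intro c hc
    obtain ⟨ε, hε, hball⟩ := Metric.isOpen_iff.1 isOpen_interior z hc
    obtain ⟨N, hN⟩ := (hlim0.eventually (gt_mem_nhds (half_pos hε))).exists_forall_of_atTop
    set n : ℕ → ℕ := fun k => 2 ^ c * (2 * (N + k) + 1) - 1 with hn
    have hn1 : ∀ k, n k + 1 = 2 ^ c * (2 * (N + k) + 1) := fun k =>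
      Nat.sub_add_cancel (Nat.one_le_iff_ne_zero.2 (by positivity))
    have hnS : ∀ k, n (k + 1) = n k + 2 ^ (c + 1) := by
      intro k
      have h1 := hn1 k
      have h2 := hn1 (k + 1)
      have : 2 ^ c * (2 * (N + (k + 1)) + 1) = 2 ^ c * (2 * (N + k) + 1) + 2 ^ (c + 1) := by ring
      omega
    have hnk : ∀ k, n k = n 0 + k * 2 ^ (c + 1) := by
      intro k
      induction k with
      | zero => simp
      | succ k ih => rw [hnS, ih]; ring
    have hval : ∀ k, padicValNat 2 (n k + 1) = c := by
      intro k
      rw [hn1, padicValNat.mul (by positivity) (by positivity), padicValNat.prime_pow,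
        padicValNat.eq_zero_of_not_dvd (by omega), add_zero]
    have hrad : ∀ k, (β ^ 2 ^ (c + 1)) ^ k * (β ^ n 0 * ρ) = β ^ n k * ρ := by
      intro k
      rw [hnk k, pow_add, ← pow_mul, mul_comm k]; ring
    have hn0 : N ≤ n 0 := by
      have h1 := hn1 0
      have : 1 * (2 * (N + 0) + 1) ≤ 2 ^ c * (2 * (N + 0) + 1) :=
        Nat.mul_le_mul_right _ Nat.one_le_two_pow
      omega
    refine hA c (fun k => y (n k)) (β ^ n 0 * ρ) (hpow _) ((hle _).trans hρ1) ?_ ?_ ?_ z ?_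
    · intro p hp
      refine interior_subset (hball ?_)
      have h1 := hzn (n 0)
      have h2 := hN _ hn0
      rw [Metric.mem_closedBall] at hp
      rw [← Real.dist_eq, dist_comm] at h1
      rw [Metric.mem_ball]
      linarith [dist_triangle p (y (n 0)) z]
    · intro k
      rw [hrad, hrad, hnS]
      exact hnest' _ _
    · intro k
      rw [hrad, hrad]
      have h1 := hav (n k)
      rw [hval] at h1
      obtain ⟨m, hm⟩ : ∃ m, n (k + 1) = n k + 1 + m :=
        ⟨2 ^ (c + 1) - 1, by rw [hnS]; have := Nat.one_le_two_pow (n := c + 1); omega⟩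
      have h2 := hnest' (n k + 1) m
      rw [← hm] at h2
      have h3 := abs_sub_le (y (n k + 1)) (y (n (k + 1))) (A c (y (n k)) (β ^ n k * ρ))
      rw [abs_sub_comm (y (n k + 1)) (y (n (k + 1)))] at h3
      have : β ^ n (k + 1) * ρ ≤ β ^ (n k + 1) * ρ := by
        linarith [abs_nonneg (y (n (k + 1)) - y (n k + 1))]
      linarith [hpow (n k + 1)]
    · intro k
      rw [hrad]
      exact hzn _

theorem le_dimH_of_wins (h : IsAhlfors μ C α ρ₀) {D S : ℕ → Set ℝ}
    (hwin : ∀ c, ∀ β, 0 < β → β ≤ 1 / 3 → Wins β (D c) (S c)) {V T : Set ℝ} (hV : IsOpen V)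
    (hne : (V ∩ msupport μ).Nonempty)
    (hT : ∀ y ∈ V, (∀ c, y ∈ interior (D c) → y ∈ S c) → y ∈ T) :
    ENNReal.ofReal α ≤ dimH (T ∩ msupport μ) := by
  have hC : 0 < C := lt_of_lt_of_le one_pos h.one_le
  have hα := h.α_pos
  refine le_of_forall_lt fun t ht => ?_
  obtain ⟨s, hts, hsα⟩ := ENNReal.lt_iff_exists_nnreal_btwn.1 ht
  refine hts.trans_le (le_dimH_of_hausdorffMeasure_ne_zero fun h0 => ?_)
  have hs0 : (0 : ℝ) < s := by
    exact_mod_cast (zero_le.trans_lt hts)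
  have hsα' : (s : ℝ) < α := by
    rw [← ENNReal.ofReal_coe_nnreal, ENNReal.ofReal_lt_ofReal_iff hα] at hsα
    exact hsα
  obtain ⟨β, hβ0, hβ8, hβ⟩ : ∃ β : ℝ, 0 < β ∧ β ≤ 1 / 8 ∧
      C * (8 * β) ^ α + C * (4 * β) ^ α * β ^ (-(s : ℝ)) < C⁻¹ * (1 / 2) ^ α := by
    have key : Tendsto (fun β : ℝ => C * 8 ^ α * β ^ α + C * 4 ^ α * β ^ (α - s))
        (nhds 0) (nhds 0) := by
      have h1 : Tendsto (fun β : ℝ => β ^ α) (nhds 0) (nhds 0) := by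
        simpa [Real.zero_rpow hα.ne'] using
          (Real.continuousAt_rpow_const 0 α (Or.inr hα.le)).tendsto
      have h2 : Tendsto (fun β : ℝ => β ^ (α - s)) (nhds 0) (nhds 0) := by
        simpa [Real.zero_rpow (sub_pos.2 hsα').ne'] using
          (Real.continuousAt_rpow_const 0 (α - s) (Or.inr (sub_pos.2 hsα').le)).tendsto
      simpa using (h1.const_mul (C * 8 ^ α)).add (h2.const_mul (C * 4 ^ α))
    have hev := (key.mono_left (nhdsWithin_le_nhds (s := Ioi 0))).eventually
      (gt_mem_nhds (show 0 < C⁻¹ * (1 / 2) ^ α by positivity))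
    obtain ⟨β, hβ, h1⟩ := (hev.and (Ioc_mem_nhdsGT (show (0 : ℝ) < 1 / 8 by norm_num))).exists
    refine ⟨β, h1.1, h1.2, ?_⟩
    rw [Real.mul_rpow (by norm_num) h1.1.le, Real.mul_rpow (by norm_num) h1.1.le]
    rw [sub_eq_add_neg, Real.rpow_add h1.1] at hβ
    linarith
  obtain ⟨x, hxV, hx⟩ := hne
  obtain ⟨ε, hε, hball⟩ := Metric.isOpen_iff.1 hV x hxV
  obtain ⟨ρ, hρ, hρmin⟩ := exists_between (lt_min hε (lt_min h.ρ₀_pos one_pos))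
  have hρε : ρ < ε := hρmin.trans_le (min_le_left _ _)
  have hρ0 : ρ ≤ ρ₀ := (hρmin.trans_le ((min_le_right _ _).trans (min_le_left _ _))).le
  have hρ1 : ρ ≤ 1 := (hρmin.trans_le ((min_le_right _ _).trans (min_le_right _ _))).le
  have hδ : 0 < ENNReal.ofReal ((β * ρ) ^ (s : ℝ)) / 2 :=
    ENNReal.half_pos (by simpa using (by positivity : 0 < (β * ρ) ^ (s : ℝ)))
  obtain ⟨w', hw'0, hw'⟩ := ENNReal.exists_pos_sum_of_countable' hδ.ne' ℕ
  rw [Measure.hausdorffMeasure_apply] at h0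
  have h1 := le_of_eq h0
  rw [iSup₂_le_iff] at h1
  have h2 := (h1 1 one_pos).trans_lt hδ
  simp only [iInf_lt_iff] at h2
  obtain ⟨E, hE, -, hEs⟩ := h2
  obtain ⟨y, hy, hyx, hyE, hyS⟩ := exists_play h hs0 hβ0 hβ8 hβ
    (E := E) (w := fun i => (⨆ _ : (E i).Nonempty, Metric.ediam (E i) ^ (s : ℝ)) + w' i)
    (fun i => ((hw'0 i).trans_le le_add_self).ne')
    (fun i hi => le_trans (le_iSup (fun _ => Metric.ediam (E i) ^ (s : ℝ)) hi) le_self_add)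
    hx hρ hρ0 hρ1 (by
      rw [ENNReal.tsum_add]
      exact (add_le_add hEs.le hw'.le).trans_eq (ENNReal.add_halves _)) hwin
  have hyV : y ∈ V := hball (by rw [Metric.mem_ball, Real.dist_eq]; linarith)
  obtain ⟨i, hi⟩ := mem_iUnion.1 (hE ⟨hT y hyV hyS, hy⟩)
  exact hyE i hi

end

section

variable {μ : Measure ℝ} {C α ρ₀ : ℝ}

lemma dimH_inter_ball_le (h : IsAhlfors μ C α ρ₀) {x ρ : ℝ} (hx : x ∈ msupport μ) (hρ : 0 < ρ)
    (hρ0 : 2 * ρ ≤ ρ₀) : dimH (msupport μ ∩ Metric.ball x ρ) ≤ ENNReal.ofReal α := by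
  have hC : 0 < C := lt_of_lt_of_le one_pos h.one_le
  have hα := h.α_pos
  set ν := μ.restrict (Metric.ball x (2 * ρ)) with hν
  have hfin : ν univ ≠ ⊤ := by
    rw [hν, Measure.restrict_apply_univ]
    exact ((h.upper x hx _ (by positivity) hρ0).trans_lt ENNReal.ofReal_lt_top).ne
  set I : ℝ → ℤ → Set ℝ := fun ε k => Ico (k * ε) ((k + 1) * ε) with hI
  have hIdisj : ∀ ε, 0 < ε → Pairwise fun i j => Disjoint (I ε i) (I ε j) := by
    intro ε hε i j hij
    rw [Set.disjoint_left]
    intro y hy hy'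
    apply hij
    have h1 : (i : ℝ) < j + 1 := lt_of_mul_lt_mul_right (hy.1.trans_lt hy'.2) hε.le
    have h2 : (j : ℝ) < i + 1 := lt_of_mul_lt_mul_right (hy'.1.trans_lt hy.2) hε.le
    have h1' : i < j + 1 := by exact_mod_cast h1
    have h2' : j < i + 1 := by exact_mod_cast h2
    omega
  have hsum : ∀ ε, 0 < ε → ∑' k, ν (I ε k) ≤ ν univ := fun ε hε =>
    (tsum_meas_le_meas_iUnion_of_disjoint ν (fun _ => measurableSet_Ico) (hIdisj ε hε)).trans
      (measure_mono (subset_univ _))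
  have hterm : ∀ ε, 0 < ε → ε < ρ → ∀ k,
      Metric.ediam (I ε k ∩ (msupport μ ∩ Metric.ball x ρ)) ^ α ≤
        ENNReal.ofReal C * (ν (I ε (k - 1)) + ν (I ε k) + ν (I ε (k + 1))) := by
    intro ε hε hερ k
    rcases (I ε k ∩ (msupport μ ∩ Metric.ball x ρ)).eq_empty_or_nonempty with he | ⟨y, hyI, hy, hyx⟩
    · rw [he, Metric.ediam_empty, ENNReal.zero_rpow_of_pos hα]; exact zero_le
    have h1 : Metric.ediam (I ε k ∩ (msupport μ ∩ Metric.ball x ρ)) ≤ ENNReal.ofReal ε := by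
      refine (Metric.ediam_mono inter_subset_left).trans ?_
      rw [hI, Real.ediam_Ico]
      exact ENNReal.ofReal_le_ofReal (by linarith)
    have h2 : Metric.ball y ε ⊆ I ε (k - 1) ∪ I ε k ∪ I ε (k + 1) := by
      intro z hz
      rw [Metric.mem_ball, Real.dist_eq, abs_lt] at hz
      have ha := hyI.1
      have hb := hyI.2
      rcases lt_or_ge z (k * ε) with h3 | h3
      · refine Or.inl (Or.inl ⟨?_, ?_⟩) <;> push_cast <;> linarith
      · rcases lt_or_ge z ((k + 1) * ε) with h4 | h4
        · exact Or.inl (Or.inr ⟨h3, h4⟩)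
        · refine Or.inr ⟨?_, ?_⟩ <;> push_cast <;> linarith
    have h3 : Metric.ball y ε ⊆ Metric.ball x (2 * ρ) := by
      refine Metric.ball_subset_ball' ?_
      rw [Metric.mem_ball] at hyx
      linarith
    calc _ ≤ ENNReal.ofReal ε ^ α := ENNReal.rpow_le_rpow h1 hα.le
      _ = ENNReal.ofReal C * ENNReal.ofReal (C⁻¹ * ε ^ α) := by
        rw [ENNReal.ofReal_rpow_of_pos hε, ← ENNReal.ofReal_mul hC.le,
          mul_inv_cancel_left₀ hC.ne']
      _ ≤ ENNReal.ofReal C * ν (Metric.ball y ε) := by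
        rw [hν, Measure.restrict_eq_self _ h3]
        exact mul_le_mul_right (h.lower y hy ε hε (by linarith)) _
      _ ≤ _ := mul_le_mul_right ((measure_mono h2).trans ((measure_union_le _ _).trans
        (add_le_add (measure_union_le _ _) le_rfl))) _
  have htot : ∀ ε, 0 < ε → ε < ρ →
      ∑' k, Metric.ediam (I ε k ∩ (msupport μ ∩ Metric.ball x ρ)) ^ α ≤
        ENNReal.ofReal C * (ν univ + ν univ + ν univ) := by
    intro ε hε hερ
    refine (ENNReal.tsum_le_tsum (hterm ε hε hερ)).trans ?_
    have e₁ : ∑' k, ν (I ε (k - 1)) = ∑' k, ν (I ε k) :=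
      (Equiv.subRight (1 : ℤ)).tsum_eq fun k => ν (I ε k)
    have e₂ : ∑' k, ν (I ε (k + 1)) = ∑' k, ν (I ε k) :=
      (Equiv.addRight (1 : ℤ)).tsum_eq fun k => ν (I ε k)
    rw [ENNReal.tsum_mul_left, ENNReal.tsum_add, ENNReal.tsum_add, e₁, e₂]
    exact mul_le_mul_right (add_le_add (add_le_add (hsum ε hε) (hsum ε hε)) (hsum ε hε)) _
  have hlim : Tendsto ENNReal.ofReal (nhdsWithin 0 (Ioi 0)) (nhds 0) := by
    have := (ENNReal.continuous_ofReal.tendsto 0).mono_left (nhdsWithin_le_nhds (s := Ioi 0))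
    rwa [ENNReal.ofReal_zero] at this
  have hsmall : ∀ᶠ ε in nhdsWithin (0 : ℝ) (Ioi 0), 0 < ε ∧ ε < ρ := Ioo_mem_nhdsGT hρ
  have hH := Measure.hausdorffMeasure_le_liminf_tsum α (msupport μ ∩ Metric.ball x ρ)
    ENNReal.ofReal hlim (fun ε k => I ε k ∩ (msupport μ ∩ Metric.ball x ρ))
    (hsmall.mono fun ε hε k => by
      refine (Metric.ediam_mono inter_subset_left).trans ?_
      rw [hI, Real.ediam_Ico]
      exact ENNReal.ofReal_le_ofReal (by linarith))
    (hsmall.mono fun ε hε y hy => mem_iUnion.2 ⟨⌊y / ε⌋,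
      ⟨by rw [← le_div_iff₀ hε.1]; exact Int.floor_le _,
        by rw [← div_lt_iff₀ hε.1]; exact Int.lt_floor_add_one _⟩, hy⟩)
  have hne : μH[α] (msupport μ ∩ Metric.ball x ρ) ≠ ⊤ := by
    refine (hH.trans_lt ((liminf_le_of_frequently_le'
      (hsmall.mono fun ε hε => htot ε hε.1 hε.2).frequently).trans_lt ?_)).ne
    exact ENNReal.mul_lt_top ENNReal.ofReal_lt_top
      (ENNReal.add_lt_top.2 ⟨ENNReal.add_lt_top.2 ⟨hfin.lt_top, hfin.lt_top⟩, hfin.lt_top⟩)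
  have hα' : (α.toNNReal : ℝ) = α := Real.coe_toNNReal _ hα.le
  exact dimH_le_of_hausdorffMeasure_ne_top (by rwa [hα'])

lemma dimH_msupport_le (h : IsAhlfors μ C α ρ₀) : dimH (msupport μ) ≤ ENNReal.ofReal α := by
  have hρ : 0 < ρ₀ / 2 := half_pos h.ρ₀_pos
  obtain ⟨t, ht, htc, hcov⟩ := TopologicalSpace.countable_cover_nhdsWithin (s := msupport μ)
    (f := fun x => Metric.ball x (ρ₀ / 2))
    fun x _ => mem_nhdsWithin_of_mem_nhds (Metric.ball_mem_nhds x hρ)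
  have : msupport μ ⊆ ⋃ x ∈ t, msupport μ ∩ Metric.ball x (ρ₀ / 2) := by
    intro y hy
    obtain ⟨x, hx, hyx⟩ := mem_iUnion₂.1 (hcov hy)
    exact mem_iUnion₂.2 ⟨x, hx, hy, hyx⟩
  refine (dimH_mono this).trans ?_
  rw [dimH_bUnion htc]
  exact iSup₂_le fun x hx => dimH_inter_ball_le h (ht hx) hρ (by linarith)

end

section

/-! ### Local data of an analytic curve -/

variable {d : ℕ} {f Θ : ℝ → Fin (d + 2) → ℝ} {r : Fin (d + 2) → ℝ} {m : ℝ}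

lemma badSet_mono : Monotone (badSet r f Θ) := by
  intro e e' h x hx z hz
  have h' : (e : ℝ) ≤ e' := by exact_mod_cast h
  obtain ⟨i, hi, hb⟩ := hx z (by linarith)
  refine ⟨i, hi, le_trans ?_ hb⟩
  have : (0 : ℝ) < e + 1 := by positivity
  gcongr

lemma isClosed_badSet_inter {D : Set ℝ} (hD : IsClosed D)
    (hf : ∀ i, ContinuousOn (fun x => f x i) D) (hΘ : ∀ i, ContinuousOn (fun x => Θ x i) D)
    (e : ℕ) : IsClosed (badSet r f Θ e ∩ D) := by
  have : badSet r f Θ e ∩ D = D ∩ ⋂ (z : Fin (d + 2) → ℤ) (_ : (e : ℝ) + 1 ≤ |(z 0 : ℝ)|),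
      ⋃ (i : Fin (d + 2)) (_ : i ≠ 0), D ∩ (fun x => |z i + f x i * z 0 - Θ x i|) ⁻¹'
        Ici (1 / ((e : ℝ) + 1) * |(z 0 : ℝ)| ^ (-(r i))) := by
    ext x
    simp only [badSet, mem_inter_iff, Set.mem_ofPred_eq, mem_iInter, mem_iUnion, mem_preimage,
      mem_Ici]
    constructor
    · rintro ⟨h, hx⟩
      refine ⟨hx, fun z hz => ?_⟩
      obtain ⟨i, hi, hb⟩ := h z hz
      exact ⟨i, hi, hx, hb⟩
    · rintro ⟨hx, h⟩
      refine ⟨fun z hz => ?_, hx⟩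
      obtain ⟨i, hi, -, hb⟩ := h z hz
      exact ⟨i, hi, hb⟩
  rw [this]
  refine hD.inter (isClosed_iInter fun z => isClosed_iInter fun _ =>
    isClosed_iUnion_of_finite fun i => isClosed_iUnion_of_finite fun _ => ?_)
  refine ContinuousOn.preimage_isClosed_of_isClosed ?_ hD isClosed_Ici
  exact ((continuousOn_const.add ((hf i).mul continuousOn_const)).sub (hΘ i)).abs

/-- The quotients of derivatives. -/
noncomputable def quot (f : ℝ → Fin (d + 2) → ℝ) (x : ℝ) (i : Fin (d + 2)) : ℝ :=
  if i = 0 ∨ i = 1 then 0 else deriv (fun x => f x i) x / deriv (fun x => f x 1) x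

lemma analyticAt_quot {x₀ : ℝ} (hf : ∀ i, AnalyticAt ℝ (fun x => f x i) x₀)
    (h1 : deriv (fun x => f x 1) x₀ ≠ 0) (i : Fin (d + 2)) :
    AnalyticAt ℝ (fun x => quot f x i) x₀ := by
  unfold quot
  split_ifs
  · exact analyticAt_const
  · exact (hf i).deriv.div (hf 1).deriv h1

lemma exists_eventually_lip {g : ℝ → ℝ} {x₀ : ℝ} (hg : AnalyticAt ℝ g x₀) :
    ∃ K > 0, ∃ t ∈ nhds x₀, ∀ x ∈ t, ∀ y ∈ t, |g y - g x| ≤ K * |y - x| := by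
  obtain ⟨K, t, ht, h⟩ := (hg.contDiffAt (n := 1)).exists_lipschitzOnWith
  refine ⟨K + 1, by positivity, t, ht, fun x hx y hy => ?_⟩
  have := h.dist_le_mul y hy x hx
  rw [Real.dist_eq, Real.dist_eq] at this
  nlinarith [abs_nonneg (y - x)]

lemma exists_isCurve {x₀ : ℝ} (hf0 : ∀ x, f x 0 = 0)
    (hf : ∀ i, AnalyticAt ℝ (fun x => f x i) x₀) (h1 : deriv (fun x => f x 1) x₀ ≠ 0) :
    ∃ c K h, 0 < h ∧ IsCurve f (quot f) (Metric.closedBall x₀ h) c K := by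
  choose Kf hKf tf htf hlf using fun i => exists_eventually_lip (hf i)
  choose Kq hKq tq htq hlq using fun i => exists_eventually_lip (analyticAt_quot hf h1 i)
  set M := |deriv (fun x => f x 1) x₀| + 1 with hM
  have hM0 : 0 < M := by positivity
  set c := |deriv (fun x => f x 1) x₀| / 2 with hc
  have hc0 : 0 < c := by positivity
  have hbd : ∀ᶠ x in nhds x₀, |deriv (fun x => f x 1) x| < M :=
    (hf 1).deriv.continuousAt.abs.eventually (gt_mem_nhds (by rw [hM]; linarith))
  have hne : ∀ᶠ x in nhds x₀, deriv (fun x => f x 1) x ≠ 0 :=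
    (hf 1).deriv.continuousAt.eventually_ne h1
  have hdiff : ∀ i, ∀ᶠ x in nhds x₀, DifferentiableAt ℝ (fun x => f x i) x := fun i =>
    (hf i).eventually_analyticAt.mono fun x hx => hx.differentiableAt
  have hstrict := ((hf 1).hasStrictDerivAt.hasStrictFDerivAt.isLittleO).def hc0
  rw [nhds_prod_eq, eventually_prod_self_iff'] at hstrict
  obtain ⟨ts, hts, hs⟩ := hstrict
  have hall : ∀ᶠ x in nhds x₀, (∀ i, x ∈ tf i ∧ x ∈ tq i ∧
      DifferentiableAt ℝ (fun x => f x i) x) ∧ |deriv (fun x => f x 1) x| < M ∧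
      deriv (fun x => f x 1) x ≠ 0 ∧ x ∈ ts :=
    (eventually_all.2 fun i => (show ∀ᶠ x in nhds x₀, x ∈ tf i from htf i).and
      ((show ∀ᶠ x in nhds x₀, x ∈ tq i from htq i).and (hdiff i))).and
      (hbd.and (hne.and hts))
  obtain ⟨h, hh, hball⟩ := Metric.nhds_basis_closedBall.eventually_iff.1 hall
  set K := ∑ i, Kf i + (∑ i, Kq i) * (1 + M) with hK
  have hf0' : ∀ i, 0 ≤ Kf i := fun i => (hKf i).le
  have hq0' : ∀ i, 0 ≤ Kq i := fun i => (hKq i).le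
  have hSf : ∀ i, Kf i ≤ ∑ i, Kf i := fun i =>
    Finset.single_le_sum (fun j _ => hf0' j) (Finset.mem_univ i)
  have hSq : ∀ i, Kq i ≤ ∑ i, Kq i := fun i =>
    Finset.single_le_sum (fun j _ => hq0' j) (Finset.mem_univ i)
  have hF : ∀ i, Kf i ≤ K := fun i => by
    have := hSf i; have := hSq i; have := hq0' i; nlinarith
  have hQ : ∀ i, Kq i ≤ K := fun i => by
    have := hSf i; have := hSq i; have := hq0' i; have := hf0' i; nlinarith
  have hQM : ∀ i, Kq i * M ≤ K := fun i => by
    have := hSf i; have := hSq i; have := hq0' i; have := hf0' i; nlinarith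
  refine ⟨c, K, h, hh, hf0, fun x => by simp [quot], fun x => by simp [quot], hc0,
    (hKf 0).trans_le (hF 0), ?_, ?_, ?_, ?_⟩
  · intro x hx y hy
    have := hs y (hball hy).2.2.2 x (hball hx).2.2.2
    simp only [ContinuousLinearMap.toSpanSingleton_apply, Real.norm_eq_abs, smul_eq_mul] at this
    have h2 : |deriv (fun x => f x 1) x₀ * (y - x)| ≤ |f y 1 - f x 1| +
        |f y 1 - f x 1 - (y - x) * deriv (fun x => f x 1) x₀| := by
      refine le_trans (le_of_eq ?_) (abs_sub _ _)
      congr 1; ring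
    rw [abs_mul] at h2
    have : |deriv (fun x => f x 1) x₀| = 2 * c := by rw [hc]; ring
    rw [this] at h2
    linarith
  · intro x hx y hy i
    exact (hlf i x ((hball hx).1 i).1 y ((hball hy).1 i).1).trans
      (mul_le_mul_of_nonneg_right (hF i) (abs_nonneg _))
  · intro x hx y hy i
    exact (hlq i x ((hball hx).1 i).2.1 y ((hball hy).1 i).2.1).trans
      (mul_le_mul_of_nonneg_right (hQ i) (abs_nonneg _))
  · intro x hx y hy i hi
    by_cases hi0 : i = 0
    · subst hi0
      simp only [hf0, quot, true_or, if_true, sub_self, zero_mul, abs_zero]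
      have := (hKf 0).trans_le (hF 0)
      positivity
    have hseg : uIcc x y ⊆ Metric.closedBall x₀ h :=
      ((convex_closedBall x₀ h).ordConnected).uIcc_subset hx hy
    have hmv := (convex_uIcc x y).norm_image_sub_le_of_norm_hasDerivWithin_le
      (f := fun t => f t i - quot f x i * f t 1)
      (f' := fun t => deriv (fun x => f x i) t - quot f x i * deriv (fun x => f x 1) t)
      (C := Kq i * M * |y - x|) (fun t ht => ?_) (fun t ht => ?_) left_mem_uIcc right_mem_uIcc
    · rw [Real.norm_eq_abs, Real.norm_eq_abs] at hmv
      have e : f y i - quot f x i * f y 1 - (f x i - quot f x i * f x 1) =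
        f y i - f x i - quot f x i * (f y 1 - f x 1) := by ring
      rw [e] at hmv
      refine hmv.trans ?_
      have := hQM i
      have := mul_le_mul_of_nonneg_right this (sq_nonneg |y - x|)
      nlinarith
    · have ht' := hball (hseg ht)
      exact ((ht'.1 i).2.2.hasDerivAt.sub
        ((ht'.1 1).2.2.hasDerivAt.const_mul _)).hasDerivWithinAt
    · have ht' := hball (hseg ht)
      have e : deriv (fun x => f x i) t - quot f x i * deriv (fun x => f x 1) t =
          (quot f t i - quot f x i) * deriv (fun x => f x 1) t := by
        have : quot f t i = deriv (fun x => f x i) t / deriv (fun x => f x 1) t := by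
          simp [quot, hi0, hi]
        rw [sub_mul, this, div_mul_cancel₀ _ ht'.2.2.1]
      rw [e, Real.norm_eq_abs, abs_mul]
      have h3 := hlq i x ((hball hx).1 i).2.1 t (ht'.1 i).2.1
      have h4 : |t - x| ≤ |y - x| := abs_sub_left_of_mem_uIcc ht
      calc _ ≤ (Kq i * |y - x|) * M := mul_le_mul
            (h3.trans (mul_le_mul_of_nonneg_left h4 (hq0' i))) ht'.2.1.le (abs_nonneg _)
            (mul_nonneg (hq0' i) (abs_nonneg _))
        _ = _ := by ring

lemma isNondeg_closedBall {U : Set ℝ} (hU : U.OrdConnected)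
    (hf : ∀ i, AnalyticOnNhd ℝ (fun x => f x i) U) (hnd : IsNondeg f U) {a ρ : ℝ} (hρ : 0 < ρ)
    (ha : Metric.closedBall a ρ ⊆ U) : IsNondeg f (Metric.closedBall a ρ) := by
  intro b hb
  refine hnd b ?_
  have han : AnalyticOnNhd ℝ (fun x => ∑ i, b i * Function.update (f x) 0 1 i) U := by
    refine Finset.analyticOnNhd_fun_sum _ fun i _ => analyticOnNhd_const.mul ?_
    by_cases hi : i = 0
    · subst hi; simpa using analyticOnNhd_const
    · simpa [Function.update_of_ne hi] using hf i
  refine han.eqOn_zero_of_preconnected_of_eventuallyEq_zero hU.isPreconnected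
    (ha (Metric.mem_closedBall_self hρ.le)) ?_
  filter_upwards [Metric.closedBall_mem_nhds a hρ] with x hx using hb x hx

theorem exists_wins_badSet {U : Set ℝ} (hU : IsOpen U) (hUc : U.OrdConnected)
    (hf0 : ∀ x, f x 0 = 0) (hf : ∀ i, AnalyticOnNhd ℝ (fun x => f x i) U) (hnd : IsNondeg f U)
    (hr : IsWeight r m) {x₀ : ℝ} (hx₀ : x₀ ∈ U) (h1 : deriv (fun x => f x 1) x₀ ≠ 0)
    (hΘ : ∃ Kθ, 0 ≤ Kθ ∧ ∃ t ∈ nhds x₀, ∀ x ∈ t, ∀ y ∈ t, ∀ i,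
      |Θ y i - Θ x i| ≤ Kθ * |y - x|) :
    ∃ h > 0, ∀ β, 0 < β → β ≤ 1 / 3 →
      Wins β (Metric.closedBall x₀ h) (⋃ e, badSet r f Θ e) := by
  obtain ⟨c, K, h, hh, hc⟩ := exists_isCurve hf0 (fun i => hf i x₀ hx₀) h1
  obtain ⟨Kθ, hKθ, t, ht, hΘ⟩ := hΘ
  have hq := fun i => analyticAt_quot (fun i => hf i x₀ hx₀) h1 i
  set P := ∑ i, |quot f x₀ i| + 1 with hP
  have hPi : ∀ i, |quot f x₀ i| < P := fun i => by
    have := Finset.single_le_sum (f := fun i => |quot f x₀ i|) (fun j _ => abs_nonneg _)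
      (Finset.mem_univ i)
    rw [hP]; linarith
  have hPev : ∀ᶠ x in nhds x₀, ∀ i, |quot f x i| < P :=
    eventually_all.2 fun i => (hq i).continuousAt.abs.eventually (gt_mem_nhds (hPi i))
  obtain ⟨h', hh', hball⟩ := Metric.nhds_basis_closedBall.eventually_iff.1
    ((hPev.and (ht : ∀ᶠ x in nhds x₀, x ∈ t)).and
      ((show ∀ᶠ x in nhds x₀, x ∈ U from hU.mem_nhds hx₀).and (Metric.closedBall_mem_nhds x₀ hh)))
  set D := Metric.closedBall x₀ h' with hD
  have hDsub : D ⊆ Metric.closedBall x₀ h := fun x hx => (hball hx).2.2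
  have hc' : IsCurve f (quot f) D c K :=
    ⟨hc.f_zero, hc.ψ_zero, hc.ψ_one, hc.c_pos, hc.K_pos,
      fun x hx y hy => hc.le_f_one x (hDsub hx) y (hDsub hy),
      fun x hx y hy => hc.f_lip x (hDsub hx) y (hDsub hy),
      fun x hx y hy => hc.ψ_lip x (hDsub hx) y (hDsub hy),
      fun x hx y hy => hc.taylor x (hDsub hx) y (hDsub hy)⟩
  have hΘD : ∀ x ∈ D, ∀ y ∈ D, ∀ i, |Θ y i - Θ x i| ≤ Kθ * |y - x| :=
    fun x hx y hy i => hΘ x (hball hx).1.2 y (hball hy).1.2 i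
  obtain ⟨h₀, hh₀, hmain⟩ := exists_branch_mem_badSet (P := P) hc' hr
    (fun i => hf i x₀ hx₀) hq (by positivity) (fun x hx i => ((hball hx).1.1 i).le) hKθ
    (fun a ρ hρ ha => isNondeg_closedBall hUc hf hnd hρ (ha.trans fun x hx => (hball hx).2.1)) hΘD
  refine ⟨min h' h₀, lt_min hh' hh₀, fun β hβ0 hβ => ?_⟩
  have hsub1 : Metric.closedBall x₀ (min h' h₀) ⊆ D :=
    Metric.closedBall_subset_closedBall (min_le_left _ _)
  have hsub2 : Metric.closedBall x₀ (min h' h₀) ⊆ Metric.closedBall x₀ h₀ :=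
    Metric.closedBall_subset_closedBall (min_le_right _ _)
  refine wins_iUnion hβ0 hβ badSet_mono (fun e => isClosed_badSet_inter Metric.isClosed_closedBall
    (fun i => ((hf i).continuousOn).mono (hsub1.trans fun x hx => (hball hx).2.1))
    (fun i => ?_) e) ?_
  · refine (LipschitzOnWith.of_dist_le_mul (K := ⟨Kθ, hKθ⟩) fun x hx y hy => ?_).continuousOn
    rw [Real.dist_eq, Real.dist_eq]
    exact hΘD y (hsub1 hy) x (hsub1 hx) i
  · intro a ρ hρ hρ1 ha
    obtain ⟨e, he⟩ := hmain β hβ0 (by linarith) a ρ hρ hρ1 (ha.trans hsub2) (ha.trans hsub1)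
    exact ⟨e, he⟩

end

section

/-! ### Curves with possibly vanishing weights -/

lemma countable_zeros {U : Set ℝ} (hUc : U.OrdConnected) {g : ℝ → ℝ} (hg : AnalyticOnNhd ℝ g U)
    (hne : ∃ x ∈ U, g x ≠ 0) : {x ∈ U | g x = 0}.Countable := by
  obtain ⟨x, hx, hgx⟩ := hne
  obtain ⟨t, -, htc, hcov⟩ := TopologicalSpace.countable_cover_nhdsWithin
    (s := {x ∈ U | g x = 0}) (f := fun z => {w | w ≠ z → g w ≠ 0}) (fun z hz => by
      refine mem_nhdsWithin_of_mem_nhds ?_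
      rcases (hg z hz.1).eventually_eq_zero_or_eventually_ne_zero with h | h
      · exact absurd (hg.eqOn_zero_of_preconnected_of_eventuallyEq_zero hUc.isPreconnected
          hz.1 h hx) hgx
      · exact eventually_nhdsWithin_iff.1 h)
  refine htc.mono fun z hz => ?_
  obtain ⟨w, hw, hzw⟩ := mem_iUnion₂.1 (hcov hz)
  by_cases h : z = w
  · rwa [h]
  · exact absurd hz.2 (hzw h)

lemma countable_critical {U : Set ℝ} (hU : IsOpen U) (hUc : U.OrdConnected) {n : ℕ}
    {φ : ℝ → Fin n → ℝ} (hφ : AnalyticOnNhd ℝ φ U)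
    (hnd : ∀ (a : ℝ) (b : Fin n → ℝ), (∀ x ∈ U, a + ∑ k, b k * φ x k = 0) → a = 0 ∧ b = 0)
    (k : Fin n) : {x ∈ U | deriv (fun x => φ x k) x = 0}.Countable := by
  have hk : AnalyticOnNhd ℝ (fun x => φ x k) U := analyticOnNhd_pi_iff.1 hφ k
  refine countable_zeros hUc hk.deriv ?_
  by_contra! hcon
  obtain ⟨c, hc⟩ := hU.exists_is_const_of_deriv_eq_zero hUc.isPreconnected
    (fun x hx => (hk x hx).differentiableAt.differentiableWithinAt) hcon
  have := (hnd (-c) (Pi.single k 1) fun x hx => by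
    have := hc x hx
    simp only [Pi.single_apply, ite_mul, one_mul, zero_mul, Finset.sum_ite_eq', Finset.mem_univ,
      if_true]
    linarith).2
  have := congr_fun this k
  simp at this

lemma sum_subtype_pos {n : ℕ} {r g : Fin n → ℝ} (h : ∀ k, ¬ 0 < r k → g k = 0) :
    ∑ k : {k // 0 < r k}, g k = ∑ k, g k := by
  rw [← Finset.sum_filter_of_ne (p := fun k => 0 < r k) fun k _ hk => not_imp_comm.1 (h k) hk]
  exact (Finset.sum_subtype (Finset.univ.filter fun k => 0 < r k) (by simp) g).symm

/-- Reindexing of the positive entries of a weight, starting with a maximal one. -/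
lemma exists_reindex {n : ℕ} {r : Fin n → ℝ} (hr1 : ∑ k, r k = 1) :
    ∃ (d : ℕ) (e : Fin (d + 1) ≃ {k // 0 < r k}), ∀ k, r k ≤ r (e 0) := by
  have hne : Nonempty (Fin n) := by
    by_contra h
    rw [not_nonempty_iff] at h
    simp at hr1
  obtain ⟨k₀, hk₀⟩ := Finite.exists_max r
  have hpos : 0 < r k₀ := by
    by_contra h
    have : ∑ k, r k ≤ 0 := Finset.sum_nonpos fun k _ => (hk₀ k).trans (not_lt.1 h)
    linarith
  obtain ⟨d, hd⟩ : ∃ d, Fintype.card {k // 0 < r k} = d + 1 :=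
    Nat.exists_eq_add_one.2 (Fintype.card_pos_iff.2 ⟨⟨k₀, hpos⟩⟩)
  let e₀ := (Fintype.equivFinOfCardEq hd).symm
  refine ⟨d, (Equiv.swap 0 (e₀.symm ⟨k₀, hpos⟩)).trans e₀, fun k => ?_⟩
  simpa using hk₀ k

section

variable {n d : ℕ} {r : Fin n → ℝ} (e : Fin (d + 1) ≃ {k // 0 < r k})

/-- Reindexing of a vector, with an additional entry `0`. -/
def reindex (v : Fin n → ℝ) : Fin (d + 2) → ℝ := Fin.cons 0 fun j => v (e j)

@[simp] lemma reindex_zero (v : Fin n → ℝ) : reindex e v 0 = 0 := rfl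

@[simp] lemma reindex_succ (v : Fin n → ℝ) (j : Fin (d + 1)) :
    reindex e v j.succ = v (e j) := rfl

lemma reindex_one (v : Fin n → ℝ) : reindex e v 1 = v (e 0) := rfl

lemma exists_isWeight_reindex (hr0 : ∀ k, 0 ≤ r k) (hr1 : ∑ k, r k = 1)
    (hmax : ∀ k, r k ≤ r (e 0)) : ∃ m, IsWeight (reindex e r) m := by
  obtain ⟨j₀, hj₀⟩ := Finite.exists_min fun j => r (e j)
  refine ⟨r (e j₀), rfl, (e j₀).2, ?_, ?_, ?_⟩
  · intro i hi
    obtain ⟨j, rfl⟩ := Fin.exists_succ_eq.2 hi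
    exact hj₀ j
  · intro i
    rw [reindex_one]
    refine Fin.cases ?_ (fun j => ?_) i
    · exact hr0 _
    · exact hmax _
  · rw [Fin.sum_univ_succ, reindex_zero, zero_add]
    simp only [reindex_succ]
    rw [e.sum_comp fun k => r k, ← hr1]
    exact sum_subtype_pos fun k hk => le_antisymm (not_lt.1 hk) (hr0 k)

lemma isNondeg_reindex {U : Set ℝ} {φ : ℝ → Fin n → ℝ}
    (hnd : ∀ (a : ℝ) (b : Fin n → ℝ), (∀ x ∈ U, a + ∑ k, b k * φ x k = 0) → a = 0 ∧ b = 0) :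
    IsNondeg (fun x => reindex e (φ x)) U := by
  classical
  intro a ha
  have key := hnd (a 0) (fun k => if h : 0 < r k then a (e.symm ⟨k, h⟩).succ else 0) fun x hx => by
    have := ha x hx
    rw [Fin.sum_univ_succ] at this
    refine Eq.trans ?_ this
    congr 1
    · simp
    · have h1 : ∀ j : Fin (d + 1), a j.succ * Function.update (reindex e (φ x)) 0 1 j.succ =
          (fun k : {k // 0 < r k} => a (e.symm k).succ * φ x k) (e j) := by
        intro j
        simp
      rw [Finset.sum_congr rfl fun j _ => h1 j,
        e.sum_comp fun k : {k // 0 < r k} => a (e.symm k).succ * φ x k, ← sum_subtype_pos (r := r)]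
      · refine Finset.sum_congr rfl fun k _ => ?_
        rw [dif_pos k.2]
      · intro k hk
        rw [dif_neg hk, zero_mul]
  funext i
  refine Fin.cases key.1 (fun j => ?_) i
  have := congr_fun key.2 (e j)
  simpa [(e j).2] using this

lemma badLiminf_pos {y θv : Fin n → ℝ} {N : ℕ}
    {m : ℝ} (hm : IsWeight (reindex e r) m)
    (h : ∀ z : Fin (d + 2) → ℤ, (N : ℝ) + 1 ≤ |(z 0 : ℝ)| → ∃ i, i ≠ 0 ∧
      1 / ((N : ℝ) + 1) * |(z 0 : ℝ)| ^ (-(reindex e r i)) ≤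
        |z i + reindex e y i * z 0 - reindex e θv i|) :
    0 < badLiminf r y θv := by
  set c : ℝ := 1 / ((N : ℝ) + 1) with hc
  have hc0 : 0 < c := by positivity
  have hc1 : c ≤ 1 := by rw [hc, div_le_one (by positivity)]; linarith [N.cast_nonneg (α := ℝ)]
  refine lt_of_lt_of_le (b := ENNReal.ofReal (c ^ (1 / m))) (by simpa using by positivity) ?_
  refine le_liminf_of_le (by isBoundedDefault) ?_
  have hev : ∀ᶠ q : ℤ in comap (fun q : ℤ => |q|) atTop, (N : ℤ) + 1 ≤ |q| :=
    tendsto_comap.eventually (eventually_ge_atTop _)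
  filter_upwards [hev] with q hq
  refine ENNReal.ofReal_le_ofReal ?_
  have hq' : (N : ℝ) + 1 ≤ |(q : ℝ)| := by exact_mod_cast hq
  have hq0 : 0 < |(q : ℝ)| := lt_of_lt_of_le (by positivity) hq'
  obtain ⟨i, hi, hb⟩ := h (Fin.cons q fun j => -round ((q : ℝ) * y (e j) - θv (e j))) hq'
  obtain ⟨j, rfl⟩ := Fin.exists_succ_eq.2 hi
  have hmr : m ≤ r (e j) := hm.le _ hi
  have hrj : 0 < r (e j) := (e j).2
  simp only [Fin.cons_zero, Fin.cons_succ, reindex_succ, Int.cast_neg] at hb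
  have hd : c * |(q : ℝ)| ^ (-(r (e j))) ≤ distInt ((q : ℝ) * y (e j) - θv (e j)) := by
    refine hb.trans_eq ?_
    unfold distInt
    congr 1; ring
  have hw : c ^ (1 / m) * |(q : ℝ)|⁻¹ ≤
      wpow (distInt ((q : ℝ) * y (e j) - θv (e j))) (r (e j)) := by
    rw [wpow, if_neg hrj.ne']
    refine le_trans ?_ (Real.rpow_le_rpow (by positivity) hd (by positivity))
    rw [Real.mul_rpow hc0.le (by positivity), ← Real.rpow_mul hq0.le]
    have : -(r (e j)) * (1 / r (e j)) = -1 := by field_simp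
    rw [this, Real.rpow_neg_one]
    refine mul_le_mul_of_nonneg_right ?_ (by positivity)
    exact Real.rpow_le_rpow_of_exponent_ge hc0 hc1 (one_div_le_one_div_of_le hm.pos hmr)
  calc c ^ (1 / m) = c ^ (1 / m) * |(q : ℝ)|⁻¹ * |(q : ℝ)| := by field_simp
    _ ≤ _ := mul_le_mul_of_nonneg_right (hw.trans
      (le_ciSup (f := fun i => wpow (distInt ((q : ℝ) * y i - θv i)) (r i))
        (Set.finite_range _).bddAbove _)) hq0.le

end

end

/-! ### The theorem for countable families -/

lemma exists_family {n : ℕ} {θ : (Fin n → ℝ) → Fin n → ℝ}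
    (hθ : ∀ k, ∃ d > 0, ∀ x y : Fin n → ℝ, |θ x k - θ y k| ≤ d * ‖x - y‖)
    {r : Fin n → ℝ} (hr0 : ∀ k, 0 ≤ r k) (hr1 : ∑ k, r k = 1)
    {U : Set ℝ} (hU : IsOpen U) (hUc : U.OrdConnected) {φ : ℝ → Fin n → ℝ}
    (hφ : AnalyticOnNhd ℝ φ U)
    (hnd : ∀ (a : ℝ) (b : Fin n → ℝ), (∀ x ∈ U, a + ∑ k, b k * φ x k = 0) → a = 0 ∧ b = 0) :
    ∃ F : Set (Set ℝ × Set ℝ), F.Countable ∧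
      (∀ p ∈ F, ∀ β, 0 < β → β ≤ 1 / 3 → Wins β p.1 p.2) ∧
      ∀ y ∈ U, (∀ p ∈ F, y ∈ interior p.1 → y ∈ p.2) → 0 < badLiminf r (φ y) (θ (φ y)) := by
  obtain ⟨d, e, hmax⟩ := exists_reindex hr1
  obtain ⟨m, hm⟩ := exists_isWeight_reindex e hr0 hr1 hmax
  have hφk : ∀ k, AnalyticOnNhd ℝ (fun x => φ x k) U := analyticOnNhd_pi_iff.1 hφ
  have hf : ∀ i, AnalyticOnNhd ℝ (fun x => reindex e (φ x) i) U := fun i =>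
    Fin.cases (motive := fun i => AnalyticOnNhd ℝ (fun x => reindex e (φ x) i) U)
      analyticOnNhd_const (fun j => hφk (e j)) i
  have hΘ : ∀ x₀ ∈ U, ∃ Kθ, 0 ≤ Kθ ∧ ∃ t ∈ nhds x₀, ∀ x ∈ t, ∀ y ∈ t, ∀ i,
      |reindex e (θ (φ y)) i - reindex e (θ (φ x)) i| ≤ Kθ * |y - x| := by
    intro x₀ hx₀
    choose D hD0 hD using hθ
    obtain ⟨K, t, ht, h⟩ := ((hφ x₀ hx₀).contDiffAt (n := 1)).exists_lipschitzOnWith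
    have hS : 0 ≤ ∑ k, D k := Finset.sum_nonneg fun k _ => (hD0 k).le
    refine ⟨(∑ k, D k) * K, by positivity, t, ht, fun x hx y hy i => ?_⟩
    refine Fin.cases ?_ (fun j => ?_) i
    · simp only [reindex_zero, sub_self, abs_zero]
      positivity
    · simp only [reindex_succ]
      have h1 := h.dist_le_mul y hy x hx
      rw [dist_eq_norm, Real.dist_eq] at h1
      calc _ ≤ D (e j) * ‖φ y - φ x‖ := hD _ _ _
        _ ≤ (∑ k, D k) * (K * |y - x|) := by
          refine mul_le_mul ?_ h1 (norm_nonneg _) hS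
          exact Finset.single_le_sum (fun k _ => (hD0 k).le) (Finset.mem_univ _)
        _ = _ := by ring
  have hloc : ∀ x₀ ∈ {x ∈ U | deriv (fun x => φ x (e 0)) x ≠ 0}, ∃ h > 0, ∀ β, 0 < β →
      β ≤ 1 / 3 → Wins β (Metric.closedBall x₀ h) (⋃ N, badSet (reindex e r)
        (fun x => reindex e (φ x)) (fun x => reindex e (θ (φ x))) N) := fun x₀ hx₀ =>
    exists_wins_badSet hU hUc (fun x => reindex_zero e _) hf (isNondeg_reindex e hnd) hm hx₀.1
      hx₀.2 (hΘ x₀ hx₀.1)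
  choose! h hh0 hh using hloc
  obtain ⟨t, hts, htc, hcov⟩ := TopologicalSpace.countable_cover_nhdsWithin
    (s := {x ∈ U | deriv (fun x => φ x (e 0)) x ≠ 0}) (f := fun x => Metric.ball x (h x))
    fun x hx => mem_nhdsWithin_of_mem_nhds (Metric.ball_mem_nhds x (hh0 x hx))
  refine ⟨(fun z => (univ, {z}ᶜ)) '' {x ∈ U | deriv (fun x => φ x (e 0)) x = 0} ∪
    (fun x => (Metric.closedBall x (h x), ⋃ N, badSet (reindex e r)
        (fun x => reindex e (φ x)) (fun x => reindex e (θ (φ x))) N)) '' t,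
    ((countable_critical hU hUc hφ hnd (e 0)).image _).union (htc.image _), ?_, ?_⟩
  · rintro p (⟨z, -, rfl⟩ | ⟨x, hx, rfl⟩) β hβ hβ'
    · exact wins_compl_singleton hβ z
    · exact hh x (hts hx) β hβ hβ'
  · intro y hy hF
    have hy0 : deriv (fun x => φ x (e 0)) y ≠ 0 := fun h0 =>
      hF _ (Or.inl ⟨y, ⟨hy, h0⟩, rfl⟩) (by simp) rfl
    obtain ⟨x, hx, hyx⟩ := mem_iUnion₂.1 (hcov ⟨hy, hy0⟩)
    obtain ⟨N, hN⟩ := mem_iUnion.1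
      (hF _ (Or.inr ⟨x, hx, rfl⟩) (Metric.ball_subset_interior_closedBall hyx))
    exact badLiminf_pos e hm hN

end BadCurve


open BadCurve in
theorem stmt1 (n : ℕ → ℕ)
    (θ : (i : ℕ) → ℕ → (Fin (n i) → ℝ) → (Fin (n i) → ℝ))
    -- each coordinate of each `θ^i_j` is Lipschitz (w.r.t. the sup norm on `Fin (n i) → ℝ`)
    (hθ_lip : ∀ i j k, ∃ d > 0, ∀ x y : Fin (n i) → ℝ,
      |θ i j x k - θ i j y k| ≤ d * ‖x - y‖)
    (W : (i : ℕ) → Set (Fin (n i) → ℝ))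
    (hW_count : ∀ i, (W i).Countable)
    (hW_weight : ∀ i, ∀ r ∈ W i, (∀ k, 0 ≤ r k) ∧ ∑ k, r k = 1)
    (U : Set ℝ) (hU_open : IsOpen U) (hU_conn : U.OrdConnected)
    (φ : (i : ℕ) → ℝ → Fin (n i) → ℝ)
    (hφ_an : ∀ i, AnalyticOnNhd ℝ (φ i) U)
    -- nondegeneracy of each `φᵢ`
    (hφ_nd : ∀ i, ∀ (a : ℝ) (b : Fin (n i) → ℝ),
      (∀ x ∈ U, a + ∑ k, b k * φ i x k = 0) → a = 0 ∧ b = 0)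
    (μ : Measure ℝ)
    -- `μ` is Ahlfors regular
    (hμ_reg : ∃ C ≥ (1:ℝ), ∃ α > (0:ℝ), ∃ ρ₀ > (0:ℝ),
      ∀ x ∈ msupport μ, ∀ ρ : ℝ, 0 < ρ → ρ ≤ ρ₀ →
        ENNReal.ofReal (C⁻¹ * ρ ^ α) ≤ μ (Metric.ball x ρ) ∧
          μ (Metric.ball x ρ) ≤ ENNReal.ofReal (C * ρ ^ α))
    (hUμ : (U ∩ msupport μ).Nonempty) :
    dimH ((⋂ i, ⋂ r ∈ W i, ⋂ j,
        {x ∈ U | 0 < badLiminf r (φ i x) (θ i j (φ i x))}) ∩ msupport μ)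
      = dimH (msupport μ) := by
  obtain ⟨C, hC, α, hα, ρ₀, hρ₀, hμ⟩ := hμ_reg
  have hA : IsAhlfors μ C α ρ₀ := ⟨hC, hα, hρ₀, fun x hx ρ h0 h1 => (hμ x hx ρ h0 h1).1,
    fun x hx ρ h0 h1 => (hμ x hx ρ h0 h1).2⟩
  refine le_antisymm (dimH_mono inter_subset_right) ((dimH_msupport_le hA).trans ?_)
  have hfam : ∀ i, ∀ r ∈ W i, ∀ j, ∃ F : Set (Set ℝ × Set ℝ), F.Countable ∧
      (∀ p ∈ F, ∀ β, 0 < β → β ≤ 1 / 3 → Wins β p.1 p.2) ∧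
      ∀ y ∈ U, (∀ p ∈ F, y ∈ interior p.1 → y ∈ p.2) →
        0 < badLiminf r (φ i y) (θ i j (φ i y)) := fun i r hr j =>
    exists_family (hθ_lip i j) (hW_weight i r hr).1 (hW_weight i r hr).2 hU_open hU_conn
      (hφ_an i) (hφ_nd i)
  choose! F hFc hFw hF using hfam
  obtain ⟨G, hG⟩ : ∃ G : ℕ → Set ℝ × Set ℝ,
      insert (univ, univ) (⋃ i, ⋃ r ∈ W i, ⋃ j, F i r j) = range G := by
    refine Countable.exists_eq_range (Countable.insert _ ?_) (insert_nonempty _ _)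
    exact countable_iUnion fun i => (hW_count i).biUnion fun r hr =>
      countable_iUnion fun j => hFc i r hr j
  refine le_dimH_of_wins hA (D := fun c => (G c).1) (S := fun c => (G c).2) ?_ hU_open hUμ ?_
  · intro c
    have hc : G c ∈ insert (univ, univ) (⋃ i, ⋃ r ∈ W i, ⋃ j, F i r j) := hG ▸ mem_range_self c
    rcases hc with hc | hc
    · intro β _ _
      rw [hc]
      exact ⟨fun _ _ => 0, fun _ _ _ _ _ _ _ _ _ => mem_univ _⟩
    · simp only [mem_iUnion] at hc
      obtain ⟨i, r, hr, j, hc⟩ := hc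
      exact hFw i r hr j _ hc
  · intro y hy hyG
    simp only [mem_iInter]
    refine fun i r hr j => ⟨hy, hF i r hr j y hy fun p hp hyp => ?_⟩
    obtain ⟨c, rfl⟩ : p ∈ range G := by
      rw [← hG]
      refine Or.inr ?_
      simp only [mem_iUnion]
      exact ⟨i, r, hr, j, hp⟩
    exact hyG c hyp
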